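/- For each prime ℓ ≥ 5 there exists a constant C = C(ℓ) such that for every real X ≥ 2, the sum over squarefree integers 0 < d ≤ X of |Cl_{ℚ(√−d)}[ℓ]|² is at most C · X^{2 − 3/(ℓ+1)}. -/

import Mathlib

open NumberField IntermediateField
open scoped Classical

/-- The order of the `ℓ`-torsion subgroup of the class group of a number field `K`. -/
noncomputable def clTor (K : Type*) [Field K] (ℓ : ℕ) : ℕ :=
  Nat.card {c : ClassGroup (𝓞 K) // c ^ ℓ = 1}

/-- The imaginary quadratic field `ℚ(√-d)`, realized inside `ℂ` as `ℚ(i·√d)`. -/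
noncomputable def Qneg (d : ℕ) : IntermediateField ℚ ℂ :=
  ℚ⟮(Complex.I * (Real.sqrt d : ℂ) : ℂ)⟯

/-- primes in `(a,b]` -/
noncomputable def pr (a b : ℕ) : Finset ℕ := (Finset.Ioc a b).filter Nat.Prime

/-- sum of reciprocals of primes in `(a,b]` -/
noncomputable def rp (a b : ℕ) : ℝ := ∑ p ∈ pr a b, (1 / (p : ℝ))

lemma mem_pr {a b p : ℕ} : p ∈ pr a b ↔ a < p ∧ p ≤ b ∧ p.Prime := by
  simp [pr, and_assoc]

lemma rp_nonneg (a b : ℕ) : 0 ≤ rp a b := Finset.sum_nonneg fun _ _ => by positivity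

lemma pr_union {a b c : ℕ} (h1 : a ≤ b) (h2 : b ≤ c) : pr a c = pr a b ∪ pr b c := by
  ext p; simp only [Finset.mem_union, mem_pr]; constructor
  · rintro ⟨h, h', h''⟩
    by_cases hb : p ≤ b
    · exact Or.inl ⟨h, hb, h''⟩
    · exact Or.inr ⟨by omega, h', h''⟩
  · rintro (⟨h, h', h''⟩ | ⟨h, h', h''⟩)
    · exact ⟨h, by omega, h''⟩
    · exact ⟨by omega, h', h''⟩

lemma pr_disj (a b c : ℕ) : Disjoint (pr a b) (pr b c) := by
  rw [Finset.disjoint_left]; intro p h h'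
  rw [mem_pr] at h h'; omega

lemma sum_pr_split {a b c : ℕ} (h1 : a ≤ b) (h2 : b ≤ c) (f : ℕ → ℝ) :
    ∑ p ∈ pr a c, f p = ∑ p ∈ pr a b, f p + ∑ p ∈ pr b c, f p := by
  rw [pr_union h1 h2, Finset.sum_union (pr_disj a b c)]

lemma rp_split {a b c : ℕ} (h1 : a ≤ b) (h2 : b ≤ c) : rp a c = rp a b + rp b c :=
  sum_pr_split h1 h2 _

lemma theta_eq_pr (N : ℕ) : Chebyshev.theta N = ∑ p ∈ pr 0 N, Real.log p := by
  simp [Chebyshev.theta, pr]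

lemma log_ge_primeFactors {n N : ℕ} (hn : 0 < n) (hN : n ≤ N) :
    ∑ p ∈ (pr 0 N).filter (· ∣ n), Real.log p ≤ Real.log n := by
  have : (pr 0 N).filter (· ∣ n) = n.primeFactors := by
    ext p; simp only [Finset.mem_filter, mem_pr, Nat.mem_primeFactors]
    constructor
    · rintro ⟨⟨_, _, h⟩, h'⟩; exact ⟨h, h', hn.ne'⟩
    · rintro ⟨h, h', _⟩
      exact ⟨⟨h.pos, (Nat.le_of_dvd hn h').trans hN, h⟩, h'⟩
  rw [this, ← Real.log_prod]
  · apply Real.log_le_log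
    · apply Finset.prod_pos; intro p hp; exact_mod_cast (Nat.prime_of_mem_primeFactors hp).pos
    · rw [← Nat.cast_prod]
      exact_mod_cast Nat.le_of_dvd hn (Nat.prod_primeFactors_dvd n)
  · intro p hp; exact_mod_cast (Nat.prime_of_mem_primeFactors hp).ne_zero

/-- Mertens 1, upper bound -/
lemma mertens_one (N : ℕ) (hN : 1 ≤ N) :
    ∑ p ∈ pr 0 N, Real.log p / p ≤ Real.log N + Real.log 4 := by
  have h1 : ∑ n ∈ Finset.Ioc 0 N, ∑ p ∈ (pr 0 N).filter (· ∣ n), Real.log p ≤ N * Real.log N := by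
    calc _ ≤ ∑ n ∈ Finset.Ioc 0 N, Real.log N := by
          apply Finset.sum_le_sum; intro n hn
          rw [Finset.mem_Ioc] at hn
          refine (log_ge_primeFactors hn.1 hn.2).trans ?_
          exact Real.log_le_log (by exact_mod_cast hn.1) (by exact_mod_cast hn.2)
      _ = _ := by simp
  have h2 : ∑ n ∈ Finset.Ioc 0 N, ∑ p ∈ (pr 0 N).filter (· ∣ n), Real.log p
      = ∑ p ∈ pr 0 N, ((N / p : ℕ) : ℝ) * Real.log p := by
    simp_rw [Finset.sum_filter]
    rw [Finset.sum_comm]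
    apply Finset.sum_congr rfl; intro p hp
    rw [← Finset.sum_filter, Finset.sum_const, Nat.Ioc_filter_dvd_card_eq_div, nsmul_eq_mul]
  have h3 : ∑ p ∈ pr 0 N, ((N : ℝ) / p - 1) * Real.log p ≤ 
      ∑ p ∈ pr 0 N, ((N / p : ℕ) : ℝ) * Real.log p := by
    apply Finset.sum_le_sum; intro p hp
    have hp' := (mem_pr.1 hp).2.2
    apply mul_le_mul_of_nonneg_right _ (Real.log_nonneg (by exact_mod_cast hp'.one_lt.le))
    have : (N : ℝ) / p < (N / p : ℕ) + 1 := by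
      rw [div_lt_iff₀ (by exact_mod_cast hp'.pos)]
      have := Nat.lt_div_mul_add (a := N) hp'.pos
      have h : N < (N / p + 1) * p := by rw [add_mul]; simpa using this
      exact_mod_cast h
    linarith
  have h4 : ∑ p ∈ pr 0 N, ((N : ℝ) / p - 1) * Real.log p
      = N * ∑ p ∈ pr 0 N, Real.log p / p - Chebyshev.theta N := by
    rw [theta_eq_pr, Finset.mul_sum, ← Finset.sum_sub_distrib]
    apply Finset.sum_congr rfl; intro p hp; ring
  have h5 := Chebyshev.theta_le_log4_mul_x (x := N) (by positivity)
  have hN' : (0:ℝ) < N := by exact_mod_cast hN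
  have : N * ∑ p ∈ pr 0 N, Real.log p / p ≤ N * (Real.log N + Real.log 4) := by
    nlinarith
  exact le_of_mul_le_mul_left this hN'

lemma pr_succ (a N : ℕ) (h : a ≤ N) (f : ℕ → ℝ) : ∑ p ∈ pr a (N+1), f p
    = ∑ p ∈ pr a N, f p + if (N+1).Prime then f (N+1) else 0 := by
  rw [sum_pr_split h (Nat.le_succ N)]
  congr 1
  split_ifs with hp
  · rw [Finset.sum_eq_single (N+1)]
    · intro b hb hb'; rw [mem_pr] at hb; omega
    · intro hb; rw [mem_pr] at hb; exact absurd ⟨by omega, le_rfl, hp⟩ hb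
  · apply Finset.sum_eq_zero; intro b hb; rw [mem_pr] at hb
    have : b = N + 1 := by omega
    subst this; exact absurd hb.2.2 hp

/-- Mertens 2, upper bound -/
lemma mertens_upper : ∃ C : ℝ, 0 ≤ C ∧ ∀ N : ℕ, 2 ≤ N → rp 0 N ≤ Real.log (Real.log N) + C := by
  set c := Real.log 4 with hc
  have hc0 : 0 ≤ c := Real.log_nonneg (by norm_num)
  have key : ∀ N : ℕ, 2 ≤ N → rp 0 N - (∑ p ∈ pr 0 N, Real.log p / p) / Real.log N
      ≤ Real.log (Real.log N) - c / Real.log N + (rp 0 2 + c / Real.log 2 - Real.log (Real.log 2)) := by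
    intro N hN
    induction N, hN using Nat.le_induction with
    | base =>
      have h2 : 0 ≤ (∑ p ∈ pr 0 2, Real.log p / p) / Real.log (2:ℕ) := by
        apply div_nonneg
        · apply Finset.sum_nonneg; intro p _; positivity
        · positivity
      push_cast at *
      linarith
    | succ N hN ih =>
      have hA := mertens_one N (by omega)
      have hlN : 0 < Real.log N := Real.log_pos (by exact_mod_cast (by omega : 1 < N))
      have hlN1 : 0 < Real.log ((N+1 : ℕ)) := Real.log_pos (by exact_mod_cast (by omega : 1 < N+1))
      have hle : Real.log N ≤ Real.log ((N+1 : ℕ)) := Real.log_le_log (by positivity) (by push_cast; linarith)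
      set A := ∑ p ∈ pr 0 N, Real.log p / p with hAdef
      set a := Real.log N with ha
      set b := Real.log ((N+1 : ℕ)) with hb
      have e1 : rp 0 (N+1) - (∑ p ∈ pr 0 (N+1), Real.log p / p) / b = rp 0 N - A / b := by
        unfold rp
        rw [pr_succ 0 N (by omega), pr_succ 0 N (by omega)]
        split_ifs with hp
        · field_simp; ring
        · simp [hAdef]
      rw [e1]
      have h3 : A * (1 / a - 1 / b) ≤ (a + c) * (1 / a - 1/b) := by
        apply mul_le_mul_of_nonneg_right hA
        have := one_div_le_one_div_of_le hlN hle
        linarith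
      have h4 : 1 - a / b ≤ Real.log b - Real.log a := by
        rw [← Real.log_div hlN1.ne' hlN.ne']
        have := Real.one_sub_inv_le_log_of_pos (x := b / a) (by positivity)
        rwa [inv_div] at this
      have h5 : (a + c) * (1 / a - 1/b) = 1 - a / b + c / a - c / b := by field_simp; ring
      have h6 : A * (1 / a - 1 / b) = A / a - A / b := by ring
      linarith
  refine ⟨|1 + c / Real.log 2 + (rp 0 2 + c / Real.log 2 - Real.log (Real.log 2))|, abs_nonneg _, ?_⟩
  intro N hN
  have h1 := key N hN
  have hlN : 0 < Real.log N := Real.log_pos (by exact_mod_cast (by omega : 1 < N))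
  have h2 : (∑ p ∈ pr 0 N, Real.log p / p) / Real.log N ≤ 1 + c / Real.log N := by
    rw [div_le_iff₀ hlN]
    have := mertens_one N (by omega)
    have e : (1 + c / Real.log N) * Real.log N = Real.log N + c := by field_simp
    rw [e]; exact this
  have h3 : 0 ≤ c / Real.log 2 := div_nonneg hc0 (Real.log_nonneg (by norm_num))
  have := le_abs_self (1 + c / Real.log 2 + (rp 0 2 + c / Real.log 2 - Real.log (Real.log 2)))
  linarith

/-- enough primes in `(x/4, x]` -/
lemma cheb_lower : ∃ c : ℝ, 0 < c ∧ ∃ x0 : ℕ, ∀ x : ℕ, x0 ≤ x → 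
    c * x / Real.log x ≤ ((pr (x/4) x).card : ℝ) := by
  have hl2 : 0 < Real.log 2 := Real.log_pos (by norm_num)
  have hev : ∀ᶠ n : ℕ in Filter.atTop, Real.log (n + 1) + 2 * √n * Real.log n ≤ (Real.log 2 / 4) * n := by
    have h1 : (fun x : ℝ => Real.log x) =o[Filter.atTop] fun x => x ^ (1/2 : ℝ) :=
      isLittleO_log_rpow_atTop (by norm_num)
    have h2 := (h1.comp_tendsto tendsto_natCast_atTop_atTop).bound (c := Real.log 2 / 32) (by positivity)
    filter_upwards [h2, Filter.eventually_ge_atTop 2] with n hn hn2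
    simp only [Function.comp] at hn
    have hn1 : (2:ℝ) ≤ n := by exact_mod_cast hn2
    have hl : 0 ≤ Real.log n := Real.log_nonneg (by linarith)
    rw [Real.norm_of_nonneg hl, Real.norm_of_nonneg (by positivity), ← Real.sqrt_eq_rpow] at hn
    have h3 : Real.log (n+1) ≤ 2 * Real.log n := by
      have : Real.log ((n:ℝ)^2) = 2 * Real.log n := by simp
      rw [← this]
      exact Real.log_le_log (by linarith) (by nlinarith)
    have hs : √(n:ℝ) * √n = n := Real.mul_self_sqrt (by linarith)
    have hs1 : 1 ≤ √(n:ℝ) := Real.one_le_sqrt.2 (by linarith)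
    have h5 : √(n:ℝ) * Real.log n ≤ Real.log 2 / 32 * n := by
      calc √(n:ℝ) * Real.log n ≤ √n * (Real.log 2 / 32 * √n) := by gcongr
        _ = Real.log 2 / 32 * (√n * √n) := by ring
        _ = _ := by rw [hs]
    have h6 : Real.log n ≤ √(n:ℝ) * Real.log n := by nlinarith
    nlinarith
  rw [Filter.eventually_atTop] at hev
  obtain ⟨x0, hx0⟩ := hev
  refine ⟨Real.log 2 / 4, by positivity, max x0 2, ?_⟩
  intro x hx
  have h1 := hx0 x (le_trans (le_max_left _ _) hx)
  have hx2 : 2 ≤ x := le_trans (le_max_right _ _) hx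
  have hlx : 0 < Real.log x := Real.log_pos (by exact_mod_cast (by omega : 1 < x))
  have h2 := Chebyshev.theta_ge x
  have h3 := Chebyshev.theta_le_log4_mul_x (x := ((x/4 : ℕ) : ℝ)) (by positivity)
  have h4 : Chebyshev.theta x - Chebyshev.theta ((x/4:ℕ):ℝ) ≤ (pr (x/4) x).card * Real.log x := by
    rw [theta_eq_pr, theta_eq_pr, sum_pr_split (Nat.zero_le (x/4)) (Nat.div_le_self x 4), add_sub_cancel_left,
      ← nsmul_eq_mul]
    apply Finset.sum_le_card_nsmul
    intro p hp; rw [mem_pr] at hp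
    exact Real.log_le_log (by exact_mod_cast hp.2.2.pos) (by exact_mod_cast hp.2.1)
  have h5 : Real.log 4 = 2 * Real.log 2 := by
    rw [show (4:ℝ) = 2^2 by norm_num, Real.log_pow]; norm_num
  have h6 : ((x/4:ℕ):ℝ) ≤ x / 4 := by exact_mod_cast Nat.cast_div_le (α := ℝ) (m := x) (n := 4)
  rw [div_le_iff₀ hlx]
  rw [h5] at h3
  nlinarith

lemma sum_inv_sq_Ioc_le (N : ℕ) : ∑ n ∈ Finset.Ioc 0 N, (1 / (n:ℝ)^2) ≤ 2 := by
  have := sum_Ioo_inv_sq_le (α := ℝ) 0 (N+1)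
  have e : Finset.Ioo 0 (N+1) = Finset.Ioc 0 N := by ext; simp
  rw [e] at this
  simpa [one_div] using this

lemma sum_inv_sq_pr_le (w z : ℕ) : ∑ n ∈ pr w z, (1 / (n:ℝ)^2) ≤ 2 / ((w:ℝ) + 1) := by
  have := sum_Ioo_inv_sq_le (α := ℝ) w (z+1)
  refine le_trans ?_ this
  simp only [one_div]
  apply Finset.sum_le_sum_of_subset_of_nonneg
  · intro p hp; rw [mem_pr] at hp; simp; omega
  · intros; positivity

lemma sum_inv_sq_pr_le' (w z : ℕ) : ∑ n ∈ pr w z, (1 / (n:ℝ)^2) ≤ 2 := by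
  refine (sum_inv_sq_pr_le w z).trans ?_
  rw [div_le_iff₀ (by positivity)]
  have : (0:ℝ) ≤ w := by positivity
  linarith

/-- prime powers weighted by logarithms -/
lemma sum_log_primePow : ∃ C : ℝ, 0 ≤ C ∧ ∀ y : ℕ,
    ∑ q ∈ (Finset.Ioc 0 y).filter IsPrimePow, Real.log q ≤ C * y := by
  have hl2 : 0 < Real.log 2 := Real.log_pos (by norm_num)
  refine ⟨Real.log 4 + (4 * (4 / Real.log 2) + 4), by positivity, ?_⟩
  intro y
  rcases Nat.eq_zero_or_pos y with rfl | hy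
  · simp
  have hy1 : (1:ℝ) ≤ y := by exact_mod_cast hy
  have hly : 0 ≤ Real.log y := Real.log_nonneg hy1
  set A := (Finset.Ioc 0 y).filter IsPrimePow with hA
  have hsplit : ∑ q ∈ A, Real.log q = ∑ q ∈ A.filter Nat.Prime, Real.log q + ∑ q ∈ A.filter (fun q => ¬ q.Prime), Real.log q :=
    (Finset.sum_filter_add_sum_filter_not _ _ _).symm
  have h1 : ∑ q ∈ A.filter Nat.Prime, Real.log q ≤ Real.log 4 * y := by
    refine le_trans ?_ (Chebyshev.theta_le_log4_mul_x (x := y) (by positivity))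
    rw [theta_eq_pr]
    apply Finset.sum_le_sum_of_subset_of_nonneg
    · intro p hp; simp only [hA, Finset.mem_filter, Finset.mem_Ioc] at hp
      rw [mem_pr]; exact ⟨hp.1.1.1, hp.1.1.2, hp.2⟩
    · intro p _ _; positivity
  have hcard : (A.filter (fun q => ¬ q.Prime)).card ≤ Nat.sqrt y * (Nat.log 2 y) := by
    have : A.filter (fun q => ¬ q.Prime) ⊆ ((Finset.Icc 1 (Nat.sqrt y)) ×ˢ (Finset.Icc 1 (Nat.log 2 y))).image
        (fun x => x.1 ^ x.2) := by
      intro q hq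
      simp only [hA, Finset.mem_filter, Finset.mem_Ioc] at hq
      obtain ⟨⟨⟨hq0, hqy⟩, hpp⟩, hnp⟩ := hq
      rw [isPrimePow_nat_iff] at hpp
      obtain ⟨p, k, hp, hk, rfl⟩ := hpp
      have hk2 : 2 ≤ k := by
        by_contra h
        have : k = 1 := by omega
        subst this; simp [hp] at hnp
      rw [Finset.mem_image]
      refine ⟨(p, k), ?_, rfl⟩
      simp only [Finset.mem_product, Finset.mem_Icc]
      refine ⟨⟨hp.one_lt.le, ?_⟩, hk, ?_⟩
      · rw [Nat.le_sqrt']; exact (Nat.pow_le_pow_right hp.pos hk2).trans hqy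
      · apply Nat.le_log_of_pow_le (by norm_num)
        exact (Nat.pow_le_pow_left hp.two_le k).trans hqy
    refine (Finset.card_le_card this).trans (Finset.card_image_le.trans ?_)
    simp
  have h2 : ∑ q ∈ A.filter (fun q => ¬ q.Prime), Real.log q ≤ (Nat.sqrt y * (Nat.log 2 y) : ℕ) * Real.log y := by
    calc _ ≤ (A.filter (fun q => ¬ q.Prime)).card • Real.log y := by
          apply Finset.sum_le_card_nsmul
          intro q hq
          simp only [hA, Finset.mem_filter, Finset.mem_Ioc] at hq
          exact Real.log_le_log (by exact_mod_cast hq.1.1.1) (by exact_mod_cast hq.1.1.2)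
      _ ≤ _ := by
          rw [nsmul_eq_mul]
          apply mul_le_mul_of_nonneg_right _ hly
          exact_mod_cast hcard
  have h3 : (Nat.sqrt y : ℝ) ≤ (y:ℝ)^(1/2:ℝ) := by
    rw [← Real.sqrt_eq_rpow]; exact Real.nat_sqrt_le_real_sqrt
  have h4 : (Nat.log 2 y : ℝ) ≤ Real.log y / Real.log 2 := by
    rw [le_div_iff₀ hl2, ← Real.log_pow]
    apply Real.log_le_log (by positivity)
    exact_mod_cast Nat.pow_log_le_self 2 hy.ne'
  have h5 : Real.log y ≤ 4 * (y:ℝ)^(1/4:ℝ) := by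
    have := Real.log_le_rpow_div (x := y) (by positivity) (ε := 1/4) (by norm_num)
    linarith
  have h6 : (y:ℝ)^(1/2:ℝ) * ((y:ℝ)^(1/4:ℝ) * (y:ℝ)^(1/4:ℝ)) = y := by
    rw [← Real.rpow_add (by linarith), ← Real.rpow_add (by linarith)]; norm_num
  have h7 : ((Nat.sqrt y * (Nat.log 2 y) : ℕ):ℝ) * Real.log y ≤ 4 * (4 / Real.log 2) * y := by
    push_cast
    calc (Nat.sqrt y : ℝ) * (Nat.log 2 y : ℝ) * Real.log y
        ≤ (y:ℝ)^(1/2:ℝ) * ((4 * (y:ℝ)^(1/4:ℝ)) / Real.log 2) * (4 * (y:ℝ)^(1/4:ℝ)) := by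
          gcongr
          exact h4.trans (by gcongr)
      _ = 4 * (4 / Real.log 2) * ((y:ℝ)^(1/2:ℝ) * ((y:ℝ)^(1/4:ℝ) * (y:ℝ)^(1/4:ℝ))) := by ring
      _ = _ := by rw [h6]
  rw [hsplit]
  nlinarith

/-- nonnegative multiplicative functions, bounded by 8 on prime powers -/
structure MF (f : ℕ → ℝ) : Prop where
  nonneg : ∀ n, 0 ≤ f n
  one : f 1 = 1
  mul : ∀ {m n}, Nat.Coprime m n → f (m * n) = f m * f n
  bd : ∀ p j, p.Prime → 1 ≤ j → f (p ^ j) ≤ 8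

lemma MF.factor {f : ℕ → ℝ} (hf : MF f) {p : ℕ} (hp : p.Prime) :
    Summable (fun n : ℕ => f (p^n) / ((p^n : ℕ) : ℝ)) ∧
    ∑' n : ℕ, f (p^n) / ((p^n : ℕ):ℝ) ≤ Real.exp (f p / p + 16 / (p:ℝ)^2) := by
  have hp2 : (2:ℝ) ≤ p := by exact_mod_cast hp.two_le
  have hg : Summable (fun n : ℕ => (1/(p:ℝ))^n) := summable_geometric_of_lt_one (by positivity)
    (by rw [div_lt_one (by positivity)]; linarith)
  have hb : ∀ n : ℕ, f (p^n) / ((p^n : ℕ) : ℝ) ≤ 8 * (1/(p:ℝ))^n := by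
    intro n
    rw [one_div, inv_pow, ← div_eq_mul_inv]
    push_cast
    gcongr
    rcases Nat.eq_zero_or_pos n with rfl | hn
    · simp [hf.one]
    · exact hf.bd p n hp hn
  have hs : Summable (fun n : ℕ => f (p^n) / ((p^n : ℕ) : ℝ)) :=
    Summable.of_nonneg_of_le (fun n => div_nonneg (hf.nonneg _) (by positivity)) hb (hg.mul_left 8)
  refine ⟨hs, ?_⟩
  rw [← hs.sum_add_tsum_nat_add 2]
  have h2 : ∑' n : ℕ, f (p^(n+2)) / ((p^(n+2) : ℕ):ℝ) ≤ 16 / (p:ℝ)^2 := by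
    calc _ ≤ ∑' n : ℕ, 8 * (1/(p:ℝ))^2 * (1/(p:ℝ))^n := by
          apply Summable.tsum_le_tsum _ ((summable_nat_add_iff 2).2 hs) (hg.mul_left _)
          intro n
          refine (hb (n+2)).trans (le_of_eq (by ring))
      _ = 8 * (1/(p:ℝ))^2 * (1 - 1/(p:ℝ))⁻¹ := by
          rw [tsum_mul_left, tsum_geometric_of_lt_one (by positivity)
            (by rw [div_lt_one (by positivity)]; linarith)]
      _ ≤ 8 * (1/(p:ℝ))^2 * 2 := by
          gcongr
          rw [inv_le_comm₀ (by rw [sub_pos, div_lt_one (by positivity)]; linarith) (by norm_num)]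
          have : 1 / (p:ℝ) ≤ 1/2 := one_div_le_one_div_of_le (by norm_num) hp2
          linarith
      _ = _ := by ring
  have h3 : ∑ n ∈ Finset.range 2, f (p^n) / ((p^n : ℕ):ℝ) = 1 + f p / p := by
    simp [Finset.sum_range_succ, hf.one]
  rw [h3]
  have := Real.add_one_le_exp (f p / p + 16 / (p:ℝ)^2)
  linarith

lemma MF.sum_div_le {f : ℕ → ℝ} (hf : MF f) (N : ℕ) :
    ∑ n ∈ Finset.Ioc 0 N, f n / n ≤ Real.exp (∑ p ∈ pr 0 N, f p / p + 32) := by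
  have key := EulerProduct.summable_and_hasSum_factoredNumbers_prod_filter_prime_tsum
    (f := fun n : ℕ => f n / (n:ℝ)) (by simp [hf.one])
    (by intro m n h; simp only [hf.mul h]; push_cast; rw [div_mul_div_comm])
    (by intro p hp
        have := (hf.factor hp).1
        refine this.congr (fun n => ?_)
        rw [Real.norm_of_nonneg (div_nonneg (hf.nonneg _) (by positivity))]) (Finset.Ioc 0 N)
  have hmem : ∀ n ∈ Finset.Ioc 0 N, n ∈ Nat.factoredNumbers (Finset.Ioc 0 N) := by
    intro n hn
    rw [Finset.mem_Ioc] at hn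
    rw [Nat.mem_factoredNumbers]
    refine ⟨by omega, fun p hp => ?_⟩
    rw [Finset.mem_Ioc]
    exact ⟨(Nat.prime_of_mem_primeFactorsList hp).pos,
      (Nat.le_of_dvd hn.1 (Nat.dvd_of_mem_primeFactorsList hp)).trans hn.2⟩
  have h1 : ∑ n ∈ Finset.Ioc 0 N, f n / n ≤ ∏ p ∈ Finset.Ioc 0 N with p.Prime, ∑' n : ℕ, f (p ^ n) / ((p ^ n : ℕ):ℝ) := by
    let e : (Finset.Ioc 0 N).attach.image (fun n => (⟨n.1, hmem n.1 n.2⟩ : Nat.factoredNumbers (Finset.Ioc 0 N))) =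
      (Finset.Ioc 0 N).attach.image (fun n => (⟨n.1, hmem n.1 n.2⟩ : Nat.factoredNumbers (Finset.Ioc 0 N))) := rfl
    have := sum_le_hasSum ((Finset.Ioc 0 N).attach.image (fun n => (⟨n.1, hmem n.1 n.2⟩ : Nat.factoredNumbers (Finset.Ioc 0 N))))
      (fun n _ => div_nonneg (hf.nonneg _) (by positivity)) key.2
    refine le_trans (le_of_eq ?_) this
    rw [Finset.sum_image]
    · rw [← Finset.sum_attach]
    · intro a _ b _ h; exact Subtype.ext (Subtype.mk.inj h)
  refine h1.trans ?_
  calc _ ≤ ∏ p ∈ Finset.Ioc 0 N with p.Prime, Real.exp (f p / p + 16 / (p:ℝ)^2) := by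
        apply Finset.prod_le_prod
        · intro p _; exact tsum_nonneg fun n => div_nonneg (hf.nonneg _) (by positivity)
        · intro p hp; exact (hf.factor (Finset.mem_filter.1 hp).2).2
    _ = Real.exp (∑ p ∈ pr 0 N, f p / p + 16 * ∑ p ∈ pr 0 N, 1 / (p:ℝ)^2) := by
        rw [← Real.exp_sum, Finset.sum_add_distrib, Finset.mul_sum]
        congr 2
        apply Finset.sum_congr rfl; intros; ring
    _ ≤ _ := by
        apply Real.exp_le_exp.2
        have := sum_inv_sq_pr_le' 0 N
        linarith

lemma MF.sum_log {f : ℕ → ℝ} (hf : MF f) {C : ℝ} (hC0 : 0 ≤ C) (hC : ∀ y : ℕ,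
    ∑ q ∈ (Finset.Ioc 0 y).filter IsPrimePow, Real.log q ≤ C * y) (N : ℕ) :
    ∑ n ∈ Finset.Ioc 0 N, f n * Real.log n ≤ 8 * C * N * ∑ n ∈ Finset.Ioc 0 N, f n / n := by
  have h1 : ∑ n ∈ Finset.Ioc 0 N, f n * Real.log n ≤ ∑ x ∈ (Finset.Ioc 0 N).sigma (fun n => n.primeFactors),
      8 * (f (x.1 / x.2 ^ (x.1.factorization x.2)) * Real.log ((x.2 ^ (x.1.factorization x.2) : ℕ))) := by
    rw [Finset.sum_sigma]
    apply Finset.sum_le_sum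
    intro n hn
    rw [Finset.mem_Ioc] at hn
    have e : Real.log n = ∑ p ∈ n.primeFactors, Real.log ((p ^ (n.factorization p) : ℕ)) := by
      conv_lhs => rw [← Nat.prod_factorization_pow_eq_self (n := n) (by omega)]
      rw [Finsupp.prod, Nat.cast_prod, Real.log_prod]
      · rfl
      · intro p hp
        have := Nat.prime_of_mem_primeFactors (n := n) (by simpa using hp)
        exact_mod_cast pow_ne_zero _ this.ne_zero
    rw [e, Finset.mul_sum]
    apply Finset.sum_le_sum
    intro p hp
    have hpp := Nat.prime_of_mem_primeFactors hp
    have hdec : p ^ (n.factorization p) * (n / p ^ (n.factorization p)) = n := Nat.ordProj_mul_ordCompl_eq_self n p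
    have hcop : Nat.Coprime (p ^ (n.factorization p)) (n / p ^ (n.factorization p)) :=
      Nat.Coprime.pow_left _ (Nat.coprime_ordCompl hpp (by omega))
    have hfn : f n = f (p ^ (n.factorization p)) * f (n / p ^ (n.factorization p)) := by
      rw [← hf.mul hcop, hdec]
    have hfac : 1 ≤ n.factorization p := 
      (hpp.factorization_pos_of_dvd (by omega) (Nat.dvd_of_mem_primeFactors hp))
    have hb := hf.bd p _ hpp hfac
    have hl : 0 ≤ Real.log ((p ^ (n.factorization p) : ℕ)) := by positivity
    calc f n * Real.log ((p ^ (n.factorization p) : ℕ))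
        ≤ (8 * f (n / p ^ (n.factorization p))) * Real.log ((p ^ (n.factorization p) : ℕ)) := by
          apply mul_le_mul_of_nonneg_right _ hl
          rw [hfn]
          exact mul_le_mul_of_nonneg_right hb (hf.nonneg _)
      _ = _ := by ring
  have h2 : ∑ x ∈ (Finset.Ioc 0 N).sigma (fun n => n.primeFactors),
      8 * (f (x.1 / x.2 ^ (x.1.factorization x.2)) * Real.log ((x.2 ^ (x.1.factorization x.2) : ℕ)))
      ≤ ∑ y ∈ (Finset.Ioc 0 N).sigma (fun m => (Finset.Ioc 0 (N/m)).filter IsPrimePow), 8 * (f y.1 * Real.log y.2) := by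
    let F : (Σ _ : ℕ, ℕ) → (Σ _ : ℕ, ℕ) := fun x => ⟨x.1 / x.2 ^ (x.1.factorization x.2), x.2 ^ (x.1.factorization x.2)⟩
    have hinj : Set.InjOn F ((Finset.Ioc 0 N).sigma (fun n => n.primeFactors)) := by
      rintro ⟨n, p⟩ hx ⟨n', p'⟩ hx' h
      simp only [Finset.coe_sigma, Set.mem_sigma_iff, Finset.mem_coe, Finset.mem_Ioc] at hx hx'
      simp only [F, Sigma.mk.injEq, heq_eq_eq] at h
      have hdec : p ^ (n.factorization p) * (n / p ^ (n.factorization p)) = n := Nat.ordProj_mul_ordCompl_eq_self n p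
      have hdec' : p' ^ (n'.factorization p') * (n' / p' ^ (n'.factorization p')) = n' := Nat.ordProj_mul_ordCompl_eq_self n' p'
      have hn : n = n' := by rw [← hdec, ← hdec', h.1, h.2]
      subst hn
      have hpp := Nat.prime_of_mem_primeFactors hx.2
      have hpp' := Nat.prime_of_mem_primeFactors hx'.2
      have hfac : 1 ≤ n.factorization p := 
        (hpp.factorization_pos_of_dvd (by omega) (Nat.dvd_of_mem_primeFactors hx.2))
      have : p ∣ p' ^ (n.factorization p') := by rw [← h.2]; exact dvd_pow_self p (by omega)
      have := (Nat.prime_dvd_prime_iff_eq hpp hpp').1 (hpp.dvd_of_dvd_pow this)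
      subst this; rfl
    rw [← Finset.sum_image (s := (Finset.Ioc 0 N).sigma (fun n => n.primeFactors)) (g := F)
      (f := fun y => 8 * (f y.1 * Real.log y.2)) hinj]
    apply Finset.sum_le_sum_of_subset_of_nonneg
    · intro y hy
      rw [Finset.mem_image] at hy
      obtain ⟨⟨n, p⟩, hx, rfl⟩ := hy
      simp only [Finset.mem_sigma, Finset.mem_Ioc] at hx
      have hpp := Nat.prime_of_mem_primeFactors hx.2
      have hdec : p ^ (n.factorization p) * (n / p ^ (n.factorization p)) = n := Nat.ordProj_mul_ordCompl_eq_self n p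
      have hfac : 1 ≤ n.factorization p := 
        (hpp.factorization_pos_of_dvd (by omega) (Nat.dvd_of_mem_primeFactors hx.2))
      have hpos : 0 < n / p ^ (n.factorization p) := Nat.ordCompl_pos p (by omega)
      simp only [F, Finset.mem_sigma, Finset.mem_Ioc, Finset.mem_filter]
      refine ⟨⟨hpos, (Nat.div_le_self _ _).trans hx.1.2⟩, ⟨pow_pos hpp.pos _, ?_⟩, ?_⟩
      · rw [Nat.le_div_iff_mul_le hpos, hdec]; exact hx.1.2
      · exact hpp.isPrimePow.pow (by omega)
    · intro y _ _
      have := hf.nonneg y.1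
      positivity
  refine h1.trans (h2.trans ?_)
  rw [Finset.sum_sigma, Finset.mul_sum]
  apply Finset.sum_le_sum
  intro m hm
  simp only
  rw [← Finset.mul_sum, ← Finset.mul_sum]
  have h3 := hC (N / m)
  have h4 : ((N / m : ℕ) : ℝ) ≤ N / m := Nat.cast_div_le
  have h5 := hf.nonneg m
  calc 8 * (f m * ∑ q ∈ (Finset.Ioc 0 (N/m)).filter IsPrimePow, Real.log q) ≤ 8 * (f m * (C * (N / m))) := by
        gcongr
        exact h3.trans (by gcongr)
    _ = _ := by ring

/-- Tool U -/
lemma toolU : ∃ C : ℝ, 0 ≤ C ∧ ∀ f : ℕ → ℝ, MF f → ∀ N : ℕ, 2 ≤ N →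
    ∑ n ∈ Finset.Ioc 0 N, f n ≤ C * (N / Real.log N) * Real.exp (∑ p ∈ pr 0 N, f p / p) := by
  obtain ⟨C, hC0, hC⟩ := sum_log_primePow
  refine ⟨(8 * C + 1) * Real.exp 32, by positivity, ?_⟩
  intro f hf N hN
  have h1 := hf.sum_log hC0 hC N
  have h2 := hf.sum_div_le N
  have hlN : 0 < Real.log N := Real.log_pos (by exact_mod_cast (by omega : 1 < N))
  have h3 : ∑ n ∈ Finset.Ioc 0 N, f n * Real.log N ≤ ∑ n ∈ Finset.Ioc 0 N, f n * Real.log n + N * ∑ n ∈ Finset.Ioc 0 N, f n / n := by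
    rw [Finset.mul_sum, ← Finset.sum_add_distrib]
    apply Finset.sum_le_sum
    intro n hn
    rw [Finset.mem_Ioc] at hn
    have hn0 : (0:ℝ) < n := by exact_mod_cast hn.1
    have hN0 : (0:ℝ) < N := by positivity
    have : Real.log (N / n) ≤ N / n := (Real.log_le_sub_one_of_pos (by positivity)).trans (by linarith)
    rw [Real.log_div hN0.ne' hn0.ne'] at this
    have h5 := hf.nonneg n
    calc f n * Real.log N ≤ f n * (Real.log n + N / n) := by gcongr; linarith
      _ = _ := by ring
  rw [← Finset.sum_mul] at h3
  have h4 : (∑ n ∈ Finset.Ioc 0 N, f n) * Real.log N ≤ (8 * C + 1) * N * Real.exp (∑ p ∈ pr 0 N, f p / p + 32) := by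
    refine h3.trans ?_
    calc _ ≤ 8 * C * N * ∑ n ∈ Finset.Ioc 0 N, f n / n + N * ∑ n ∈ Finset.Ioc 0 N, f n / n := by linarith
      _ = (8 * C + 1) * N * ∑ n ∈ Finset.Ioc 0 N, f n / n := by ring
      _ ≤ _ := by gcongr
  rw [Real.exp_add] at h4
  rw [← le_div_iff₀ hlN] at h4
  refine h4.trans (le_of_eq ?_)
  ring

lemma mertens_lower : ∃ C : ℝ, 0 ≤ C ∧ ∀ N : ℕ, 2 ≤ N → Real.log (Real.log N) ≤ rp 0 N + C := by
  refine ⟨32, by norm_num, ?_⟩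
  intro N hN
  have hf : MF (fun _ => (1:ℝ)) := ⟨fun _ => by norm_num, rfl, fun _ => by norm_num, fun _ _ _ _ => by norm_num⟩
  have h := hf.sum_div_le N
  have hlN : 0 < Real.log N := Real.log_pos (by exact_mod_cast (by omega : 1 < N))
  have h2 := log_add_one_le_harmonic N
  have h3 : Real.log N ≤ ∑ n ∈ Finset.Ioc 0 N, 1 / (n:ℝ) := by
    have e : ((harmonic N : ℚ) : ℝ) = ∑ n ∈ Finset.Ioc 0 N, 1 / (n:ℝ) := by
      rw [harmonic_eq_sum_Icc]; push_cast
      apply Finset.sum_congr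
      · ext; simp; omega
      · intros; simp
    rw [← e]
    refine le_trans ?_ h2
    exact Real.log_le_log (by positivity) (by push_cast; linarith)
  rw [Real.log_le_iff_le_exp hlN]
  exact h3.trans h

/-- the number of square roots of `a` modulo `N` -/
noncomputable def nsq (a : ℤ) (N : ℕ) : ℕ := Nat.card {x : ZMod N // x ^ 2 = (a : ZMod N)}

lemma nsq_one (a : ℤ) : nsq a 1 = 1 := by
  unfold nsq
  have : Unique {x : ZMod 1 // x ^ 2 = (a : ZMod 1)} :=
    { default := ⟨0, Subsingleton.elim _ _⟩, uniq := fun x => Subtype.ext (Subsingleton.elim _ _) }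
  exact Nat.card_unique

lemma nsq_mul (a : ℤ) {m n : ℕ} (h : Nat.Coprime m n) : nsq a (m * n) = nsq a m * nsq a n := by
  unfold nsq
  rw [← Nat.card_prod]
  apply Nat.card_congr
  let e := ZMod.chineseRemainder h
  refine (Equiv.subtypeEquiv (q := fun y : ZMod m × ZMod n => y.1 ^ 2 = (a : ZMod m) ∧ y.2 ^ 2 = (a : ZMod n))
    e.toEquiv ?_).trans (Equiv.subtypeProdEquivProd (p := fun x : ZMod m => x ^ 2 = (a : ZMod m))
      (q := fun x : ZMod n => x ^ 2 = (a : ZMod n)))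
  intro x
  rw [← e.injective.eq_iff, map_pow, map_intCast, Prod.ext_iff]
  rfl

lemma nsq_prime (a : ℤ) {p : ℕ} (hp : p.Prime) (h2 : p ≠ 2) : (nsq a p : ℤ) = 1 + jacobiSym a p := by
  have := Fact.mk hp
  have := legendreSym.card_sqrts p h2 a
  rw [jacobiSym.legendreSym.to_jacobiSym] at this
  rw [add_comm, ← this]
  unfold nsq
  rw [Nat.card_eq_fintype_card]
  congr 1
  rw [Fintype.card_subtype]
  congr 1
  ext x; simp

lemma zmod_sq_dvd {a : ℤ} {N : ℕ} [NeZero N] (x y : ZMod N) (hx : x ^ 2 = a) (hy : y ^ 2 = a) :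
    (N : ℤ) ∣ ((x.val : ℤ) - y.val) * (x.val + y.val) := by
  rw [← ZMod.intCast_zmod_eq_zero_iff_dvd]
  push_cast
  simp only [ZMod.natCast_val, ZMod.cast_id', id_eq]
  linear_combination hx - hy

lemma zmod_sq_dvd' {a : ℤ} {N : ℕ} [NeZero N] (x : ZMod N) (hx : x ^ 2 = a) :
    (N : ℤ) ∣ ((x.val : ℤ))^2 - a := by
  rw [← ZMod.intCast_zmod_eq_zero_iff_dvd]
  push_cast
  simp only [ZMod.natCast_val, ZMod.cast_id', id_eq]
  linear_combination hx

lemma nsq_prime_pow (a : ℤ) {p : ℕ} (hp : p.Prime) (h2 : p ≠ 2) (hpa : ¬ (p : ℤ) ∣ a) {j : ℕ} (hj : 1 ≤ j) :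
    (nsq a (p ^ j) : ℤ) ≤ 1 + jacobiSym a p := by
  have := Fact.mk hp
  have : NeZero (p ^ j) := ⟨pow_ne_zero _ hp.ne_zero⟩
  have hpp : Prime (p : ℤ) := Nat.prime_iff_prime_int.1 hp
  have hpj : (p : ℤ) ∣ ((p ^ j : ℕ) : ℤ) := by push_cast; exact dvd_pow_self _ (by omega)
  by_cases hne : Nonempty {x : ZMod (p ^ j) // x ^ 2 = (a : ZMod (p ^ j))}
  · obtain ⟨⟨y, hy⟩⟩ := hne
    have hy' := zmod_sq_dvd' y hy
    have hJ : jacobiSym a p = 1 := by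
      rw [← jacobiSym.legendreSym.to_jacobiSym, legendreSym.eq_one_iff]
      · refine ⟨((y.val : ℤ) : ZMod p), ?_⟩
        have := (ZMod.intCast_zmod_eq_zero_iff_dvd _ p).2 (hpj.trans hy')
        push_cast at this ⊢
        linear_combination - this
      · rwa [Ne, ZMod.intCast_zmod_eq_zero_iff_dvd]
    rw [hJ]
    have : nsq a (p^j) ≤ 2 := by
      unfold nsq
      have hsub : ∀ x : ZMod (p^j), x ^ 2 = a → x = y ∨ x = -y := by
        intro x hx
        have h1 := zmod_sq_dvd x y hx hy
        have hx' := zmod_sq_dvd' x hx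
        have hnot : ¬ ((p:ℤ) ∣ (x.val : ℤ) - y.val ∧ (p:ℤ) ∣ (x.val : ℤ) + y.val) := by
          rintro ⟨h, h'⟩
          have h3 : (p:ℤ) ∣ 2 * x.val := by have := dvd_add h h'; ring_nf at this ⊢; exact this
          rcases hpp.dvd_or_dvd h3 with h4 | h4
          · have : p ∣ 2 := by exact_mod_cast h4
            exact h2 ((Nat.prime_dvd_prime_iff_eq hp Nat.prime_two).1 this)
          · apply hpa
            have h5 := hpj.trans hx'
            have h6 : (p:ℤ) ∣ (x.val:ℤ)^2 := dvd_pow h4 (by norm_num)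
            have := dvd_sub h6 h5
            simpa using this
        push_cast at h1
        by_cases hA : (p:ℤ) ∣ (x.val : ℤ) - y.val
        · have hB : ¬ (p:ℤ) ∣ (x.val : ℤ) + y.val := fun h => hnot ⟨hA, h⟩
          left
          have hc : IsCoprime ((p:ℤ)^j) ((x.val : ℤ) + y.val) := 
            ((Prime.coprime_iff_not_dvd hpp).2 hB).pow_left
          have := hc.dvd_of_dvd_mul_right h1
          have := (ZMod.intCast_zmod_eq_zero_iff_dvd _ (p^j)).2 (by push_cast; exact this)
          push_cast at this
          simp only [ZMod.natCast_val, ZMod.cast_id', id_eq] at this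
          linear_combination this
        · right
          have hc : IsCoprime ((p:ℤ)^j) ((x.val : ℤ) - y.val) := 
            ((Prime.coprime_iff_not_dvd hpp).2 hA).pow_left
          have := hc.dvd_of_dvd_mul_left h1
          have := (ZMod.intCast_zmod_eq_zero_iff_dvd _ (p^j)).2 (by push_cast; exact this)
          push_cast at this
          simp only [ZMod.natCast_val, ZMod.cast_id', id_eq] at this
          linear_combination this
      rw [Nat.card_eq_fintype_card, Fintype.card_subtype]
      refine (Finset.card_le_card (t := {y, -y}) ?_).trans Finset.card_le_two
      intro x hx
      simp only [Finset.mem_filter] at hx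
      simpa using hsub x hx.2
    have h3 : (nsq a (p^j) : ℤ) ≤ 2 := by exact_mod_cast this
    linarith
  · rw [not_nonempty_iff] at hne
    have : nsq a (p^j) = 0 := by unfold nsq; exact Nat.card_of_isEmpty
    rw [this]
    rcases jacobiSym.trichotomy a p with h | h | h <;> rw [h] <;> norm_num

lemma nsq_sq_dvd (a : ℤ) {p : ℕ} (hp : p.Prime) (h1 : (p:ℤ) ∣ a) (h2 : ¬ (p:ℤ)^2 ∣ a) {j : ℕ} (hj : 2 ≤ j) :
    nsq a (p ^ j) = 0 := by
  have : NeZero (p ^ j) := ⟨pow_ne_zero _ hp.ne_zero⟩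
  have hpp : Prime (p : ℤ) := Nat.prime_iff_prime_int.1 hp
  unfold nsq
  have : IsEmpty {x : ZMod (p ^ j) // x ^ 2 = (a : ZMod (p ^ j))} := by
    constructor
    rintro ⟨x, hx⟩
    have h := zmod_sq_dvd' x hx
    have h3 : (p:ℤ)^2 ∣ (x.val:ℤ)^2 - a := by
      refine dvd_trans ?_ h
      push_cast
      exact pow_dvd_pow _ hj
    have h4 : (p:ℤ) ∣ (x.val:ℤ)^2 := by
      have := dvd_add ((dvd_pow_self _ (by norm_num)).trans h3) h1
      simpa using this
    have h5 := hpp.dvd_of_dvd_pow h4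
    have h6 : (p:ℤ)^2 ∣ (x.val:ℤ)^2 := pow_dvd_pow_of_dvd h5 2
    apply h2
    have := dvd_sub h6 h3
    simpa using this
  exact Nat.card_of_isEmpty

lemma two_pow_dvd_aux {A B : ℤ} {j : ℕ} (h : (2:ℤ)^(j+2) ∣ A * B) (hA : ¬ (8:ℤ) ∣ A) : (2:ℤ)^j ∣ B := by
  have odd_case : ∀ (C : ℤ) (i : ℕ), ¬ (2:ℤ) ∣ C → (2:ℤ)^i ∣ C * B → (2:ℤ)^i ∣ B := by
    intro C i hC h
    exact ((Prime.coprime_iff_not_dvd Int.prime_two).2 hC).pow_left.dvd_of_dvd_mul_left h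
  by_cases h1 : (2:ℤ) ∣ A
  · obtain ⟨A, rfl⟩ := h1
    have h' : (2:ℤ)^(j+1) ∣ A * B := by
      have : (2:ℤ) * 2^(j+1) ∣ 2 * (A * B) := by
        have e : (2:ℤ)^(j+2) = 2 * 2^(j+1) := by ring
        rw [← e]; convert h using 1; ring
      exact (mul_dvd_mul_iff_left (by norm_num)).1 this
    by_cases h2 : (2:ℤ) ∣ A
    · obtain ⟨A, rfl⟩ := h2
      have h'' : (2:ℤ)^j ∣ A * B := by
        have : (2:ℤ) * 2^j ∣ 2 * (A * B) := by
          have e : (2:ℤ)^(j+1) = 2 * 2^j := by ring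
          rw [← e]; convert h' using 1; ring
        exact (mul_dvd_mul_iff_left (by norm_num)).1 this
      apply odd_case A j _ h''
      rintro ⟨D, rfl⟩
      exact hA ⟨D, by ring⟩
    · exact (pow_dvd_pow _ (by omega)).trans (odd_case A (j+1) h2 h')
  · exact (pow_dvd_pow _ (by omega)).trans (odd_case A (j+2) h1 h)

lemma nsq_two_pow (a : ℤ) (ha : ¬ (16:ℤ) ∣ a) (j : ℕ) : nsq a (2 ^ j) ≤ 8 := by
  have : NeZero (2 ^ j) := ⟨pow_ne_zero _ (by norm_num)⟩
  unfold nsq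
  rw [Nat.card_eq_fintype_card, Fintype.card_subtype]
  rcases Nat.lt_or_ge j 4 with hj | hj
  · refine (Finset.card_filter_le _ _).trans ?_
    rw [Finset.card_univ, ZMod.card]
    calc 2^j ≤ 2^3 := Nat.pow_le_pow_right (by norm_num) (by omega)
      _ = 8 := by norm_num
  · obtain ⟨i, rfl⟩ := Nat.exists_eq_add_of_le' (show 2 ≤ j by omega)
    by_cases hne : ∃ y : ZMod (2^(i+2)), y ^ 2 = a
    · obtain ⟨y, hy⟩ := hne
      have key : ∀ x : ZMod (2^(i+2)), x ^ 2 = a → (2:ℤ)^i ∣ (x.val:ℤ) - y.val ∨ (2:ℤ)^i ∣ (x.val:ℤ) + y.val := by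
        intro x hx
        have h1 := zmod_sq_dvd x y hx hy
        have hx' := zmod_sq_dvd' x hx
        push_cast at h1 hx'
        by_cases hA : (8:ℤ) ∣ (x.val : ℤ) - y.val
        · by_cases hB : (8:ℤ) ∣ (x.val : ℤ) + y.val
          · exfalso
            obtain ⟨r, hr⟩ : (4:ℤ) ∣ x.val := by omega
            apply ha
            have h16 : (16:ℤ) ∣ (x.val:ℤ)^2 - a := by
              refine dvd_trans ?_ hx'
              rw [show (16:ℤ) = 2^4 by norm_num]
              exact pow_dvd_pow _ hj
            have h17 : (16:ℤ) ∣ (x.val:ℤ)^2 := ⟨r^2, by rw [hr]; ring⟩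
            have := dvd_sub h17 h16
            simpa using this
          · left
            rw [mul_comm] at h1
            exact two_pow_dvd_aux h1 hB
        · right; exact two_pow_dvd_aux h1 hA
      have hsub : Finset.univ.filter (fun x : ZMod (2^(i+2)) => x ^ 2 = a) ⊆
          (Finset.range 4).image (fun t : ℕ => y + ((2^i * t : ℕ) : ZMod (2^(i+2)))) ∪
          (Finset.range 4).image (fun t : ℕ => - y + ((2^i * t : ℕ) : ZMod (2^(i+2)))) := by
        intro x hx
        simp only [Finset.mem_filter] at hx
        have aux : ∀ D : ℤ, (2:ℤ)^i ∣ D → ∃ t ∈ Finset.range 4, (D : ZMod (2^(i+2))) = ((2^i * t : ℕ) : ZMod (2^(i+2))) := by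
          rintro D ⟨q, rfl⟩
          refine ⟨(q % 4).toNat, by simp; omega, ?_⟩
          have e : ((2^i * (q % 4).toNat : ℕ) : ZMod (2^(i+2))) = ((2^i * (q % 4) : ℤ) : ZMod (2^(i+2))) := by
            have : ((q % 4).toNat : ℤ) = q % 4 := Int.toNat_of_nonneg (by omega)
            rw [← this]; push_cast; rfl
          rw [e, ZMod.intCast_eq_intCast_iff_dvd_sub]
          push_cast
          refine ⟨- (q / 4), ?_⟩
          have := Int.emod_add_mul_ediv q 4
          have e2 : (2:ℤ)^(i+2) = 2^i * 4 := by ring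
          rw [e2]
          linear_combination (2:ℤ)^i * this
        rw [Finset.mem_union, Finset.mem_image, Finset.mem_image]
        rcases key x hx.2 with h | h
        · left
          obtain ⟨t, ht, hD⟩ := aux _ h
          refine ⟨t, ht, ?_⟩
          rw [← hD]; push_cast
          simp only [ZMod.natCast_val, ZMod.cast_id', id_eq]; ring
        · right
          obtain ⟨t, ht, hD⟩ := aux _ h
          refine ⟨t, ht, ?_⟩
          rw [← hD]; push_cast
          simp only [ZMod.natCast_val, ZMod.cast_id', id_eq]; ring
      refine (Finset.card_le_card hsub).trans ((Finset.card_union_le _ _).trans ?_)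
      have h4 : (Finset.range 4).card = 4 := by simp
      have hA := Finset.card_image_le (s := Finset.range 4) (f := fun t : ℕ => y + ((2^i * t : ℕ) : ZMod (2^(i+2))))
      have hB := Finset.card_image_le (s := Finset.range 4) (f := fun t : ℕ => - y + ((2^i * t : ℕ) : ZMod (2^(i+2))))
      omega
    · push Not at hne
      rw [Finset.filter_false_of_mem (by intro x _; exact hne x)]
      simp

lemma jac_le_one (a : ℤ) (b : ℕ) : jacobiSym a b ≤ 1 := by
  rcases jacobiSym.trichotomy a b with h | h | h <;> rw [h] <;> norm_num

lemma jac_ge (a : ℤ) (b : ℕ) : -1 ≤ jacobiSym a b := by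
  rcases jacobiSym.trichotomy a b with h | h | h <;> rw [h] <;> norm_num

lemma jac_abs (a : ℤ) (b : ℕ) : |(jacobiSym a b : ℝ)| ≤ 1 := by
  rcases jacobiSym.trichotomy a b with h | h | h <;> rw [h] <;> norm_num

lemma sqfree_not_sq_dvd {d : ℕ} (hd : Squarefree d) {p : ℕ} (hp : p.Prime) : ¬ (p:ℤ)^2 ∣ (-(d:ℤ)) := by
  intro h
  rw [dvd_neg] at h
  have h' : p * p ∣ d := by rw [← sq]; exact_mod_cast h
  have := hd p h'
  exact hp.one_lt.ne' (Nat.isUnit_iff.1 this)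

/-- root counting function is tame -/
lemma MF_rho {d : ℕ} (hd : Squarefree d) : MF (fun n => (nsq (-(d:ℤ)) n : ℝ)) where
  nonneg n := by positivity
  one := by simp [nsq_one]
  mul h := by simp only [nsq_mul _ h]; push_cast; rfl
  bd p j hp hj := by
    by_cases h2 : p = 2
    · subst h2
      have : ¬ (16:ℤ) ∣ (-(d:ℤ)) := by
        intro h
        apply sqfree_not_sq_dvd hd Nat.prime_two
        exact dvd_trans (by norm_num) h
      exact_mod_cast nsq_two_pow _ this j
    · by_cases hpd : (p:ℤ) ∣ (-(d:ℤ))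
      · rcases Nat.lt_or_ge j 2 with h | h
        · have : j = 1 := by omega
          subst this
          have h3 := nsq_prime (-(d:ℤ)) hp h2
          have h4 := jac_le_one (-(d:ℤ)) p
          rw [pow_one]
          have : (nsq (-(d:ℤ)) p : ℤ) ≤ 8 := by linarith
          exact_mod_cast this
        · rw [nsq_sq_dvd _ hp hpd (sqfree_not_sq_dvd hd hp) h]; norm_num
      · have h3 := nsq_prime_pow (-(d:ℤ)) hp h2 hpd hj
        have h4 := jac_le_one (-(d:ℤ)) p
        have : (nsq (-(d:ℤ)) (p^j) : ℤ) ≤ 8 := by linarith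
        exact_mod_cast this

/-- the counting function in the `v` aspect -/
noncomputable def fk (ℓ k v : ℕ) : ℕ := if Nat.Coprime v k then nsq (4 * (k:ℤ)^ℓ) (v^2) else 0

lemma fk_prime_pow {ℓ k : ℕ} (hℓ : Odd ℓ) {p : ℕ} (hp : p.Prime) (h2 : p ≠ 2) {j : ℕ} (hj : 1 ≤ j) :
    (fk ℓ k (p^j) : ℤ) ≤ 1 + jacobiSym k p := by
  unfold fk
  split_ifs with h
  · have hpk : Nat.Coprime p k := Nat.Coprime.coprime_dvd_left (dvd_pow_self p (by omega)) h
    rw [← pow_mul]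
    have hpp : Prime (p : ℤ) := Nat.prime_iff_prime_int.1 hp
    have hpk' : ¬ (p:ℤ) ∣ k := by
      intro hh
      have : p ∣ k := by exact_mod_cast hh
      have := Nat.dvd_gcd dvd_rfl this
      rw [hpk] at this
      exact hp.one_lt.ne' (Nat.dvd_one.1 this)
    have hp2 : ¬ (p:ℤ) ∣ 2 := by
      intro hh
      have : p ∣ 2 := by exact_mod_cast hh
      exact h2 ((Nat.prime_dvd_prime_iff_eq hp Nat.prime_two).1 this)
    have hn : ¬ (p:ℤ) ∣ 4 * (k:ℤ)^ℓ := by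
      intro hh
      rcases hpp.dvd_or_dvd hh with h4 | h4
      · rw [show (4:ℤ) = 2^2 by norm_num] at h4
        exact hp2 (hpp.dvd_of_dvd_pow h4)
      · exact hpk' (hpp.dvd_of_dvd_pow h4)
    have h3 := nsq_prime_pow _ hp h2 hn (j := j * 2) (by omega)
    have e : jacobiSym (4 * (k:ℤ)^ℓ) p = jacobiSym k p := by
      rw [jacobiSym.mul_left, jacobiSym.pow_left, show (4:ℤ) = 2^2 by norm_num]
      have h5 : jacobiSym (2^2) p = 1 := by
        apply jacobiSym.sq_one'
        rw [← Int.isCoprime_iff_gcd_eq_one]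
        exact ((Prime.coprime_iff_not_dvd hpp).2 hp2).symm
      rw [h5, one_mul]
      rcases jacobiSym.trichotomy k p with h6 | h6 | h6 <;> rw [h6]
      · exact zero_pow (by rintro rfl; simp at hℓ)
      · simp
      · exact hℓ.neg_one_pow
    rw [e] at h3
    exact h3
  · have := jac_ge k p
    push_cast; linarith

lemma MF_fk {ℓ k : ℕ} (hℓ : Odd ℓ) (hk : Odd k) : MF (fun v => (fk ℓ k v : ℝ)) where
  nonneg n := by positivity
  one := by simp [fk, nsq_one]
  mul := by
    intro m n h
    unfold fk
    rw [mul_pow, nsq_mul _ (Nat.Coprime.pow 2 2 h)]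
    by_cases h1 : Nat.Coprime m k
    · by_cases h2 : Nat.Coprime n k
      · rw [if_pos h1, if_pos h2, if_pos (Nat.Coprime.mul_left h1 h2)]; push_cast; rfl
      · rw [if_neg h2, if_neg (fun h => h2 (Nat.Coprime.coprime_mul_left h))]; simp
    · rw [if_neg h1, if_neg (fun h => h1 (Nat.Coprime.coprime_mul_right h))]; simp
  bd p j hp hj := by
    by_cases h2 : p = 2
    · subst h2
      have : fk ℓ k (2^j) ≤ 8 := by
        unfold fk
        split_ifs
        · rw [← pow_mul]
          apply nsq_two_pow
          intro h
          have h4 : (4:ℤ) ∣ (k:ℤ)^ℓ := by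
            have : (4:ℤ) * 4 ∣ 4 * (k:ℤ)^ℓ := by norm_num; exact h
            exact (mul_dvd_mul_iff_left (by norm_num)).1 this
          have h5 : (2:ℤ) ∣ k := Int.prime_two.dvd_of_dvd_pow (dvd_trans (by norm_num) h4)
          have : 2 ∣ k := by exact_mod_cast h5
          rw [← Nat.not_even_iff_odd] at hk
          exact hk (even_iff_two_dvd.2 this)
        · norm_num
      exact_mod_cast this
    · have h3 := fk_prime_pow (k := k) hℓ hp h2 hj
      have h4 := jac_le_one k p
      have : (fk ℓ k (p^j) : ℤ) ≤ 8 := by linarith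
      exact_mod_cast this

/-! ### moments of an index function -/

lemma sum_pow_index (k : ℕ) : ∃ c : ℝ, 0 ≤ c ∧ ∀ {α : Type} (Ω : Finset α) (bad : ℕ → α → Prop) (idx : α → ℕ) (N C : ℝ),
    0 ≤ N → 0 ≤ C → (Ω.card : ℝ) ≤ N →
    (∀ i, 1 ≤ i → ((Ω.filter (bad i)).card : ℝ) ≤ C * N / 2 ^ i) →
    (∀ ω ∈ Ω, ∀ j, 1 ≤ j → j < idx ω → bad j ω) →
    ∑ ω ∈ Ω, (idx ω : ℝ) ^ k ≤ (1 + C * c) * N := by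
  have hs : Summable (fun j : ℕ => ((j:ℝ)+1)^k / 2^j) := by
    have h1 := summable_pow_mul_geometric_of_norm_lt_one (R := ℝ) k (r := 1/2) (by norm_num)
    have h2 := ((summable_nat_add_iff 1).2 h1).mul_left 2
    refine h2.congr (fun j => ?_)
    push_cast
    rw [pow_succ, one_div, inv_pow]
    field_simp
  refine ⟨∑' j : ℕ, ((j:ℝ)+1)^k / 2^j, tsum_nonneg fun j => by positivity, ?_⟩
  intro α Ω bad idx N C hN hC hcard hbad hidx
  set J := Ω.sup idx with hJ
  have h1 : ∀ ω ∈ Ω, (idx ω : ℝ)^k ≤ 1 + ∑ j ∈ Finset.Icc 1 J, if bad j ω then ((j:ℝ)+1)^k else 0 := by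
    intro ω hω
    have hnn : ∀ j ∈ Finset.Icc 1 J, 0 ≤ if bad j ω then ((j:ℝ)+1)^k else 0 := by
      intro j _; split_ifs <;> positivity
    rcases Nat.lt_or_ge (idx ω) 2 with h | h
    · have h01 : (idx ω : ℝ) ≤ 1 := by exact_mod_cast (by omega : idx ω ≤ 1)
      have := pow_le_one₀ (n := k) (by positivity : (0:ℝ) ≤ idx ω) h01
      have := Finset.sum_nonneg hnn
      linarith
    · have hmem : idx ω - 1 ∈ Finset.Icc 1 J := by
        rw [Finset.mem_Icc]
        have := Finset.le_sup (f := idx) hω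
        omega
      have := Finset.single_le_sum hnn hmem
      rw [if_pos (hidx ω hω _ (by omega) (by omega))] at this
      have e : ((idx ω - 1 : ℕ) : ℝ) + 1 = idx ω := by
        rw [Nat.cast_sub (by omega)]; simp
      rw [e] at this
      linarith
  calc ∑ ω ∈ Ω, (idx ω : ℝ) ^ k ≤ ∑ ω ∈ Ω, (1 + ∑ j ∈ Finset.Icc 1 J, if bad j ω then ((j:ℝ)+1)^k else 0) :=
        Finset.sum_le_sum h1
    _ = Ω.card + ∑ j ∈ Finset.Icc 1 J, ((Ω.filter (bad j)).card : ℝ) * ((j:ℝ)+1)^k := by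
        rw [Finset.sum_add_distrib, Finset.sum_comm]
        congr 1
        · simp
        · apply Finset.sum_congr rfl; intro j _
          rw [← Finset.sum_filter, Finset.sum_const, nsmul_eq_mul]
    _ ≤ N + ∑ j ∈ Finset.Icc 1 J, (C * N) * (((j:ℝ)+1)^k / 2^j) := by
        refine add_le_add hcard (Finset.sum_le_sum fun j hj => ?_)
        have := hbad j (Finset.mem_Icc.1 hj).1
        calc ((Ω.filter (bad j)).card : ℝ) * ((j:ℝ)+1)^k ≤ (C * N / 2^j) * ((j:ℝ)+1)^k := by gcongr
          _ = _ := by ring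
    _ ≤ N + (C * N) * ∑' j : ℕ, ((j:ℝ)+1)^k / 2^j := by
        rw [← Finset.mul_sum]
        gcongr
        exact hs.sum_le_tsum _ (fun j _ => by positivity)
    _ = _ := by ring

/-- second moment bound -/
lemma second_moment {α : Type} (Ω : Finset α) (c : ℕ → α → ℝ) (N : ℝ) (z : ℕ)
    (hc : ∀ p ω, |c p ω| ≤ 1) (hcard : (Ω.card : ℝ) ≤ N) (hz : (z:ℝ)^5 ≤ N)
    (hoff : ∀ p q, p ∈ pr 2 z → q ∈ pr 2 z → p ≠ q → |∑ ω ∈ Ω, c p ω * c q ω| ≤ ((p:ℝ) * q)^2)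
    (i : ℕ) (hi : 1 ≤ i) :
    ((Ω.filter (fun ω => ¬ |∑ p ∈ pr (2^i) z, c p ω / p| ≤ 1)).card : ℝ) ≤ 3 * N / 2 ^ i := by
  have hN : 0 ≤ N := le_trans (by positivity) hcard
  rcases Nat.lt_or_ge z (2^i) with hlt | hge
  · have : pr (2^i) z = ∅ := by
      ext p; simp only [mem_pr]; constructor
      · rintro ⟨h1, h2, _⟩; omega
      · simp
    rw [this]
    simp only [Finset.sum_empty, abs_zero]
    rw [Finset.filter_false_of_mem (by intro x _; norm_num)]
    simp; positivity
  have h2i : 2 ≤ 2^i := by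
    calc 2 = 2^1 := by norm_num
      _ ≤ 2^i := Nat.pow_le_pow_right (by norm_num) hi
  have hsub : ∀ p ∈ pr (2^i) z, p ∈ pr 2 z := by
    intro p hp; rw [mem_pr] at hp ⊢; exact ⟨by omega, hp.2.1, hp.2.2⟩
  have hpos : ∀ p ∈ pr (2^i) z, (0:ℝ) < p := by
    intro p hp; rw [mem_pr] at hp; exact_mod_cast hp.2.2.pos
  set S := Ω.filter (fun ω => ¬ |∑ p ∈ pr (2^i) z, c p ω / p| ≤ 1)
  have h1 : (S.card : ℝ) ≤ ∑ ω ∈ Ω, (∑ p ∈ pr (2^i) z, c p ω / p)^2 := by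
    calc (S.card : ℝ) = ∑ ω ∈ S, (1:ℝ) := by simp
      _ ≤ ∑ ω ∈ S, (∑ p ∈ pr (2^i) z, c p ω / p)^2 := by
          apply Finset.sum_le_sum; intro ω hω
          have := (Finset.mem_filter.1 hω).2
          push Not at this
          rw [← sq_abs]; nlinarith
      _ ≤ _ := Finset.sum_le_sum_of_subset_of_nonneg (Finset.filter_subset _ _) (fun _ _ _ => by positivity)
  have h2 : ∑ ω ∈ Ω, (∑ p ∈ pr (2^i) z, c p ω / p)^2
      = ∑ p ∈ pr (2^i) z, ∑ q ∈ pr (2^i) z, (∑ ω ∈ Ω, c p ω * c q ω) / (p * q) := by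
    simp_rw [sq, Finset.sum_mul_sum]
    rw [Finset.sum_comm]
    apply Finset.sum_congr rfl; intro p _
    rw [Finset.sum_comm]
    apply Finset.sum_congr rfl; intro q _
    rw [Finset.sum_div]
    apply Finset.sum_congr rfl; intro ω _
    rw [div_mul_div_comm]
  have h3 : ∀ p ∈ pr (2^i) z, ∀ q ∈ pr (2^i) z, (∑ ω ∈ Ω, c p ω * c q ω) / ((p:ℝ) * q)
      ≤ (if p = q then N * (1 / (p:ℝ)^2) else 0) + p * q := by
    intro p hp q hq
    have hp0 := hpos p hp
    have hq0 := hpos q hq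
    by_cases hpq : p = q
    · subst hpq
      rw [if_pos rfl]
      have : ∑ ω ∈ Ω, c p ω * c p ω ≤ N := by
        calc _ ≤ ∑ ω ∈ Ω, (1:ℝ) := by
              apply Finset.sum_le_sum; intro ω _
              have := hc p ω
              rw [abs_le] at this; nlinarith
          _ ≤ N := by simpa using hcard
      have h5 : (∑ ω ∈ Ω, c p ω * c p ω) / ((p:ℝ) * p) ≤ N / (p * p) := by gcongr
      have h6 : N / ((p:ℝ) * p) = N * (1 / (p:ℝ)^2) := by rw [sq]; ring
      have : (0:ℝ) ≤ p * p := by positivity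
      linarith
    · rw [if_neg hpq, zero_add, div_le_iff₀ (by positivity)]
      have := (le_abs_self _).trans (hoff p q (hsub p hp) (hsub q hq) hpq)
      nlinarith
  have h4 : ∑ p ∈ pr (2^i) z, (p:ℝ) ≤ (z:ℝ)^2 := by
    calc _ ≤ ∑ p ∈ pr (2^i) z, (z:ℝ) := by
          apply Finset.sum_le_sum; intro p hp; rw [mem_pr] at hp; exact_mod_cast hp.2.1
      _ = (pr (2^i) z).card * (z:ℝ) := by simp
      _ ≤ z * z := by
          gcongr
          refine (Finset.card_le_card (Finset.filter_subset _ _)).trans ?_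
          simp
      _ = _ := by ring
  have h5 : ∑ p ∈ pr (2^i) z, ∑ q ∈ pr (2^i) z, (∑ ω ∈ Ω, c p ω * c q ω) / ((p:ℝ) * q)
      ≤ N * (2 / (2^i : ℝ)) + (z:ℝ)^4 := by
    calc _ ≤ ∑ p ∈ pr (2^i) z, ∑ q ∈ pr (2^i) z, ((if p = q then N * (1 / (p:ℝ)^2) else 0) + (p:ℝ) * q) :=
          Finset.sum_le_sum fun p hp => Finset.sum_le_sum fun q hq => h3 p hp q hq
      _ = N * ∑ p ∈ pr (2^i) z, (1 / (p:ℝ)^2) + (∑ p ∈ pr (2^i) z, (p:ℝ)) * ∑ q ∈ pr (2^i) z, (q:ℝ) := by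
          simp_rw [Finset.sum_add_distrib]
          congr 1
          · rw [Finset.mul_sum]; apply Finset.sum_congr rfl; intro p hp
            rw [Finset.sum_ite_eq, if_pos hp]
          · rw [Finset.sum_mul_sum]
      _ ≤ N * (2 / (2^i : ℝ)) + (z:ℝ)^2 * (z:ℝ)^2 := by
          have := sum_inv_sq_pr_le (2^i) z
          gcongr
          refine this.trans ?_
          push_cast
          gcongr
          linarith
      _ = _ := by ring
  have h6 : (z:ℝ)^4 ≤ N / 2^i := by
    rw [le_div_iff₀ (by positivity)]
    calc (z:ℝ)^4 * 2^i ≤ (z:ℝ)^4 * z := by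
          gcongr; exact_mod_cast hge
      _ = (z:ℝ)^5 := by ring
      _ ≤ N := hz
  calc (S.card : ℝ) ≤ N * (2 / (2^i : ℝ)) + (z:ℝ)^4 := by rw [h2] at h1; exact h1.trans h5
    _ ≤ N * (2 / (2^i : ℝ)) + N / 2^i := by linarith
    _ = _ := by ring

lemma exp_rp_le : ∃ C : ℝ, 1 ≤ C ∧ ∀ i : ℕ, 1 ≤ i → Real.exp (rp 0 (2^i)) ≤ C * i := by
  obtain ⟨C, hC0, hC⟩ := mertens_upper
  refine ⟨Real.exp C, Real.one_le_exp hC0, ?_⟩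
  intro i hi
  have h2i : 2 ≤ 2^i := by
    calc 2 = 2^1 := by norm_num
      _ ≤ 2^i := Nat.pow_le_pow_right (by norm_num) hi
  have h := hC (2^i) h2i
  have hi0 : (0:ℝ) < i := by exact_mod_cast hi
  have hl : Real.log ((2^i : ℕ) : ℝ) = i * Real.log 2 := by push_cast; rw [Real.log_pow]
  rw [hl] at h
  have hl2 : 0 < Real.log 2 := Real.log_pos (by norm_num)
  have hl2' : Real.log 2 ≤ 1 := by have := Real.log_two_lt_d9; linarith
  calc Real.exp (rp 0 (2^i)) ≤ Real.exp (Real.log (i * Real.log 2) + C) := Real.exp_le_exp.2 h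
    _ = (i * Real.log 2) * Real.exp C := by rw [Real.exp_add, Real.exp_log (by positivity)]
    _ ≤ (i * 1) * Real.exp C := by gcongr
    _ = _ := by ring

lemma rp_mono {a b c : ℕ} (h : b ≤ c) : rp a b ≤ rp a c := by
  apply Finset.sum_le_sum_of_subset_of_nonneg
  · intro p hp; rw [mem_pr] at hp ⊢; exact ⟨hp.1, by omega, hp.2.2⟩
  · intros; positivity

lemma rp_anti {a b c : ℕ} (h : a ≤ b) : rp b c ≤ rp a c := by
  apply Finset.sum_le_sum_of_subset_of_nonneg
  · intro p hp; rw [mem_pr] at hp ⊢; exact ⟨by omega, hp.2.1, hp.2.2⟩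
  · intros; positivity

lemma abs_sum_pr_le (c : ℕ → ℝ) (hc : ∀ p, |c p| ≤ 1) (a b : ℕ) : |∑ p ∈ pr a b, c p / p| ≤ rp a b := by
  refine (Finset.abs_sum_le_sum_abs _ _).trans ?_
  apply Finset.sum_le_sum
  intro p _
  rw [abs_div, Nat.abs_cast]
  gcongr
  exact hc p

/-- with a good index, the prime sum is controlled -/
lemma sum_pr_two_le (c : ℕ → ℝ) (hc : ∀ p, |c p| ≤ 1) (z i : ℕ) (hi : 1 ≤ i)
    (hgood : |∑ p ∈ pr (2^i) z, c p / p| ≤ 1) : |∑ p ∈ pr 2 z, c p / p| ≤ rp 0 (2^i) + 1 := by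
  have h2i : 2 ≤ 2^i := by
    calc 2 = 2^1 := by norm_num
      _ ≤ 2^i := Nat.pow_le_pow_right (by norm_num) hi
  rcases Nat.lt_or_ge z (2^i) with hlt | hge
  · refine (abs_sum_pr_le c hc 2 z).trans ?_
    have h1 := rp_mono (a := 2) hlt.le
    have h2 := rp_anti (c := 2^i) (Nat.zero_le 2)
    linarith
  · rw [sum_pr_split h2i hge]
    refine (abs_add_le _ _).trans ?_
    have h0 := abs_sum_pr_le c hc 2 (2^i)
    have h2 := rp_anti (c := 2^i) (Nat.zero_le 2)
    linarith

lemma exists_good (c : ℕ → ℝ) (z : ℕ) : ∃ i, 1 ≤ i ∧ |∑ p ∈ pr (2^i) z, c p / p| ≤ 1 := by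
  refine ⟨z + 1, by omega, ?_⟩
  have : pr (2^(z+1)) z = ∅ := by
    ext p; simp only [mem_pr]; constructor
    · rintro ⟨h1, h2, _⟩
      have := Nat.lt_two_pow_self (n := z+1)
      omega
    · simp
  rw [this]; simp

/-! ### character sums -/

lemma periodic_shift (g : ℕ → ℝ) (T : ℕ) (hper : ∀ n, g (n + T) = g n) (a : ℕ) :
    ∑ n ∈ Finset.Ico a (a + T), g n = ∑ n ∈ Finset.range T, g n := by
  induction a with
  | zero => simp
  | succ a ih =>
    rw [← ih]
    rcases Nat.eq_zero_or_pos T with rfl | hT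
    · simp
    have h1 : ∑ n ∈ Finset.Ico a (a+T), g n = g a + ∑ n ∈ Finset.Ico (a+1) (a+T), g n :=
      Finset.sum_eq_sum_Ico_succ_bot (by omega) _
    have h2 : ∑ n ∈ Finset.Ico (a+1) (a+1+T), g n = ∑ n ∈ Finset.Ico (a+1) (a+T), g n + g (a+T) := by
      rw [show a+1+T = (a+T)+1 by ring]
      exact Finset.sum_Ico_succ_top (by omega) _
    rw [h1, h2, hper]; ring

lemma periodic_sum_bound (g : ℕ → ℝ) (T : ℕ) (hT : 0 < T) (hper : ∀ n, g (n + T) = g n)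
    (hb : ∀ n, |g n| ≤ 1) (h0 : ∑ n ∈ Finset.range T, g n = 0) :
    ∀ L a, |∑ n ∈ Finset.Ico a (a + L), g n| ≤ T := by
  intro L
  induction L using Nat.strong_induction_on with
  | _ L ih =>
    intro a
    rcases Nat.lt_or_ge L T with h | h
    · calc _ ≤ ∑ n ∈ Finset.Ico a (a+L), |g n| := Finset.abs_sum_le_sum_abs _ _
        _ ≤ ∑ n ∈ Finset.Ico a (a+L), (1:ℝ) := Finset.sum_le_sum fun n _ => hb n
        _ = L := by simp
        _ ≤ T := by exact_mod_cast h.le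
    · rw [← Finset.sum_Ico_consecutive g (show a ≤ a + T by omega) (show a + T ≤ a + L by omega),
        periodic_shift g T hper, h0, zero_add]
      have := ih (L - T) (by omega) (a + T)
      rwa [show a + T + (L - T) = a + L by omega] at this

lemma twist_sum_zero (g : ℕ → ℝ) (T t : ℕ) (hT : 0 < T) (hper : ∀ n, g (n + T) = g n)
    (hcop : Nat.Coprime t T) (ht : ∀ n, g (t * n) = - g n) : ∑ n ∈ Finset.range T, g n = 0 := by
  have hmod : ∀ n, g (n % T) = g n := fun n => (Function.Periodic.map_mod_nat hper n)
  have h1 : ∑ n ∈ Finset.range T, g ((t * n) % T) = ∑ n ∈ Finset.range T, g n := by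
    have hinj : Set.InjOn (fun n => (t * n) % T) (Finset.range T) := by
      intro a ha b hb hab
      have ha' : a < T := by simpa using ha
      have hb' : b < T := by simpa using hb
      have h3 : t * a ≡ t * b [MOD T] := hab
      have h4 := Nat.ModEq.cancel_left_of_coprime (by simpa [Nat.coprime_comm] using hcop) h3
      exact Nat.ModEq.eq_of_lt_of_lt h4 ha' hb'
    have himg : (Finset.range T).image (fun n => (t * n) % T) = Finset.range T := by
      apply Finset.eq_of_subset_of_card_le
      · intro x hx
        obtain ⟨n, _, rfl⟩ := Finset.mem_image.1 hx
        exact Finset.mem_range.2 (Nat.mod_lt _ hT)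
      · rw [Finset.card_image_of_injOn hinj]
    rw [← Finset.sum_image (f := g) hinj, himg]
  have h2 : ∑ n ∈ Finset.range T, g ((t * n) % T) = - ∑ n ∈ Finset.range T, g n := by
    rw [← Finset.sum_neg_distrib]
    apply Finset.sum_congr rfl; intro n _
    rw [hmod, ht]
  linarith

lemma exists_jac_neg_one {p : ℕ} (hp : p.Prime) (h2 : p ≠ 2) : ∃ t : ℕ, jacobiSym (t:ℤ) p = -1 := by
  have : Fact p.Prime := ⟨hp⟩
  obtain ⟨a, ha⟩ := FiniteField.exists_nonsquare (F := ZMod p) (by rw [ZMod.ringChar_zmod_n]; exact h2)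
  refine ⟨a.val, ?_⟩
  rw [ZMod.nonsquare_iff_jacobiSym_eq_neg_one]
  simpa using ha

lemma jac_pair {p q : ℕ} (hp : p.Prime) (hq : q.Prime) (hp2 : p ≠ 2) (hq2 : q ≠ 2) (hpq : p ≠ q)
    (a L : ℕ) : |∑ n ∈ Finset.Ico a (a + L), ((jacobiSym (n:ℤ) p : ℝ) * (jacobiSym (n:ℤ) q : ℝ))| ≤ (p:ℝ) * q := by
  obtain ⟨t0, ht0⟩ := exists_jac_neg_one hp hp2
  have hcop : Nat.Coprime p q := (Nat.coprime_primes hp hq).2 hpq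
  obtain ⟨t, ht1, ht2⟩ := Nat.chineseRemainder hcop t0 1
  have h := periodic_sum_bound (fun n => ((jacobiSym (n:ℤ) p : ℝ) * (jacobiSym (n:ℤ) q : ℝ))) (p*q)
    (Nat.mul_pos hp.pos hq.pos) ?_ ?_ ?_ L a
  · simpa using h
  · intro n
    have e1 : jacobiSym ((n + p * q : ℕ) : ℤ) p = jacobiSym (n:ℤ) p := by
      apply jacobiSym.mod_left'
      push_cast; simp
    have e2 : jacobiSym ((n + p * q : ℕ) : ℤ) q = jacobiSym (n:ℤ) q := by
      apply jacobiSym.mod_left'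
      push_cast; simp
    simp only [e1, e2]
  · intro n
    simp only [abs_mul]
    have := jac_abs (n:ℤ) p
    have := jac_abs (n:ℤ) q
    have e1 : |(jacobiSym (n:ℤ) p : ℝ)| ≤ 1 := by exact_mod_cast jac_abs (n:ℤ) p
    have e2 : |(jacobiSym (n:ℤ) q : ℝ)| ≤ 1 := by exact_mod_cast jac_abs (n:ℤ) q
    exact mul_le_one₀ e1 (abs_nonneg _) e2
  · have et1 : jacobiSym (t:ℤ) p = -1 := by
      rw [← ht0]; apply jacobiSym.mod_left'
      exact_mod_cast ht1
    have et2 : jacobiSym (t:ℤ) q = 1 := by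
      rw [← jacobiSym.one_left q]; apply jacobiSym.mod_left'
      exact_mod_cast ht2
    apply twist_sum_zero _ (p*q) t (Nat.mul_pos hp.pos hq.pos)
    · intro n
      have e1 : jacobiSym ((n + p * q : ℕ) : ℤ) p = jacobiSym (n:ℤ) p := by
        apply jacobiSym.mod_left'
        push_cast; simp
      have e2 : jacobiSym ((n + p * q : ℕ) : ℤ) q = jacobiSym (n:ℤ) q := by
        apply jacobiSym.mod_left'
        push_cast; simp
      simp only [e1, e2]
    · apply Nat.Coprime.mul_right
      · rw [Nat.coprime_comm, Nat.Prime.coprime_iff_not_dvd hp]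
        intro hd
        have : Fact p.Prime := ⟨hp⟩
        have h0 : jacobiSym (t:ℤ) p = 0 := by
          rw [jacobiSym.eq_zero_iff]
          refine ⟨hp.ne_zero, ?_⟩
          rw [Int.gcd_natCast_natCast, Nat.gcd_eq_right hd]; exact hp.one_lt.ne'
        rw [h0] at et1; norm_num at et1
      · have := ht2.gcd_eq
        rw [Nat.gcd_one_left] at this
        exact this
    · intro n
      push_cast
      rw [jacobiSym.mul_left, jacobiSym.mul_left, et1, et2]
      push_cast; ring

/-! ### D1 -/
noncomputable def chi (d p : ℕ) : ℝ := (jacobiSym (-(d:ℤ)) p : ℝ)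

lemma chi_abs (d p : ℕ) : |chi d p| ≤ 1 := by
  unfold chi; exact_mod_cast jac_abs _ _

lemma chi_off (X z p q : ℕ) (hp : p ∈ pr 2 z) (hq : q ∈ pr 2 z) (hpq : p ≠ q) :
    |∑ d ∈ Finset.Ico X (2*X), chi d p * chi d q| ≤ ((p:ℝ)*q)^2 := by
  rw [mem_pr] at hp hq
  have e : ∑ d ∈ Finset.Ico X (2*X), chi d p * chi d q = ((jacobiSym (-1) p : ℝ) * (jacobiSym (-1) q : ℝ)) *
      ∑ n ∈ Finset.Ico X (X + X), ((jacobiSym (n:ℤ) p : ℝ) * (jacobiSym (n:ℤ) q : ℝ)) := by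
    rw [Finset.mul_sum, two_mul]
    apply Finset.sum_congr rfl
    intro d _
    unfold chi
    rw [show (-(d:ℤ)) = (-1) * d by ring, jacobiSym.mul_left, jacobiSym.mul_left]
    push_cast; ring
  rw [e, abs_mul, abs_mul]
  have e1 : |(jacobiSym (-1) p : ℝ)| ≤ 1 := by exact_mod_cast jac_abs _ _
  have e2 : |(jacobiSym (-1) q : ℝ)| ≤ 1 := by exact_mod_cast jac_abs _ _
  have h := jac_pair hp.2.2 hq.2.2 (by omega) (by omega) hpq X X
  have h1 : (1:ℝ) ≤ (p:ℝ) * q := by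
    have : 1 ≤ p * q := Nat.mul_pos hp.2.2.pos hq.2.2.pos
    exact_mod_cast this
  calc _ ≤ 1 * ((p:ℝ) * q) := by
        apply mul_le_mul (mul_le_one₀ e1 (abs_nonneg _) e2) h (abs_nonneg _) (by norm_num)
    _ ≤ _ := by nlinarith

def badd (z i d : ℕ) : Prop :=
  (¬ |∑ p ∈ pr (2^i) z, chi d p / p| ≤ 1) ∨ ¬ ∑ p ∈ (pr (2^i) z).filter (· ∣ d), (1:ℝ)/p ≤ 1

lemma pr_empty {a b : ℕ} (h : b ≤ a) : pr a b = ∅ := by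
  ext p; simp only [mem_pr]; constructor
  · rintro ⟨h1, h2, _⟩; omega
  · simp

lemma not_badd_of_lt {z i d : ℕ} (h : z ≤ 2^i) : ¬ badd z i d := by
  unfold badd
  rw [pr_empty h]; simp

lemma exists_idx (z d : ℕ) : ∃ i, 1 ≤ i ∧ ¬ badd z i d :=
  ⟨z+1, by omega, not_badd_of_lt ((by omega : z ≤ z+1).trans Nat.lt_two_pow_self.le)⟩

noncomputable def idx (z d : ℕ) : ℕ := Nat.find (exists_idx z d)

lemma idx_pos (z d : ℕ) : 1 ≤ idx z d := (Nat.find_spec (exists_idx z d)).1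
lemma idx_good (z d : ℕ) : ¬ badd z (idx z d) d := (Nat.find_spec (exists_idx z d)).2
lemma idx_bad {z d j : ℕ} (h1 : 1 ≤ j) (h : j < idx z d) : badd z j d := by
  by_contra hb
  exact Nat.find_min (exists_idx z d) h ⟨h1, hb⟩
lemma idx_le {z d j : ℕ} (h1 : 1 ≤ j) (h : z ≤ 2^j) : idx z d ≤ j := by
  by_contra hb
  exact not_badd_of_lt (d := d) h (idx_bad h1 (by omega))

lemma idx_le_log (z d : ℕ) (hz : 2 ≤ z) : (idx z d : ℝ) ≤ 4 * Real.log z := by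
  have h := idx_le (z := z) (d := d) (j := Nat.log 2 z + 1) (by omega) (Nat.lt_pow_succ_log_self (by norm_num) z).le
  have h3 : (Nat.log 2 z : ℝ) * Real.log 2 ≤ Real.log z := by
    rw [← Real.log_pow]
    apply Real.log_le_log (by positivity)
    exact_mod_cast Nat.pow_log_le_self 2 (by omega)
  have h4 : Real.log 2 ≤ Real.log z := Real.log_le_log (by norm_num) (by exact_mod_cast hz)
  have := Real.log_two_gt_d9
  have h5 : (idx z d : ℝ) ≤ Nat.log 2 z + 1 := by exact_mod_cast h
  nlinarith

lemma card_dvd_Ico (X p : ℕ) (hp : 0 < p) : (((Finset.Ico X (2*X)).filter (p ∣ ·)).card : ℝ) ≤ X / p + 1 := by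
  have h : ((Finset.Ico X (2*X)).filter (p ∣ ·)).card ≤ X / p + 1 := by
    have := Nat.Ico_filter_modEq_card X (2*X) hp 0
    have e : ((Finset.Ico X (2*X)).filter (p ∣ ·)).card = ((Finset.Ico X (2*X)).filter (· ≡ 0 [MOD p])).card := by
      congr 1; ext x; simp [Nat.modEq_zero_iff_dvd]
    rw [e]
    have h2 : (((Finset.Ico X (2*X)).filter (· ≡ 0 [MOD p])).card : ℤ) ≤ (X / p + 1 : ℕ) := by
      rw [this]
      apply max_le
      · have h5 : ⌈(((2*X : ℕ):ℚ) - (0:ℕ)) / (p:ℚ)⌉ < (((2*X : ℕ):ℚ) - (0:ℕ)) / (p:ℚ) + 1 := Int.ceil_lt_add_one _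
        have h6 : (((X : ℕ):ℚ) - (0:ℕ)) / (p:ℚ) ≤ ⌈(((X : ℕ):ℚ) - (0:ℕ)) / (p:ℚ)⌉ := Int.le_ceil _
        have h7 : (X:ℚ)/p < ((X/p : ℕ) : ℚ) + 1 := by
          rw [div_lt_iff₀ (by exact_mod_cast hp)]
          have := Nat.lt_div_mul_add (a := X) hp
          have h8 : X < X / p * p + p := this
          have : (X:ℚ) < (X/p : ℕ) * p + p := by exact_mod_cast h8
          linarith
        have h9 : ((⌈(((2*X : ℕ):ℚ) - (0:ℕ)) / (p:ℚ)⌉ - ⌈(((X : ℕ):ℚ) - (0:ℕ)) / (p:ℚ)⌉ : ℤ) : ℚ) < ((X/p + 1 + 1 : ℕ) : ℚ) := by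
          push_cast at h5 h6 ⊢
          have : (2 * (X:ℚ) - 0)/p = X/p + X/p := by ring
          rw [this] at h5 ⊢
          rw [sub_zero] at h6 ⊢
          linarith
        have : (⌈(((2*X : ℕ):ℚ) - (0:ℕ)) / (p:ℚ)⌉ - ⌈(((X : ℕ):ℚ) - (0:ℕ)) / (p:ℚ)⌉ : ℤ) < ((X/p + 1 + 1 : ℕ) : ℤ) := by
          rw [← Int.cast_lt (R := ℚ), Int.cast_natCast]; exact h9
        omega
      · positivity
    exact_mod_cast h2
  calc _ ≤ ((X / p + 1 : ℕ) : ℝ) := by exact_mod_cast h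
    _ ≤ _ := by push_cast; gcongr; exact Nat.cast_div_le

lemma badd_card (X z i : ℕ) (hX : z^5 ≤ X) (hi : 1 ≤ i) :
    (((Finset.Ico X (2*X)).filter (badd z i)).card : ℝ) ≤ 7 * X / 2^i := by
  have hc : ((Finset.Ico X (2*X)).card : ℝ) ≤ X := by
    rw [Nat.card_Ico, two_mul, Nat.add_sub_cancel]
  have h1 := second_moment (Finset.Ico X (2*X)) (fun p d => chi d p) X z (fun p d => chi_abs d p) hc
    (by exact_mod_cast hX) (fun p q hp hq hpq => chi_off X z p q hp hq hpq) i hi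
  have h2 : (((Finset.Ico X (2*X)).filter (fun d => ¬ ∑ p ∈ (pr (2^i) z).filter (· ∣ d), (1:ℝ)/p ≤ 1)).card : ℝ) ≤ 4 * X / 2^i := by
    calc (((Finset.Ico X (2*X)).filter (fun d => ¬ ∑ p ∈ (pr (2^i) z).filter (· ∣ d), (1:ℝ)/p ≤ 1)).card : ℝ)
        = ∑ d ∈ (Finset.Ico X (2*X)).filter (fun d => ¬ ∑ p ∈ (pr (2^i) z).filter (· ∣ d), (1:ℝ)/p ≤ 1), (1:ℝ) := by simp
      _ ≤ ∑ d ∈ (Finset.Ico X (2*X)).filter (fun d => ¬ ∑ p ∈ (pr (2^i) z).filter (· ∣ d), (1:ℝ)/p ≤ 1),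
          ∑ p ∈ (pr (2^i) z).filter (· ∣ d), (1:ℝ)/p := by
          apply Finset.sum_le_sum; intro d hd
          have := (Finset.mem_filter.1 hd).2
          linarith [not_le.1 this]
      _ ≤ ∑ d ∈ (Finset.Ico X (2*X)), ∑ p ∈ (pr (2^i) z).filter (· ∣ d), (1:ℝ)/p := by
          apply Finset.sum_le_sum_of_subset_of_nonneg (Finset.filter_subset _ _)
          intros; positivity
      _ = ∑ p ∈ pr (2^i) z, (((Finset.Ico X (2*X)).filter (p ∣ ·)).card : ℝ) * (1/p) := by
          simp_rw [Finset.sum_filter]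
          rw [Finset.sum_comm]
          apply Finset.sum_congr rfl; intro p _
          rw [← Finset.sum_filter, Finset.sum_const, nsmul_eq_mul]
      _ ≤ ∑ p ∈ pr (2^i) z, 2 * X * (1/(p:ℝ)^2) := by
          apply Finset.sum_le_sum; intro p hp
          rw [mem_pr] at hp
          have hp0 : 0 < (p:ℝ) := by exact_mod_cast hp.2.2.pos
          have hpX : (p:ℝ) ≤ X := by
            have : p ≤ X := hp.2.1.trans ((Nat.le_self_pow (by norm_num) z).trans hX)
            exact_mod_cast this
          have h3 := card_dvd_Ico X p hp.2.2.pos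
          have h4 : (X:ℝ)/p + 1 ≤ 2 * X / p := by
            rw [mul_div_assoc, two_mul]
            gcongr
            rwa [le_div_iff₀ hp0, one_mul]
          calc _ ≤ (2 * X / p) * (1/(p:ℝ)) := by gcongr; exact h3.trans h4
            _ = _ := by field_simp
      _ ≤ 2 * X * (2 / ((2^i:ℕ) + 1 : ℝ)) := by
          rw [← Finset.mul_sum]; gcongr; exact_mod_cast sum_inv_sq_pr_le (2^i) z
      _ ≤ 2 * X * (2 / 2^i) := by gcongr; push_cast; linarith
      _ = _ := by ring
  have h3 : ((Finset.Ico X (2*X)).filter (badd z i)).card ≤ ((Finset.Ico X (2*X)).filter (fun d => ¬ |∑ p ∈ pr (2^i) z, chi d p / p| ≤ 1)).card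
     + ((Finset.Ico X (2*X)).filter (fun d => ¬ ∑ p ∈ (pr (2^i) z).filter (· ∣ d), (1:ℝ)/p ≤ 1)).card := by
    refine le_trans (Finset.card_le_card ?_) (Finset.card_union_le _ _)
    intro d hd
    rw [Finset.mem_filter] at hd
    rw [Finset.mem_union, Finset.mem_filter, Finset.mem_filter]
    rcases hd.2 with h | h
    · exact Or.inl ⟨hd.1, h⟩
    · exact Or.inr ⟨hd.1, h⟩
  have h3' : (((Finset.Ico X (2*X)).filter (badd z i)).card : ℝ) ≤ ((Finset.Ico X (2*X)).filter (fun d => ¬ |∑ p ∈ pr (2^i) z, chi d p / p| ≤ 1)).card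
     + ((Finset.Ico X (2*X)).filter (fun d => ¬ ∑ p ∈ (pr (2^i) z).filter (· ∣ d), (1:ℝ)/p ≤ 1)).card := by exact_mod_cast h3
  calc _ ≤ 3 * (X:ℝ)/2^i + 4 * X/2^i := h3'.trans (add_le_add h1 h2)
    _ = _ := by ring

theorem D1 : ∃ C : ℝ, 0 ≤ C ∧ ∀ X z : ℕ, z^5 ≤ X → ∑ d ∈ Finset.Ico X (2*X), (idx z d : ℝ)^12 ≤ C * X := by
  obtain ⟨c, hc0, hc⟩ := sum_pow_index 12
  refine ⟨1 + 7 * c, by positivity, ?_⟩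
  intro X z hX
  refine hc (Finset.Ico X (2*X)) (badd z) (idx z) X 7 (by positivity) (by norm_num) ?_ (fun i hi => badd_card X z i hX hi) ?_
  · rw [Nat.card_Ico, two_mul, Nat.add_sub_cancel]
  · intro d _ j h1 h2; exact idx_bad h1 h2

theorem D2 : ∃ C : ℝ, 0 ≤ C ∧ ∀ Q z : ℕ, z^5 ≤ Q^2 →
    ∑ m ∈ Finset.Icc 1 Q, ∑ n ∈ Finset.Icc 1 Q, Real.exp (∑ p ∈ pr 2 z, (jacobiSym ((m:ℤ) * n) p : ℝ) / p) ≤ C * (Q:ℝ)^2 := by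
  obtain ⟨c, hc0, hc⟩ := sum_pow_index 1
  obtain ⟨C1, hC1, hE⟩ := exp_rp_le
  refine ⟨Real.exp 1 * C1 * (1 + 3 * c), by positivity, ?_⟩
  intro Q z hz
  set Ω := Finset.Icc 1 Q ×ˢ Finset.Icc 1 Q with hΩ
  let cc : ℕ → ℕ × ℕ → ℝ := fun p ω => (jacobiSym ((ω.1:ℤ) * ω.2) p : ℝ)
  have hcc : ∀ p ω, |cc p ω| ≤ 1 := fun p ω => by
    show |(jacobiSym ((ω.1:ℤ) * ω.2) p : ℝ)| ≤ 1
    exact_mod_cast jac_abs _ _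
  have hcard : (Ω.card : ℝ) ≤ (Q:ℝ)^2 := by
    rw [hΩ, Finset.card_product]; simp [sq]
  have hoff : ∀ p q, p ∈ pr 2 z → q ∈ pr 2 z → p ≠ q → |∑ ω ∈ Ω, cc p ω * cc q ω| ≤ ((p:ℝ) * q)^2 := by
    intro p q hp hq hpq
    rw [mem_pr] at hp hq
    have e : ∑ ω ∈ Ω, cc p ω * cc q ω = (∑ n ∈ Finset.Ico 1 (1 + Q), ((jacobiSym (n:ℤ) p : ℝ) * (jacobiSym (n:ℤ) q : ℝ)))^2 := by
      have eI : Finset.Icc 1 Q = Finset.Ico 1 (1+Q) := by ext; simp; omega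
      rw [hΩ, Finset.sum_product, sq, Finset.sum_mul_sum, eI]
      apply Finset.sum_congr rfl; intro m _
      apply Finset.sum_congr rfl; intro n _
      simp only [cc]
      rw [jacobiSym.mul_left, jacobiSym.mul_left]
      push_cast; ring
    rw [e, abs_pow]
    gcongr
    exact jac_pair hp.2.2 hq.2.2 (by omega) (by omega) hpq 1 Q
  have hsm := second_moment Ω cc ((Q:ℝ)^2) z hcc hcard (by exact_mod_cast hz) hoff
  let ix : ℕ × ℕ → ℕ := fun ω => Nat.find (exists_good (fun p => cc p ω) z)
  have h := hc Ω (fun i ω => ¬ |∑ p ∈ pr (2^i) z, cc p ω / p| ≤ 1) ix ((Q:ℝ)^2) 3 (by positivity) (by norm_num) hcard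
    (fun i hi => by convert hsm i hi) ?_
  · rw [← Finset.sum_product (s := Finset.Icc 1 Q) (t := Finset.Icc 1 Q) (f := fun ω => Real.exp (∑ p ∈ pr 2 z, cc p ω / p))]
    calc ∑ ω ∈ Ω, Real.exp (∑ p ∈ pr 2 z, cc p ω / p) ≤ ∑ ω ∈ Ω, Real.exp 1 * C1 * (ix ω : ℝ)^1 := by
          apply Finset.sum_le_sum; intro ω _
          have hs := Nat.find_spec (exists_good (fun p => cc p ω) z)
          have h1 := sum_pr_two_le (fun p => cc p ω) (fun p => hcc p ω) z (ix ω) hs.1 hs.2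
          have h2 := hE (ix ω) hs.1
          calc _ ≤ Real.exp (rp 0 (2^(ix ω)) + 1) := Real.exp_le_exp.2 ((le_abs_self _).trans h1)
            _ = Real.exp 1 * Real.exp (rp 0 (2^(ix ω))) := by rw [Real.exp_add]; ring
            _ ≤ Real.exp 1 * (C1 * ix ω) := by gcongr
            _ = _ := by ring
      _ = Real.exp 1 * C1 * ∑ ω ∈ Ω, (ix ω : ℝ)^1 := by rw [Finset.mul_sum]
      _ ≤ Real.exp 1 * C1 * ((1 + 3 * c) * (Q:ℝ)^2) := by gcongr
      _ = _ := by ring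
  · intro ω _ j hj1 hj2 hg
    exact Nat.find_min (exists_good (fun p => cc p ω) z) hj2 ⟨hj1, hg⟩

lemma exists_twist {d d' : ℕ} (hd : Squarefree d) (hd' : Squarefree d') (hne : d ≠ d') :
    ∃ t : ℕ, Odd t ∧ jacobiSym ((d * d' : ℕ) : ℤ) t = -1 := by
  have hd0 : d ≠ 0 := hd.ne_zero
  have hd0' : d' ≠ 0 := hd'.ne_zero
  set G := Nat.gcd d d' with hG
  have hG0 : 0 < G := Nat.gcd_pos_of_pos_left _ (Nat.pos_of_ne_zero hd0)
  obtain ⟨a, ha⟩ : G ∣ d := Nat.gcd_dvd_left _ _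
  obtain ⟨b, hb⟩ : G ∣ d' := Nat.gcd_dvd_right _ _
  have hab : Nat.Coprime a b := by
    have := Nat.coprime_div_gcd_div_gcd (m := d) (n := d') hG0
    rw [← hG] at this
    rwa [ha, hb, Nat.mul_div_cancel_left _ hG0, Nat.mul_div_cancel_left _ hG0] at this
  have hGa : Nat.Coprime G a := Nat.coprime_of_squarefree_mul (ha ▸ hd)
  have hGb : Nat.Coprime G b := Nat.coprime_of_squarefree_mul (hb ▸ hd')
  have hsa : Squarefree a := hd.squarefree_of_dvd ⟨G, by rw [ha]; ring⟩
  have hsb : Squarefree b := hd'.squarefree_of_dvd ⟨G, by rw [hb]; ring⟩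
  have hsm : Squarefree (a * b) := (Nat.squarefree_mul hab).2 ⟨hsa, hsb⟩
  have hGm : Nat.Coprime G (a * b) := hGa.mul_right hGb
  have hm1 : a * b ≠ 1 := by
    intro h
    have h1 := Nat.eq_one_of_mul_eq_one_right h
    have h2 := Nat.eq_one_of_mul_eq_one_left h
    apply hne; rw [ha, hb, h1, h2]
  have hD : d * d' = (a * b) * G^2 := by rw [ha, hb]; ring
  by_cases hq : ∃ q, q.Prime ∧ q ≠ 2 ∧ q ∣ a * b
  · obtain ⟨q, hqp, hq2, r, hr⟩ := hq
    have hqr : Nat.Coprime q r := Nat.coprime_of_squarefree_mul (hr ▸ hsm)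
    have hqG : Nat.Coprime q G := (Nat.Coprime.coprime_dvd_right ⟨r, hr⟩ hGm).symm
    set R := r * G^2 with hR
    have hr0 : r ≠ 0 := by
      rintro rfl
      rw [hr] at hsm; simp at hsm
    have hR0 : 0 < R := Nat.mul_pos (Nat.pos_of_ne_zero hr0) (by positivity)
    have hq4 : Nat.Coprime q 4 := by
      rw [Nat.Prime.coprime_iff_not_dvd hqp]
      intro h
      have : q ∣ 2^2 := by simpa using h
      have := hqp.dvd_of_dvd_pow this
      exact hq2 ((Nat.prime_dvd_prime_iff_eq hqp Nat.prime_two).1 this)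
    have hcop : Nat.Coprime q (4 * R) := hq4.mul_right (hqr.mul_right (hqG.pow_right 2))
    obtain ⟨t0, ht0⟩ := exists_jac_neg_one hqp hq2
    obtain ⟨t, ht1, ht2⟩ := Nat.chineseRemainder hcop t0 1
    have htR : t % (4 * R) = 1 := by
      have : t % (4*R) = 1 % (4*R) := ht2
      rwa [Nat.mod_eq_of_lt (show 1 < 4 * R by omega)] at this
    have ht4 : t % 4 = 1 := by
      rw [← Nat.mod_mul_right_mod t 4 R, htR]
    have hodd : Odd t := Nat.odd_iff.2 (by omega)
    refine ⟨t, hodd, ?_⟩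
    have e : d * d' = q * R := by rw [hD, hr, hR]; ring
    rw [e]; push_cast
    rw [jacobiSym.mul_left]
    have e1 : jacobiSym (R:ℤ) t = 1 := by
      rw [jacobiSym.mod_right' R hodd, htR]; simp
    have e2 : jacobiSym (q:ℤ) t = -1 := by
      rw [← jacobiSym.quadratic_reciprocity_one_mod_four ht4 (hqp.odd_of_ne_two hq2), ← ht0]
      apply jacobiSym.mod_left'
      exact_mod_cast ht1
    rw [e1, e2]; norm_num
  · push Not at hq
    have hm2 : a * b = 2 := by
      obtain ⟨q, hqp, hqd⟩ := Nat.exists_prime_and_dvd hm1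
      have hq2 : q = 2 := by
        by_contra h; exact hq q hqp h hqd
      subst hq2
      obtain ⟨r, hr⟩ := hqd
      by_cases hr1 : r = 1
      · rw [hr, hr1]
      · obtain ⟨q, hqp, hqd⟩ := Nat.exists_prime_and_dvd hr1
        have hq2 : q = 2 := by
          by_contra h; exact hq q hqp h (hr ▸ hqd.mul_left 2)
        subst hq2
        obtain ⟨u, hu⟩ := hqd
        exfalso
        have := hsm 2 ⟨u, by rw [hr, hu]; ring⟩
        rw [Nat.isUnit_iff] at this; omega
    rw [hm2] at hGm hD
    have hc8 : Nat.Coprime G 8 := by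
      have := hGm.pow_right 3; simpa using this
    obtain ⟨t, ht1, ht2⟩ := Nat.chineseRemainder hc8 1 5
    have ht8 : t % 8 = 5 := ht2
    have hodd : Odd t := Nat.odd_iff.2 (by omega)
    refine ⟨t, hodd, ?_⟩
    rw [hD]; push_cast
    rw [jacobiSym.mul_left, jacobiSym.at_two hodd, ZMod.χ₈_nat_eq_if_mod_eight, jacobiSym.pow_left,
      jacobiSym.sq_one]
    · simp [ht8]; omega
    · have := ht1.gcd_eq
      rw [Nat.gcd_one_left] at this
      rw [Int.gcd_natCast_natCast, Nat.gcd_comm]; exact this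

lemma offdiag {d d' : ℕ} (hd : Squarefree d) (hd' : Squarefree d') (hne : d ≠ d') (L : ℕ) :
    |∑ n ∈ Finset.Ico 1 (1+L), if Odd n then (jacobiSym ((d * d' : ℕ) : ℤ) n : ℝ) else 0| ≤ 4 * (d * d' : ℕ) := by
  obtain ⟨t, hodd, ht⟩ := exists_twist hd hd' hne
  set D := d * d' with hD
  have hD0 : 0 < D := Nat.mul_pos (Nat.pos_of_ne_zero hd.ne_zero) (Nat.pos_of_ne_zero hd'.ne_zero)
  have hper : ∀ n, (fun n => if Odd n then (jacobiSym (D : ℤ) n : ℝ) else 0) (n + 4 * D)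
      = (fun n => if Odd n then (jacobiSym (D : ℤ) n : ℝ) else 0) n := by
    intro n
    simp only
    by_cases hn : Odd n
    · have hn' : Odd (n + 4 * D) := by rw [Nat.odd_iff] at hn ⊢; omega
      rw [if_pos hn, if_pos hn', jacobiSym.mod_right' D hn', jacobiSym.mod_right' D hn, Nat.add_mod_right]
    · have hn' : ¬ Odd (n + 4 * D) := by rw [Nat.odd_iff] at hn ⊢; omega
      rw [if_neg hn, if_neg hn']
  have h := periodic_sum_bound (fun n => if Odd n then (jacobiSym (D : ℤ) n : ℝ) else 0) (4 * D) (by omega) hper ?_ ?_ L 1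
  · exact_mod_cast h
  · intro n
    split_ifs
    · exact_mod_cast jac_abs _ _
    · simp
  · apply twist_sum_zero _ (4*D) t (by omega) hper
    · apply Nat.Coprime.mul_right
      · have : Nat.Coprime t 2 := Nat.coprime_two_right.2 hodd
        have := this.pow_right 2; simpa using this
      · by_contra hc
        have h0 : jacobiSym (D:ℤ) t = 0 := by
          rw [jacobiSym.eq_zero_iff]
          refine ⟨by rintro rfl; simp at hodd, ?_⟩
          rw [Int.gcd_natCast_natCast, Nat.gcd_comm]; exact hc
        rw [h0] at ht; norm_num at ht
    · intro n
      by_cases hn : Odd n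
      · rw [if_pos hn, if_pos (hodd.mul hn), jacobiSym.mul_right' _ (by rintro rfl; simp at hodd) (by rintro rfl; simp at hn), ht]
        push_cast; ring
      · rw [if_neg hn, if_neg]
        · simp
        · intro h; exact hn (Nat.odd_mul.1 h).2

lemma HM_sum (X : ℕ) (E : Finset ℕ) (hE : ∀ d ∈ E, Squarefree d ∧ d < 2*X) (L : ℕ) :
    ∑ n ∈ (Finset.Ico 1 (1+L)).filter Odd, (∑ d ∈ E, chi d n)^2 ≤ E.card * (L:ℝ) + 16 * (E.card:ℝ)^2 * (X:ℝ)^2 := by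
  have e : ∀ n, (∑ d ∈ E, chi d n)^2 = ∑ d ∈ E, ∑ d' ∈ E, (jacobiSym ((d * d' : ℕ):ℤ) n : ℝ) := by
    intro n
    rw [sq, Finset.sum_mul_sum]
    apply Finset.sum_congr rfl; intro d _
    apply Finset.sum_congr rfl; intro d' _
    unfold chi
    rw [show ((d * d' : ℕ):ℤ) = (-(d:ℤ)) * (-(d':ℤ)) by push_cast; ring, jacobiSym.mul_left]
    push_cast; ring
  have e2 : ∑ n ∈ (Finset.Ico 1 (1+L)).filter Odd, (∑ d ∈ E, chi d n)^2 =
      ∑ d ∈ E, ∑ d' ∈ E, ∑ n ∈ Finset.Ico 1 (1+L), if Odd n then (jacobiSym ((d * d' : ℕ):ℤ) n : ℝ) else 0 := by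
    simp_rw [e]
    rw [Finset.sum_comm]
    apply Finset.sum_congr rfl; intro d _
    rw [Finset.sum_comm]
    apply Finset.sum_congr rfl; intro d' _
    rw [Finset.sum_filter]
  rw [e2]
  have hb : ∀ d ∈ E, ∀ d' ∈ E, (∑ n ∈ Finset.Ico 1 (1+L), if Odd n then (jacobiSym ((d * d' : ℕ):ℤ) n : ℝ) else 0)
      ≤ (if d = d' then (L:ℝ) else 0) + 16 * (X:ℝ)^2 := by
    intro d hd d' hd'
    split_ifs with h
    · have : (∑ n ∈ Finset.Ico 1 (1+L), if Odd n then (jacobiSym ((d * d' : ℕ):ℤ) n : ℝ) else 0) ≤ ∑ n ∈ Finset.Ico 1 (1+L), (1:ℝ) := by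
        apply Finset.sum_le_sum; intro n _
        split_ifs
        · exact_mod_cast jac_le_one _ _
        · norm_num
      have h2 : ∑ n ∈ Finset.Ico 1 (1+L), (1:ℝ) = L := by simp
      nlinarith [sq_nonneg (X:ℝ)]
    · have h1 := (le_abs_self _).trans (offdiag (hE d hd).1 (hE d' hd').1 h L)
      have h2 : (d:ℝ) ≤ 2 * X := by exact_mod_cast (hE d hd).2.le
      have h3 : (d':ℝ) ≤ 2 * X := by exact_mod_cast (hE d' hd').2.le
      push_cast at h1 ⊢
      have : (d:ℝ) * d' ≤ (2*X)*(2*X) := by gcongr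
      nlinarith
  calc _ ≤ ∑ d ∈ E, ∑ d' ∈ E, ((if d = d' then (L:ℝ) else 0) + 16 * (X:ℝ)^2) :=
        Finset.sum_le_sum fun d hd => Finset.sum_le_sum fun d' hd' => hb d hd d' hd'
    _ = E.card * (L:ℝ) + 16 * (E.card:ℝ)^2 * (X:ℝ)^2 := by
        simp_rw [Finset.sum_add_distrib, Finset.sum_ite_eq]
        simp
        ring

lemma tuple_fiber (k : ℕ) (hk : 0 < k) (P : Finset ℕ) (hP : ∀ p ∈ P, p.Prime) (n : ℕ) (hn : n ≠ 0) :
    ((Fintype.piFinset (fun _ : Fin k => P)).filter (fun τ => ∏ i, τ i = n)).card ≤ k^k := by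
  by_cases hne : ((Fintype.piFinset (fun _ : Fin k => P)).filter (fun τ => ∏ i, τ i = n)).Nonempty
  · obtain ⟨τ0, h0⟩ := hne
    rw [Finset.mem_filter, Fintype.mem_piFinset] at h0
    have hpf : n.primeFactors ⊆ Finset.univ.image τ0 := by
      intro q hq
      have hqp := Nat.prime_of_mem_primeFactors hq
      have hqd := Nat.dvd_of_mem_primeFactors hq
      rw [← h0.2, hqp.prime.dvd_finset_prod_iff] at hqd
      obtain ⟨i, _, hi⟩ := hqd
      rw [Finset.mem_image]
      exact ⟨i, Finset.mem_univ _, ((Nat.prime_dvd_prime_iff_eq hqp (hP _ (h0.1 i))).1 hi).symm⟩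
    have hc : n.primeFactors.card ≤ k := by
      calc _ ≤ _ := Finset.card_le_card hpf
        _ ≤ _ := Finset.card_image_le
        _ = k := by simp
    calc _ ≤ (Fintype.piFinset (fun _ : Fin k => n.primeFactors)).card := by
          apply Finset.card_le_card
          intro τ hτ
          rw [Finset.mem_filter, Fintype.mem_piFinset] at hτ
          rw [Fintype.mem_piFinset]
          intro i
          rw [Nat.mem_primeFactors]
          exact ⟨hP _ (hτ.1 i), hτ.2 ▸ Finset.dvd_prod_of_mem τ (Finset.mem_univ i), hn⟩
      _ = n.primeFactors.card ^ k := by simp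
      _ ≤ k^k := Nat.pow_le_pow_left hc k
  · rw [Finset.not_nonempty_iff_eq_empty.1 hne]; simp

lemma HM (k : ℕ) (hk : 0 < k) (hke : Even k) (X x : ℕ) (E : Finset ℕ) (hE : ∀ d ∈ E, Squarefree d ∧ d < 2*X)
    (P : Finset ℕ) (hP : ∀ p ∈ P, p.Prime ∧ p ≠ 2 ∧ p ≤ x) (hlow : ∀ d ∈ E, ∑ p ∈ P, chi d p ≤ -(1/2) * (P.card:ℝ)) :
    (P.card:ℝ)^k * E.card ≤ (4 * k : ℝ)^k * ((x:ℝ)^k + 16 * E.card * (X:ℝ)^2) := by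
  set B : ℝ := (E.card : ℝ) with hB
  set n : ℝ := (P.card : ℝ) with hn
  set Tu := Fintype.piFinset (fun _ : Fin k => P) with hTu
  have hTc : (Tu.card : ℝ) = n^k := by simp [hTu, hn]
  set F : ℕ → ℝ := fun m => ∑ d ∈ E, chi d m with hF
  have hprod : ∀ τ ∈ Tu, ∀ d, ∏ i, chi d (τ i) = chi d (∏ i, τ i) := by
    intro τ hτ d
    rw [hTu, Fintype.mem_piFinset] at hτ
    unfold chi
    rw [← Int.cast_prod]
    congr 1
    have : ∀ s : Finset (Fin k), ∏ i ∈ s, jacobiSym (-(d:ℤ)) (τ i) = jacobiSym (-(d:ℤ)) (∏ i ∈ s, τ i) := by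
      intro s
      induction s using Finset.induction_on with
      | empty => simp
      | insert a s ha ih =>
        rw [Finset.prod_insert ha, Finset.prod_insert ha, ih, jacobiSym.mul_right']
        · exact (hP _ (hτ a)).1.ne_zero
        · exact Finset.prod_ne_zero_iff.2 fun i _ => (hP _ (hτ i)).1.ne_zero
    exact this _
  have h1 : B * (n/2)^k ≤ ∑ τ ∈ Tu, F (∏ i, τ i) := by
    calc B * (n/2)^k = ∑ d ∈ E, (n/2)^k := by simp [hB]
      _ ≤ ∑ d ∈ E, (∑ p ∈ P, chi d p)^k := by
          apply Finset.sum_le_sum; intro d hd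
          have := hlow d hd
          rw [← hke.neg_pow (∑ p ∈ P, chi d p)]
          gcongr
          linarith
      _ = ∑ d ∈ E, ∑ τ ∈ Tu, ∏ i, chi d (τ i) := by
          apply Finset.sum_congr rfl; intro d _
          rw [hTu, ← Finset.prod_univ_sum]; simp
      _ = ∑ τ ∈ Tu, F (∏ i, τ i) := by
          rw [Finset.sum_comm]
          apply Finset.sum_congr rfl; intro τ hτ
          rw [hF]
          apply Finset.sum_congr rfl; intro d _
          exact hprod τ hτ d
  have h2 : (∑ τ ∈ Tu, F (∏ i, τ i))^2 ≤ n^k * ∑ τ ∈ Tu, (F (∏ i, τ i))^2 := by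
    rw [← hTc]; exact sq_sum_le_card_mul_sum_sq
  have hmap : ∀ τ ∈ Tu, ∏ i, τ i ∈ (Finset.Ico 1 (1+x^k)).filter Odd := by
    intro τ hτ
    rw [hTu, Fintype.mem_piFinset] at hτ
    rw [Finset.mem_filter, Finset.mem_Ico]
    refine ⟨⟨?_, ?_⟩, ?_⟩
    · exact Nat.pos_of_ne_zero (Finset.prod_ne_zero_iff.2 fun i _ => (hP _ (hτ i)).1.ne_zero)
    · have : ∏ i, τ i ≤ ∏ i : Fin k, x := Finset.prod_le_prod' fun i _ => (hP _ (hτ i)).2.2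
      simp at this; omega
    · exact Finset.prod_induction _ Odd (fun a b => Odd.mul) (by simp) fun i _ => (hP _ (hτ i)).1.odd_of_ne_two (hP _ (hτ i)).2.1
  have h3 : ∑ τ ∈ Tu, (F (∏ i, τ i))^2 ≤ (k:ℝ)^k * ∑ m ∈ (Finset.Ico 1 (1+x^k)).filter Odd, (F m)^2 := by
    rw [← Finset.sum_fiberwise_of_maps_to hmap, Finset.mul_sum]
    apply Finset.sum_le_sum; intro m hm
    have hm0 : m ≠ 0 := by
      have := (Finset.mem_Ico.1 (Finset.mem_filter.1 hm).1).1; omega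
    calc ∑ τ ∈ Tu.filter (fun τ => ∏ i, τ i = m), (F (∏ i, τ i))^2 = ∑ τ ∈ Tu.filter (fun τ => ∏ i, τ i = m), (F m)^2 := by
          apply Finset.sum_congr rfl; intro τ hτ; rw [(Finset.mem_filter.1 hτ).2]
      _ = ((Tu.filter (fun τ => ∏ i, τ i = m)).card : ℝ) * (F m)^2 := by rw [Finset.sum_const, nsmul_eq_mul]
      _ ≤ (k:ℝ)^k * (F m)^2 := by
          gcongr
          exact_mod_cast tuple_fiber k hk P (fun p hp => (hP p hp).1) m hm0
  have h4 := HM_sum X E hE (x^k)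
  have hBn : 0 ≤ B := by positivity
  have hnn : 0 ≤ n := by positivity
  have h5 : (B * (n/2)^k)^2 ≤ n^k * ((k:ℝ)^k * (B * (x:ℝ)^k + 16 * B^2 * (X:ℝ)^2)) := by
    calc _ ≤ (∑ τ ∈ Tu, F (∏ i, τ i))^2 := by gcongr
      _ ≤ _ := h2
      _ ≤ _ := by
          gcongr
          refine h3.trans ?_
          gcongr
          push_cast at h4; exact h4
  rcases hBn.eq_or_lt with hB0 | hBpos
  · rw [← hB0]; simp; positivity
  rcases hnn.eq_or_lt with hn0 | hnpos
  · rw [← hn0, zero_pow hk.ne']; simp; positivity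
  have h6 : (B * n^k) * (n^k * B) ≤ ((4 * k : ℝ)^k * ((x:ℝ)^k + 16 * B * (X:ℝ)^2)) * (n^k * B) := by
    have e : (4:ℝ)^k * (B * (n/2)^k)^2 = (B * n^k) * (n^k * B) := by
      have : (4:ℝ)^k = (2^k)^2 := by rw [← pow_mul, mul_comm, pow_mul]; norm_num
      rw [this, div_pow]; field_simp
    rw [← e]
    calc _ ≤ (4:ℝ)^k * (n^k * ((k:ℝ)^k * (B * (x:ℝ)^k + 16 * B^2 * (X:ℝ)^2))) := by gcongr
      _ = _ := by rw [mul_pow]; ring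
  have := le_of_mul_le_mul_right h6 (by positivity)
  linarith

theorem D3 (s : ℕ) (hs : 1 ≤ s) : ∃ C : ℝ, 0 ≤ C ∧ ∃ x0 : ℕ, ∀ X x : ℕ, x0 ≤ x → X ≤ x^s →
    (((Finset.Ico X (2*X)).filter (fun d => Squarefree d ∧ ∑ p ∈ pr (x/4) x, chi d p ≤ -(1/2) * ((pr (x/4) x).card:ℝ))).card : ℝ)
      ≤ C * (Real.log x)^(6*s) := by
  obtain ⟨c, hc, x1, h1⟩ := cheb_lower
  set k := 6 * s with hk
  have hlog : ∀ᶠ x : ℝ in Filter.atTop, Real.log x ≤ c * x^(1/2:ℝ) := by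
    have := (isLittleO_log_rpow_atTop (show (0:ℝ) < 1/2 by norm_num)).bound hc
    filter_upwards [this, Filter.eventually_ge_atTop 1] with x hx hx1
    rw [Real.norm_of_nonneg (Real.log_nonneg hx1), Real.norm_of_nonneg (by positivity)] at hx
    exact hx
  obtain ⟨x2, h2⟩ := (tendsto_natCast_atTop_atTop (R := ℝ)).eventually hlog |> Filter.eventually_atTop.1
  refine ⟨2 * (4 * k : ℝ)^k / c^k, by positivity, max (max x1 x2) (max 12 (32 * (4*k)^k)), ?_⟩
  intro X x hx hX
  have hx1 : x1 ≤ x := le_trans (le_trans (le_max_left _ _) (le_max_left _ _)) hx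
  have hx2 : x2 ≤ x := le_trans (le_trans (le_max_right _ _) (le_max_left _ _)) hx
  have hx3 : 12 ≤ x := le_trans (le_trans (le_max_left _ _) (le_max_right _ _)) hx
  have hx4 : 32 * (4*k)^k ≤ x := le_trans (le_trans (le_max_right _ _) (le_max_right _ _)) hx
  have hx0 : (0:ℝ) < x := by exact_mod_cast (by omega : 0 < x)
  have hlx : 0 < Real.log x := Real.log_pos (by exact_mod_cast (by omega : 1 < x))
  have hn := h1 x hx1
  have hl := h2 x hx2
  set P := pr (x/4) x with hP
  set E := (Finset.Ico X (2*X)).filter (fun d => Squarefree d ∧ ∑ p ∈ P, chi d p ≤ -(1/2) * (P.card:ℝ)) with hE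
  have hm := HM k (by omega) ⟨3*s, by omega⟩ X x E
    (by intro d hd; rw [hE, Finset.mem_filter, Finset.mem_Ico] at hd; exact ⟨hd.2.1, hd.1.2⟩) P
    (by intro p hp; rw [hP, mem_pr] at hp; exact ⟨hp.2.2, by omega, hp.2.1⟩)
    (by intro d hd; rw [hE, Finset.mem_filter] at hd; exact hd.2.2)
  set B : ℝ := (E.card : ℝ) with hB
  set n : ℝ := (P.card : ℝ) with hnn
  have hBn : 0 ≤ B := by positivity
  have hsq : (x:ℝ)^(1/2:ℝ) ≤ n := by
    refine le_trans ?_ hn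
    rw [le_div_iff₀ hlx]
    calc (x:ℝ)^(1/2:ℝ) * Real.log x ≤ (x:ℝ)^(1/2:ℝ) * (c * (x:ℝ)^(1/2:ℝ)) := by gcongr
      _ = c * ((x:ℝ)^(1/2:ℝ) * (x:ℝ)^(1/2:ℝ)) := by ring
      _ = c * x := by rw [← Real.rpow_add hx0]; norm_num
  have hnk : (x:ℝ)^(3*s) ≤ n^k := by
    calc (x:ℝ)^(3*s) = ((x:ℝ)^(1/2:ℝ))^k := by
          rw [← Real.rpow_natCast, ← Real.rpow_natCast, ← Real.rpow_mul hx0.le]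
          congr 1; rw [hk]; push_cast; ring
      _ ≤ n^k := by gcongr
  have hXs : (X:ℝ)^2 ≤ (x:ℝ)^(2*s) := by
    have : (X:ℝ) ≤ (x:ℝ)^s := by exact_mod_cast hX
    calc (X:ℝ)^2 ≤ ((x:ℝ)^s)^2 := by gcongr
      _ = _ := by rw [← pow_mul]; congr 1; ring
  have hkk : 32 * (4 * k : ℝ)^k ≤ (x:ℝ)^s := by
    calc 32 * (4 * k : ℝ)^k ≤ x := by exact_mod_cast hx4
      _ = (x:ℝ)^1 := by simp
      _ ≤ (x:ℝ)^s := pow_le_pow_right₀ (by exact_mod_cast (by omega : 1 ≤ x)) hs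
  have h5 : (4 * k : ℝ)^k * (16 * B * (X:ℝ)^2) ≤ n^k * B / 2 := by
    calc (4 * k : ℝ)^k * (16 * B * (X:ℝ)^2) = (32 * (4 * k : ℝ)^k) * (X:ℝ)^2 * B / 2 := by ring
      _ ≤ (x:ℝ)^s * (x:ℝ)^(2*s) * B / 2 := by gcongr
      _ = (x:ℝ)^(3*s) * B / 2 := by rw [← pow_add]; congr 3; ring
      _ ≤ _ := by gcongr
  have h6 : n^k * B ≤ 2 * (4 * k : ℝ)^k * (x:ℝ)^k := by linarith
  have h7 : (c * x / Real.log x)^k * B ≤ 2 * (4 * k : ℝ)^k * (x:ℝ)^k :=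
    le_trans (by gcongr) h6
  rw [div_pow, mul_pow] at h7
  have h8 : (x:ℝ)^k * (c^k * B) ≤ (x:ℝ)^k * (2 * (4*k:ℝ)^k * (Real.log x)^k) := by
    have h9 := mul_le_mul_of_nonneg_right h7 (show 0 ≤ (Real.log x)^k by positivity)
    calc _ = c ^ k * (x:ℝ) ^ k / Real.log x ^ k * B * Real.log x ^ k := by field_simp
      _ ≤ _ := h9
      _ = _ := by ring
  have h10 := le_of_mul_le_mul_left h8 (by positivity)
  rw [div_mul_eq_mul_div, le_div_iff₀ (by positivity)]
  linarith

structure QR (R : Type) [CommRing R] (d : ℕ) where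
  δ : R
  hδ : δ^2 = -(d:R)
  σ : R →+* R
  hσ : σ δ = -δ
  φ : R →+* ℂ
  hφ : Function.Injective φ
  hφδ : φ δ = Complex.I * (Real.sqrt d : ℂ)
  hφσ : ∀ x, φ (σ x) = (starRingEnd ℂ) (φ x)
  half : ∀ x : R, ∃ u v : ℤ, 2 * x = (u:R) + v * δ
  dvd : ∀ m n : ℤ, (m:R) ∣ (n:R) → m ∣ n

noncomputable section
/-- the element √-d of `Qneg d` -/
def dl (d : ℕ) : Qneg d := ⟨Complex.I * (Real.sqrt d : ℂ), mem_adjoin_simple_self ℚ _⟩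

lemma dl_sq_C (d : ℕ) : (Complex.I * (Real.sqrt d : ℂ))^2 = -(d:ℂ) := by
  rw [mul_pow, Complex.I_sq, ← Complex.ofReal_pow, Real.sq_sqrt (by positivity)]; simp

lemma dl_sq (d : ℕ) : (dl d)^2 = -(d : Qneg d) := by
  apply Subtype.ext
  have := dl_sq_C d
  simpa [dl] using this

lemma dl_int (d : ℕ) : IsIntegral ℤ (dl d) := by
  refine ⟨Polynomial.X^2 + Polynomial.C (d:ℤ), ?_, ?_⟩
  · monicity!
  · simp [dl_sq]

lemma Qneg_mem (d : ℕ) (x : ℂ) (hx : x ∈ Qneg d) : ∃ a b : ℚ, x = a + b * (Complex.I * (Real.sqrt d : ℂ)) := by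
  have hint : IsIntegral ℚ (Complex.I * (Real.sqrt d : ℂ)) := by
    refine ⟨Polynomial.X^2 + Polynomial.C (d:ℚ), by monicity!, ?_⟩
    simp [dl_sq_C d]
  have hx' : x ∈ Algebra.adjoin ℚ {Complex.I * (Real.sqrt d : ℂ)} := by
    rw [Qneg] at hx
    rw [← IntermediateField.mem_toSubalgebra, IntermediateField.adjoin_simple_toSubalgebra_of_isAlgebraic hint.isAlgebraic] at hx
    exact hx
  clear hx
  induction hx' using Algebra.adjoin_induction with
  | mem y hy => rw [Set.mem_singleton_iff] at hy; exact ⟨0, 1, by rw [hy]; simp⟩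
  | algebraMap r => exact ⟨r, 0, by simp⟩
  | add x y _ _ hx hy =>
    obtain ⟨a, b, rfl⟩ := hx
    obtain ⟨a', b', rfl⟩ := hy
    exact ⟨a + a', b + b', by push_cast; ring⟩
  | mul x y _ _ hx hy =>
    obtain ⟨a, b, rfl⟩ := hx
    obtain ⟨a', b', rfl⟩ := hy
    refine ⟨a * a' - d * (b * b'), a * b' + b * a', ?_⟩
    have := dl_sq_C d
    push_cast
    linear_combination (b * b' : ℂ) * this

instance Qneg_nf (d : ℕ) : NumberField (Qneg d) := by
  have hint : IsIntegral ℚ (Complex.I * (Real.sqrt d : ℂ)) := by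
    refine ⟨Polynomial.X^2 + Polynomial.C (d:ℚ), by monicity!, ?_⟩
    simp [dl_sq_C d]
  have : FiniteDimensional ℚ (Qneg d) := IntermediateField.adjoin.finiteDimensional hint
  exact ⟨⟩

/-- complex conjugation on `Qneg d` -/
def cj (d : ℕ) : Qneg d →+* Qneg d where
  toFun x := ⟨(starRingEnd ℂ) x, by
    obtain ⟨a, b, h⟩ := Qneg_mem d x x.2
    have h1 : (starRingEnd ℂ) (x : ℂ) = (a:ℂ) + (-b : ℚ) * (Complex.I * (Real.sqrt d : ℂ)) := by
      rw [h]; simp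
    rw [h1]
    have h2 : Complex.I * (Real.sqrt d : ℂ) ∈ Qneg d := mem_adjoin_simple_self ℚ _
    exact add_mem ((Qneg d).algebraMap_mem a) (mul_mem ((Qneg d).algebraMap_mem (-b)) h2)⟩
  map_one' := by ext; simp
  map_zero' := by ext; simp
  map_add' x y := by ext; simp
  map_mul' x y := by ext; simp

lemma rat_int {d : ℕ} (q : ℚ) (h : IsIntegral ℤ (q : Qneg d)) : ∃ n : ℤ, q = n := by
  have h' : IsIntegral ℤ (algebraMap ℚ (Qneg d) q) := by simpa using h
  have h2 : IsIntegral ℤ q := (isIntegral_algebraMap_iff (algebraMap ℚ (Qneg d)).injective).1 h'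
  obtain ⟨n, hn⟩ := IsIntegrallyClosed.isIntegral_iff.1 h2
  exact ⟨n, by rw [← hn]; simp⟩

lemma sqfree_rat {d : ℕ} (hd : Squarefree d) (q : ℚ) (n : ℤ) (h : d * q^2 = n) : ∃ m : ℤ, q = m := by
  refine ⟨q.num, ?_⟩
  suffices q.den = 1 by exact (Rat.den_eq_one_iff q).1 this |>.symm
  by_contra hne
  obtain ⟨p, hp, hpd⟩ := Nat.exists_prime_and_dvd hne
  have h1 : (d:ℤ) * q.num^2 = n * (q.den:ℤ)^2 := by
    have hden : (q.den : ℚ) ≠ 0 := by exact_mod_cast q.den_ne_zero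
    have : (d:ℚ) * q.num^2 = n * (q.den:ℚ)^2 := by
      rw [← h]
      have := Rat.num_div_den q
      nth_rewrite 2 [← this]
      field_simp
    exact_mod_cast this
  have hpn : ¬ (p:ℤ) ∣ q.num := by
    intro hh
    have := q.reduced
    have h3 : p ∣ q.num.natAbs := Int.natCast_dvd.1 hh
    have := Nat.dvd_gcd h3 hpd
    rw [q.reduced] at this
    exact hp.one_lt.ne' (Nat.dvd_one.1 this)
  have hpp : ((p:ℤ)^2) ∣ d * q.num^2 := by
    rw [h1]
    exact Dvd.dvd.mul_left (pow_dvd_pow_of_dvd (Int.natCast_dvd_natCast.2 hpd) 2) _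
  have hcop : IsCoprime ((p:ℤ)^2) (q.num^2) := by
    apply IsCoprime.pow
    exact (Nat.prime_iff_prime_int.1 hp).irreducible.coprime_iff_not_dvd.2 hpn
  have h4 : ((p:ℤ)^2) ∣ d := hcop.dvd_of_dvd_mul_right hpp
  have h5 : p * p ∣ d := by
    have : ((p * p : ℕ) : ℤ) ∣ d := by push_cast; rwa [← sq]
    exact Int.natCast_dvd_natCast.1 this
  have := hd p h5
  exact hp.one_lt.ne' (Nat.isUnit_iff.1 this)

lemma half_Qneg {d : ℕ} (hd : Squarefree d) (x : 𝓞 (Qneg d)) : ∃ u v : ℤ, 2 * ((x : Qneg d) : ℂ) = (u:ℂ) + v * (Complex.I * (Real.sqrt d : ℂ)) := by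
  obtain ⟨a, b, h⟩ := Qneg_mem d (x : Qneg d) (x : Qneg d).2
  set y : 𝓞 (Qneg d) := RingOfIntegers.mapRingHom (cj d) x with hy
  have hyc : ((y : Qneg d) : ℂ) = (a:ℂ) - b * (Complex.I * (Real.sqrt d : ℂ)) := by
    have : ((y : Qneg d) : ℂ) = (starRingEnd ℂ) ((x : Qneg d) : ℂ) := rfl
    rw [this, h]; simp; ring
  have hs : ((2 * a : ℚ) : Qneg d) = ((x + y : 𝓞 (Qneg d)) : Qneg d) := by
    apply Subtype.ext
    have e : ((x : Qneg d) : ℂ) + ((y : Qneg d) : ℂ) = 2 * a := by rw [h, hyc]; ring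
    show ((2 * a : ℚ) : ℂ) = ((x : Qneg d) : ℂ) + ((y : Qneg d) : ℂ)
    rw [e]; simp
  have hp : ((a^2 + d * b^2 : ℚ) : Qneg d) = ((x * y : 𝓞 (Qneg d)) : Qneg d) := by
    apply Subtype.ext
    have e : ((x : Qneg d) : ℂ) * ((y : Qneg d) : ℂ) = (a:ℂ)^2 + d * b^2 := by
      rw [h, hyc]; linear_combination (-(b:ℂ)^2) * dl_sq_C d
    show ((a^2 + d * b^2 : ℚ) : ℂ) = ((x : Qneg d) : ℂ) * ((y : Qneg d) : ℂ)
    rw [e]; simp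
  obtain ⟨u, hu⟩ := rat_int (d := d) (2 * a) (by rw [hs]; exact RingOfIntegers.isIntegral_coe _)
  obtain ⟨n, hn⟩ := rat_int (d := d) (a^2 + d * b^2) (by rw [hp]; exact RingOfIntegers.isIntegral_coe _)
  obtain ⟨v, hv⟩ := sqfree_rat hd (2 * b) (4 * n - u^2) (by push_cast; rw [← hu, ← hn]; ring)
  refine ⟨u, v, ?_⟩
  have hu' : (2 * a : ℂ) = u := by exact_mod_cast congrArg (fun q : ℚ => (q:ℂ)) hu
  have hv' : (2 * b : ℂ) = v := by exact_mod_cast congrArg (fun q : ℚ => (q:ℂ)) hv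
  rw [h, ← hu', ← hv']; ring

/-- √-d as an integer -/
def dlO (d : ℕ) : 𝓞 (Qneg d) := ⟨dl d, (mem_integralClosure_iff ℤ (Qneg d)).2 (dl_int d)⟩

lemma dlO_coe (d : ℕ) : algebraMap (𝓞 (Qneg d)) (Qneg d) (dlO d) = dl d := rfl

/-- instance of the abstract structure -/
def QRi (d : ℕ) (hd : Squarefree d) : QR (𝓞 (Qneg d)) d where
  δ := dlO d
  hδ := by
    apply RingOfIntegers.coe_injective
    rw [map_pow, map_neg, map_natCast, dlO_coe]; exact dl_sq d
  σ := RingOfIntegers.mapRingHom (cj d)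
  hσ := by
    apply RingOfIntegers.coe_injective
    apply Subtype.ext
    show (starRingEnd ℂ) (Complex.I * (Real.sqrt d : ℂ)) = -(Complex.I * (Real.sqrt d : ℂ))
    simp
  φ := (algebraMap (Qneg d) ℂ).comp (algebraMap (𝓞 (Qneg d)) (Qneg d))
  hφ := by
    rw [RingHom.coe_comp]
    exact (algebraMap (Qneg d) ℂ).injective.comp RingOfIntegers.coe_injective
  hφδ := rfl
  hφσ x := rfl
  half x := by
    obtain ⟨u, v, h⟩ := half_Qneg hd x
    refine ⟨u, v, ?_⟩
    apply RingOfIntegers.coe_injective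
    apply Subtype.ext
    rw [map_mul, map_add, map_mul, map_intCast, map_intCast, map_ofNat, dlO_coe]
    exact h
  dvd m n h := by
    obtain ⟨x, hx⟩ := h
    rcases eq_or_ne m 0 with rfl | hm
    · have : (n : 𝓞 (Qneg d)) = 0 := by simpa using hx
      have : n = 0 := by exact_mod_cast this
      rw [this]
    have h1 : (((n:ℚ)/m : ℚ) : Qneg d) = (x : Qneg d) := by
      have h2 := congrArg (fun z : 𝓞 (Qneg d) => (z : Qneg d)) hx
      simp only [map_mul, map_intCast] at h2
      have hm' : ((m:ℤ) : Qneg d) ≠ 0 := by exact_mod_cast hm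
      push_cast
      rw [h2]; field_simp
    obtain ⟨k, hk⟩ := rat_int (d := d) ((n:ℚ)/m) (by rw [h1]; exact RingOfIntegers.isIntegral_coe _)
    refine ⟨k, ?_⟩
    have hm' : (m:ℚ) ≠ 0 := by exact_mod_cast hm
    rw [div_eq_iff hm'] at hk
    have : n = k * m := by exact_mod_cast hk
    rw [this]; ring
end

namespace QR
variable {R : Type} [CommRing R] {d : ℕ}

lemma re_im (q : QR R d) {x : R} {u v : ℤ} (h : 2 * x = (u:R) + v * q.δ) :
    2 * (q.φ x).re = u ∧ 2 * (q.φ x).im = v * Real.sqrt d := by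
  have h1 := congrArg q.φ h
  rw [map_mul, map_add, map_mul, map_intCast, map_intCast, map_ofNat, q.hφδ] at h1
  have h2 := congrArg Complex.re h1
  have h3 := congrArg Complex.im h1
  constructor
  · simpa using h2
  · simpa using h3

lemma nrm (q : QR R d) (x : R) : ∃ k : ℕ, 4 * Complex.normSq (q.φ x) = k := by
  obtain ⟨u, v, h⟩ := q.half x
  obtain ⟨h1, h2⟩ := q.re_im h
  refine ⟨(u^2 + d * v^2).toNat, ?_⟩
  have : (((u^2 + d * v^2).toNat : ℤ) : ℝ) = ((u^2 + d * v^2 : ℤ) : ℝ) := by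
    rw [Int.toNat_of_nonneg (by positivity)]
  rw [Int.cast_natCast] at this
  rw [this, Complex.normSq_apply]
  push_cast
  have hs : Real.sqrt d ^ 2 = d := Real.sq_sqrt (by positivity)
  rw [← h1, ← hs]
  have : (v:ℝ) ^2 * (Real.sqrt d)^2 = (2 * (q.φ x).im)^2 := by rw [h2]; ring
  nlinarith

lemma reduce (q : QR R d) (hd : 0 < d) (I : Ideal R) (hI : I ≠ ⊥) :
    ∃ α : R, α ≠ 0 ∧ ∃ (a : ℕ) (b : ℤ), 0 < a ∧ 3 * a^2 ≤ 4 * d ∧ (a:ℤ) ∣ b^2 + d ∧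
      (∀ x ∈ I, ∃ m n : ℤ, (a:R) * x = α * (m * a + n * (b + q.δ))) ∧
      (∀ m n : ℤ, ∃ x ∈ I, (a:R) * x = α * (m * a + n * (b + q.δ))) := by
  have hr : 0 < Real.sqrt d := Real.sqrt_pos.2 (by exact_mod_cast hd)
  have hr2 : Real.sqrt d * Real.sqrt d = d := Real.mul_self_sqrt (by positivity)
  -- minimal element
  have hex : ∃ k : ℕ, ∃ x ∈ I, x ≠ 0 ∧ 4 * Complex.normSq (q.φ x) = k := by
    obtain ⟨x, hx, hx0⟩ := Submodule.exists_mem_ne_zero_of_ne_bot hI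
    obtain ⟨k, hk⟩ := q.nrm x
    exact ⟨k, x, hx, hx0, hk⟩
  obtain ⟨α, hαI, hα0, hαk⟩ := Nat.find_spec hex
  have hmin : ∀ x ∈ I, x ≠ 0 → Complex.normSq (q.φ α) ≤ Complex.normSq (q.φ x) := by
    intro x hx hx0
    obtain ⟨k, hk⟩ := q.nrm x
    have h1 : Nat.find hex ≤ k := Nat.find_min' hex ⟨x, hx, hx0, hk⟩
    have h2 : ((Nat.find hex : ℕ) : ℝ) ≤ k := by exact_mod_cast h1
    linarith
  set A := q.φ α with hA
  have hA0 : A ≠ 0 := by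
    intro h; apply hα0; apply q.hφ; rw [← hA, h, map_zero]
  have hNA : 0 < Complex.normSq A := Complex.normSq_pos.2 hA0
  let J : ℂ → Prop := fun z => ∃ x ∈ I, q.φ x = A * z
  have J1 : J 1 := ⟨α, hαI, by simp [hA]⟩
  have Jadd : ∀ z w, J z → J w → J (z + w) := by
    rintro z w ⟨x, hx, hxz⟩ ⟨y, hy, hyw⟩
    exact ⟨x + y, I.add_mem hx hy, by rw [map_add, hxz, hyw]; ring⟩
  have Jmul : ∀ y z, J z → J (q.φ y * z) := by
    rintro y z ⟨x, hx, hxz⟩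
    exact ⟨y * x, I.mul_mem_left y hx, by rw [map_mul, hxz]; ring⟩
  have Jint : ∀ (n : ℤ) z, J z → J (n * z) := by
    intro n z hz
    have := Jmul (n:R) z hz
    rwa [map_intCast] at this
  have Jmin : ∀ z, J z → z ≠ 0 → 1 ≤ Complex.normSq z := by
    rintro z ⟨x, hx, hxz⟩ hz
    have hx0 : x ≠ 0 := by
      rintro rfl
      rw [map_zero] at hxz
      exact (mul_ne_zero hA0 hz) hxz.symm
    have := hmin x hx hx0
    rw [hxz, map_mul] at this
    by_contra hlt
    nlinarith [not_le.1 hlt]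
  have Jreal : ∀ z, J z → z.im = 0 → ∃ m : ℤ, z = m := by
    intro z hz him
    refine ⟨⌊z.re⌋, ?_⟩
    have h1 : J (z + ((-⌊z.re⌋ : ℤ):ℂ) * 1) := Jadd _ _ hz (Jint _ _ J1)
    by_contra hne
    have h2 : z + ((-⌊z.re⌋ : ℤ):ℂ) * 1 ≠ 0 := by
      intro h0; apply hne
      push_cast at h0
      linear_combination h0
    have h3 := Jmin _ h1 h2
    rw [Complex.normSq_apply] at h3
    simp [him] at h3
    have h4 := Int.floor_le z.re
    have h5 := Int.lt_floor_add_one z.re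
    nlinarith
  have Jim : ∀ z, J z → ∃ v : ℤ, 2 * Complex.normSq A * z.im = v * Real.sqrt d := by
    rintro z ⟨x, hx, hxz⟩
    obtain ⟨u, v, h⟩ := q.half (x * q.σ α)
    refine ⟨v, ?_⟩
    rw [← (q.re_im h).2, map_mul, q.hφσ, ← hA, hxz]
    have : A * z * (starRingEnd ℂ) A = (Complex.normSq A : ℂ) * z := by
      rw [← Complex.mul_conj]; ring
    rw [this, Complex.im_ofReal_mul]
    ring
  let H : AddSubgroup ℤ :=
    { carrier := {v | ∃ z, J z ∧ 2 * Complex.normSq A * z.im = v * Real.sqrt d}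
      add_mem' := by
        rintro v w ⟨z, hz, hzv⟩ ⟨z', hz', hzw⟩
        refine ⟨z + z', Jadd _ _ hz hz', ?_⟩
        push_cast; rw [Complex.add_im]; linarith
      zero_mem' := ⟨0, ⟨0, I.zero_mem, by simp⟩, by simp⟩
      neg_mem' := by
        rintro v ⟨z, hz, hzv⟩
        refine ⟨((-1:ℤ):ℂ) * z, Jint _ _ hz, ?_⟩
        push_cast
        rw [neg_one_mul, Complex.neg_im]; linarith }
  obtain ⟨g, hg⟩ := Int.subgroup_cyclic H
  have hgm : ∀ v ∈ H, ∃ k : ℤ, v = k * g := by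
    intro v hv
    rw [hg, AddSubgroup.mem_closure_singleton] at hv
    obtain ⟨k, hk⟩ := hv
    exact ⟨k, by rw [← hk]; simp⟩
  have hgH : g ∈ H := by rw [hg]; exact AddSubgroup.subset_closure rfl
  obtain ⟨ω0, hω0, hω0g⟩ := hgH
  have hspan0 : ∀ z, J z → ∃ m n : ℤ, z = m + n * ω0 := by
    intro z hz
    obtain ⟨v, hv⟩ := Jim z hz
    obtain ⟨k, hk⟩ := hgm v ⟨z, hz, hv⟩
    have h1 : J (z + ((-k:ℤ):ℂ) * ω0) := Jadd _ _ hz (Jint _ _ hω0)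
    obtain ⟨m, hm⟩ := Jreal _ h1 (by
      rw [Complex.add_im, show (((-k:ℤ):ℂ) * ω0).im = -k * ω0.im by
        rw [show (((-k:ℤ):ℂ)) = (((-k:ℤ):ℝ):ℂ) by push_cast; rfl, Complex.im_ofReal_mul]; push_cast; ring]
      have : 2 * Complex.normSq A * (z.im + -k * ω0.im) = 0 := by
        rw [mul_add, hv, hk]
        push_cast
        linear_combination (-(k:ℝ)) * hω0g
      rcases mul_eq_zero.1 this with h | h
      · exfalso; linarith
      · exact h)
    refine ⟨m, k, ?_⟩
    push_cast at hm
    linear_combination hm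
  have hδJ : J (q.φ q.δ) := by
    have := Jmul q.δ 1 J1; rwa [mul_one] at this
  obtain ⟨m0, k, hk⟩ := hspan0 _ hδJ
  have hk0 : k ≠ 0 := by
    rintro rfl
    have := congrArg Complex.im hk
    rw [q.hφδ] at this
    simp at this
    exact hd.ne' this
  -- normalise sign
  obtain ⟨a, ω1, b0, ha, hω1, hω1e, hspan1⟩ : ∃ (a : ℕ) (ω1 : ℂ) (b0 : ℤ), 0 < a ∧ J ω1 ∧ (a:ℂ) * ω1 = b0 + q.φ q.δ ∧
      ∀ z, J z → ∃ m n : ℤ, z = m + n * ω1 := by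
    rcases lt_or_gt_of_ne hk0 with hneg | hpos
    · refine ⟨k.natAbs, ((-1:ℤ):ℂ) * ω0, -m0, by omega, Jint _ _ hω0, ?_, ?_⟩
      · rw [hk]
        have : (k.natAbs : ℂ) = -(k:ℂ) := by
          have : ((k.natAbs : ℤ) : ℂ) = ((-k : ℤ):ℂ) := by congr 1; omega
          rw [Int.cast_natCast] at this; rw [this]; push_cast; rfl
        rw [this]; push_cast; ring
      · intro z hz
        obtain ⟨m, n, h⟩ := hspan0 z hz
        exact ⟨m, -n, by rw [h]; push_cast; ring⟩
    · refine ⟨k.natAbs, ω0, -m0, by omega, hω0, ?_, hspan0⟩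
      rw [hk]
      have : (k.natAbs : ℂ) = (k:ℂ) := by
        have : ((k.natAbs : ℤ) : ℂ) = ((k : ℤ):ℂ) := by congr 1; omega
        rw [Int.cast_natCast] at this; rw [this]
      rw [this]; push_cast; ring
  -- shift
  set j : ℤ := (2 * b0 + a) / (2 * a) with hj
  set b : ℤ := b0 - a * j with hb
  set ω : ℂ := ω1 - j with hω
  have haZ : (0:ℤ) < a := by exact_mod_cast ha
  have hb2 : 4 * b^2 ≤ (a:ℤ)^2 := by
    have h1 := Int.emod_add_mul_ediv (2 * b0 + a) (2 * a)
    have h2 := Int.emod_nonneg (2 * b0 + a) (show (2 * (a:ℤ)) ≠ 0 by omega)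
    have h3 := Int.emod_lt_of_pos (2 * b0 + a) (show 0 < (2 * (a:ℤ)) by omega)
    rw [← hj] at h1
    have h4 : 2 * b + a = (2 * b0 + a) % (2 * a) := by rw [hb]; linarith
    have h5 : 0 ≤ 2 * b + a := by omega
    have h6 : 2 * b + a < 2 * a := by omega
    nlinarith
  have hJω : J ω := by
    have := Jadd _ _ hω1 (Jint (-j) 1 J1)
    convert this using 1
    rw [hω]; push_cast; ring
  have hωe : (a:ℂ) * ω = b + q.φ q.δ := by
    rw [hω, mul_sub, hω1e, hb]; push_cast; ring
  have hspan : ∀ z, J z → ∃ m n : ℤ, z = m + n * ω := by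
    intro z hz
    obtain ⟨m, n, h⟩ := hspan1 z hz
    exact ⟨m + n * j, n, by rw [h, hω]; push_cast; ring⟩
  have haC : (a:ℂ) ≠ 0 := by exact_mod_cast ha.ne'
  refine ⟨α, hα0, a, b, ha, ?_, ?_, ?_, ?_⟩
  · have h1 : ω ≠ 0 := by
      intro h
      rw [h, mul_zero, q.hφδ] at hωe
      have := congrArg Complex.im hωe
      simp at this
      exact hr.ne this
    have h2 := Jmin ω hJω h1
    have h3 := congrArg Complex.normSq hωe
    rw [map_mul, Complex.normSq_natCast, q.hφδ, Complex.normSq_apply (_ + _)] at h3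
    simp at h3
    have h4 : (a:ℝ)^2 ≤ b^2 + d := by nlinarith [show (0:ℝ) < a by exact_mod_cast ha]
    have h5 : (a:ℤ)^2 ≤ b^2 + d := by exact_mod_cast h4
    have h6 : 3 * (a:ℤ)^2 ≤ 4 * d := by linarith
    exact_mod_cast h6
  · obtain ⟨m, n, h⟩ := hspan _ (Jmul q.δ ω hJω)
    have h1 : q.φ q.δ * (b + q.φ q.δ) = m * a + n * (b + q.φ q.δ) := by
      rw [← hωe]; linear_combination (a:ℂ) * h
    rw [q.hφδ] at h1
    have h2 := congrArg Complex.im h1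
    have h3 := congrArg Complex.re h1
    simp at h2 h3
    have hbn : b = n := by
      have : Real.sqrt d * ((b:ℝ) - n) = 0 := by linarith
      rcases mul_eq_zero.1 this with h | h
      · exfalso; linarith
      · have : (b:ℝ) = n := by linarith
        exact_mod_cast this
    rw [← hbn] at h3
    have h4 : (b:ℝ)^2 + d = a * (-m) := by linarith
    exact ⟨-m, by exact_mod_cast h4⟩
  · intro x hx
    obtain ⟨m, n, h⟩ := hspan (q.φ x / A) ⟨x, hx, by field_simp⟩
    refine ⟨m, n, ?_⟩
    apply q.hφ
    simp only [map_mul, map_add, map_intCast, map_natCast]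
    rw [← hωe, ← hA]
    rw [div_eq_iff hA0] at h
    rw [h]; ring
  · intro m n
    obtain ⟨x, hx, hxe⟩ := Jadd _ _ (Jint m 1 J1) (Jint n ω hJω)
    refine ⟨x, hx, ?_⟩
    apply q.hφ
    simp only [map_mul, map_add, map_intCast, map_natCast]
    rw [← hωe, ← hA, hxe]; ring

lemma class_inj [IsDomain R] (q : QR R d) {I I' : Ideal R} {α α' : R} {a : ℕ} {b b' : ℤ}
    (ha : 0 < a) (hbb : (a:ℤ) ∣ b' - b)
    (h1 : ∀ x ∈ I, ∃ m n : ℤ, (a:R) * x = α * (m * a + n * (b + q.δ)))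
    (h2 : ∀ m n : ℤ, ∃ x ∈ I', (a:R) * x = α' * (m * a + n * (b' + q.δ))) :
    Ideal.span {α'} * I ≤ Ideal.span {α} * I' := by
  obtain ⟨k, hk⟩ := hbb
  have haR : (a:R) ≠ 0 := by
    intro h
    have := congrArg q.φ h
    rw [map_natCast, map_zero] at this
    exact ha.ne' (by exact_mod_cast this)
  rw [Ideal.span_singleton_mul_le_iff]
  intro x hx
  obtain ⟨m, n, h⟩ := h1 x hx
  obtain ⟨y, hy, hye⟩ := h2 (m - n * k) n
  have hb' : (b':R) = b + a * k := by
    have : b' = b + a * k := by linarith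
    rw [this]; push_cast; ring
  have e : α' * x = α * y := by
    apply mul_left_cancel₀ haR
    calc (a:R) * (α' * x) = α' * (a * x) := by ring
      _ = α * (a * y) := by rw [h, hye, hb']; push_cast; ring
      _ = _ := by ring
  rw [e]
  exact Ideal.mem_span_singleton_mul.2 ⟨y, hy, rfl⟩

theorem card_class_le [IsDedekindDomain R] (q : QR R d) (hd : 0 < d) (A : ℕ) (hA : ∀ a : ℕ, 3 * a^2 ≤ 4 * d → a ≤ A) :
    Nat.card (ClassGroup R) ≤ ∑ a ∈ Finset.Icc 1 A, nsq (-(d:ℤ)) a := by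
  have hsurj := ClassGroup.mk0_surjective (R := R)
  choose Ic hIc using hsurj
  have hred := fun c => q.reduce hd (Ic c : Ideal R) (mem_nonZeroDivisors_iff_ne_zero.1 (Ic c).2)
  choose α hα a b ha ha2 hdvd h1 h2 using hred
  have hmem : ∀ c, a c ∈ Finset.Icc 1 A := fun c => Finset.mem_Icc.2 ⟨ha c, hA _ (ha2 c)⟩
  have hb : ∀ c, ((b c : ℤ) : ZMod (a c))^2 = ((-(d:ℤ) : ℤ) : ZMod (a c)) := by
    intro c
    have := (ZMod.intCast_zmod_eq_zero_iff_dvd (b c^2 + d) (a c)).2 (hdvd c)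
    push_cast at this ⊢
    linear_combination this
  have hne : ∀ i : Finset.Icc 1 A, NeZero (i:ℕ) := fun i => ⟨by have := (Finset.mem_Icc.1 i.2).1; omega⟩
  have hfin : ∀ i : Finset.Icc 1 A, Finite {x : ZMod (i:ℕ) // x^2 = ((-(d:ℤ) : ℤ) : ZMod (i:ℕ))} := fun i => by
    have := hne i
    infer_instance
  let f : ClassGroup R → Σ i : Finset.Icc 1 A, {x : ZMod (i:ℕ) // x^2 = ((-(d:ℤ) : ℤ) : ZMod (i:ℕ))} :=
    fun c => ⟨⟨a c, hmem c⟩, ⟨b c, hb c⟩⟩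
  have hf : Function.Injective f := by
    intro c c' h
    have ha' : a c = a c' := by
      have := congrArg (fun t => (t.1 : ℕ)) h
      simpa [f] using this
    have hb' : (a c : ℤ) ∣ b c' - b c := by
      have key : ∀ (n n' : ℕ) (hn : n ∈ Finset.Icc 1 A) (hn' : n' ∈ Finset.Icc 1 A) (x x' : ℤ) (hx hx'),
          (⟨⟨n, hn⟩, ⟨(x : ZMod n), hx⟩⟩ : Σ i : Finset.Icc 1 A, {x : ZMod (i:ℕ) // x^2 = ((-(d:ℤ) : ℤ) : ZMod (i:ℕ))})
            = ⟨⟨n', hn'⟩, ⟨(x' : ZMod n'), hx'⟩⟩ → (n:ℤ) ∣ x' - x := by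
        intro n n' hn hn' x x' hx hx' hh
        have e : n = n' := by
          have := congrArg (fun t => (t.1 : ℕ)) hh
          simpa using this
        subst e
        simp at hh
        exact (ZMod.intCast_eq_intCast_iff_dvd_sub x x' n).1 hh
      exact key _ _ _ _ _ _ _ _ h
    have hb'' : (a c' : ℤ) ∣ b c - b c' := by
      rw [← ha', ← dvd_neg]; simpa using hb'
    rw [← hIc c, ← hIc c', ClassGroup.mk0_eq_mk0_iff]
    refine ⟨α c', α c, hα _, hα _, le_antisymm ?_ ?_⟩
    · exact q.class_inj (ha c) hb' (h1 c) (by rw [ha']; exact h2 c')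
    · exact q.class_inj (ha c') hb'' (h1 c') (by rw [← ha']; exact h2 c)
  calc Nat.card (ClassGroup R) ≤ Nat.card (Σ i : Finset.Icc 1 A, {x : ZMod (i:ℕ) // x^2 = ((-(d:ℤ) : ℤ) : ZMod (i:ℕ))}) :=
        Nat.card_le_card_of_injective f hf
    _ = ∑ i : Finset.Icc 1 A, nsq (-(d:ℤ)) i := by
        rw [Nat.card_sigma]; rfl
    _ = _ := by rw [Finset.sum_coe_sort (Finset.Icc 1 A) (fun a => nsq (-(d:ℤ)) a)]
end QR

namespace QR
variable {R : Type} [CommRing R] {d : ℕ}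

/-- the ideal (n, δ - t) -/
def I (q : QR R d) (n : ℕ) (t : ℤ) : Ideal R := Ideal.span {(n:R), q.δ - t}

lemma n_mem (q : QR R d) (n : ℕ) (t : ℤ) : (n:R) ∈ q.I n t := Ideal.subset_span (by simp)
lemma d_mem (q : QR R d) (n : ℕ) (t : ℤ) : q.δ - t ∈ q.I n t := Ideal.subset_span (by simp)

lemma I_le {q : QR R d} {n : ℕ} {t : ℤ} {J : Ideal R} (h1 : (n:R) ∈ J) (h2 : q.δ - t ∈ J) : q.I n t ≤ J := by
  rw [I, Ideal.span_le]
  rintro x hx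
  rcases hx with rfl | rfl
  · exact h1
  · exact h2

lemma I_mul (q : QR R d) (n : ℕ) (t : ℤ) (m : ℕ) (s : ℤ) {J : Ideal R} (h1 : (n:R) * m ∈ J) (h2 : (n:R) * (q.δ - s) ∈ J)
    (h3 : (q.δ - t) * m ∈ J) (h4 : (q.δ - t) * (q.δ - s) ∈ J) : q.I n t * q.I m s ≤ J := by
  rw [I, I, Ideal.span_mul_span', Ideal.span_le]
  rintro x ⟨y, hy, z, hz, rfl⟩
  rcases hy with rfl | rfl <;> rcases hz with rfl | rfl <;> assumption

lemma uv_unique (q : QR R d) (hd : 0 < d) {a b a' b' : ℤ} (h : (a:R) + b * q.δ = a' + b' * q.δ) : a = a' ∧ b = b' := by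
  have hr : 0 < Real.sqrt d := Real.sqrt_pos.2 (by exact_mod_cast hd)
  have h1 := congrArg q.φ h
  simp only [map_mul, map_add, map_intCast] at h1
  rw [q.hφδ] at h1
  have h2 := congrArg Complex.re h1
  have h3 := congrArg Complex.im h1
  simp at h2 h3
  refine ⟨h2, ?_⟩
  rcases h3 with h3 | h3
  · exact h3
  · omega

lemma int_mem (q : QR R d) (hd : 0 < d) {n : ℕ} {t : ℤ} (hn : Odd n) (ht : (n:ℤ) ∣ t^2 + d) (z : ℤ) (hz : (z:R) ∈ q.I n t) :
    (n:ℤ) ∣ z := by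
  rw [I, Ideal.mem_span_pair] at hz
  obtain ⟨x, y, h⟩ := hz
  obtain ⟨k, hk⟩ := ht
  have hk' : (t:R)^2 + d = n * k := by exact_mod_cast congrArg (fun z : ℤ => (z:R)) hk
  obtain ⟨u, v, hw⟩ := q.half (x * (q.δ + t) - k * y)
  have h1 : ((2 * z * t : ℤ) : R) + ((2 * z : ℤ):R) * q.δ = ((n * u : ℤ) : R) + ((n * v : ℤ):R) * q.δ := by
    push_cast
    have e : (z:R) * (q.δ + t) = n * (x * (q.δ + t) - k * y) := by
      rw [← h]
      have := q.hδ
      linear_combination y * this - y * hk'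
    linear_combination 2 * e + (n:R) * hw
  have h2 := (q.uv_unique hd h1).2
  have h3 : (n:ℤ) ∣ 2 * z := ⟨v, h2⟩
  have h4 : IsCoprime (n:ℤ) 2 := by
    have := (Nat.coprime_two_right (n := n)).2 hn
    exact_mod_cast Nat.isCoprime_iff_coprime.2 this
  exact h4.dvd_of_dvd_mul_left h3

lemma cop_t {n : ℕ} {t : ℤ} (hn : Nat.Coprime n (2*d)) (ht : (n:ℤ) ∣ t^2 + d) : IsCoprime (n:ℤ) (2 * t) := by
  have h2 : IsCoprime (n:ℤ) 2 := by
    exact_mod_cast Nat.isCoprime_iff_coprime.2 (Nat.Coprime.coprime_mul_right_right hn)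
  have hdd : IsCoprime (n:ℤ) d := by
    exact_mod_cast Nat.isCoprime_iff_coprime.2 (Nat.Coprime.coprime_mul_left_right hn)
  refine h2.mul_right ?_
  obtain ⟨k, hk⟩ := ht
  have : IsCoprime (n:ℤ) (t^2) := by
    rw [show t^2 = -(d:ℤ) + n * k by linarith]
    exact IsCoprime.add_mul_left_right (hdd.neg_right) k
  exact (IsCoprime.pow_right_iff (by norm_num)).1 this

lemma I_mul_neg (q : QR R d) {n : ℕ} {t : ℤ} (hn : Nat.Coprime n (2*d)) (ht : (n:ℤ) ∣ t^2 + d) :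
    q.I n t * q.I n (-t) = Ideal.span {(n:R)} := by
  apply le_antisymm
  · apply q.I_mul
    · exact Ideal.mem_span_singleton.2 ⟨n, rfl⟩
    · exact Ideal.mem_span_singleton.2 ⟨_, rfl⟩
    · exact Ideal.mem_span_singleton.2 ⟨_, mul_comm _ _⟩
    · obtain ⟨k, hk⟩ := ht
      have hk' : (t:R)^2 + d = n * k := by exact_mod_cast congrArg (fun z : ℤ => (z:R)) hk
      refine Ideal.mem_span_singleton.2 ⟨-k, ?_⟩
      push_cast
      linear_combination q.hδ - hk'
  · rw [Ideal.span_singleton_le_iff_mem]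
    obtain ⟨a, b, hab⟩ := cop_t hn ht
    have hab' : (a:R) * n + b * (2 * t) = 1 := by exact_mod_cast congrArg (fun z : ℤ => (z:R)) hab
    have e : (n:R) = a * ((n:R) * n) + b * ((n:R) * (q.δ - (-t:ℤ)) - (q.δ - t) * n) := by
      push_cast
      linear_combination (-(n:R)) * hab'
    rw [e]
    apply Ideal.add_mem
    · exact Ideal.mul_mem_left _ _ (Ideal.mul_mem_mul (q.n_mem _ _) (q.n_mem _ _))
    · exact Ideal.mul_mem_left _ _ (Ideal.sub_mem _ (Ideal.mul_mem_mul (q.n_mem _ _) (q.d_mem _ _))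
        (Ideal.mul_mem_mul (q.d_mem _ _) (q.n_mem _ _)))

lemma I_split (q : QR R d) {g m : ℕ} (s : ℤ) (hgm : Nat.Coprime g m) : q.I (g * m) s = q.I g s * q.I m s := by
  apply le_antisymm
  · apply I_le
    · push_cast; exact Ideal.mul_mem_mul (q.n_mem _ _) (q.n_mem _ _)
    · obtain ⟨a, b, hab⟩ := Nat.isCoprime_iff_coprime.2 hgm
      have hab' : (a:R) * g + b * m = 1 := by exact_mod_cast congrArg (fun z : ℤ => (z:R)) hab
      have e : q.δ - s = a * ((g:R) * (q.δ - s)) + b * ((q.δ - s) * m) := by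
        linear_combination (-(q.δ - s)) * hab'
      rw [e]
      apply Ideal.add_mem
      · exact Ideal.mul_mem_left _ _ (Ideal.mul_mem_mul (q.n_mem _ _) (q.d_mem _ _))
      · exact Ideal.mul_mem_left _ _ (Ideal.mul_mem_mul (q.d_mem _ _) (q.n_mem _ _))
  · apply q.I_mul
    · have := q.n_mem (g*m) s; push_cast at this; exact this
    · exact Ideal.mul_mem_left _ _ (q.d_mem _ _)
    · exact Ideal.mul_mem_right _ _ (q.d_mem _ _)
    · exact Ideal.mul_mem_left _ _ (q.d_mem _ _)

lemma I_congr (q : QR R d) {n : ℕ} {t t' : ℤ} (h : (n:ℤ) ∣ t - t') : q.I n t = q.I n t' := by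
  have key : ∀ t t' : ℤ, (n:ℤ) ∣ t - t' → q.I n t ≤ q.I n t' := by
    rintro t t' ⟨k, hk⟩
    apply I_le (q.n_mem _ _)
    have : q.δ - t = (q.δ - t') + -k * n := by
      have : (t:R) - t' = n * k := by exact_mod_cast congrArg (fun z : ℤ => (z:R)) hk
      linear_combination -this
    rw [this]
    exact Ideal.add_mem _ (q.d_mem _ _) (Ideal.mul_mem_left _ _ (q.n_mem _ _))
  exact le_antisymm (key _ _ h) (key _ _ (by rw [← dvd_neg]; simpa using h))

lemma I_coprime (q : QR R d) {m p : ℕ} {s t : ℤ} (hp : p.Prime) (h : ¬ (p ∣ m ∧ (p:ℤ) ∣ s - t)) :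
    IsCoprime (q.I m s) (q.I p t) := by
  rw [Ideal.isCoprime_iff_sup_eq, Ideal.eq_top_iff_one]
  have hm : (m:R) ∈ q.I m s ⊔ q.I p t := Ideal.mem_sup_left (q.n_mem _ _)
  have hpm : (p:R) ∈ q.I m s ⊔ q.I p t := Ideal.mem_sup_right (q.n_mem _ _)
  have hst : ((s - t : ℤ):R) ∈ q.I m s ⊔ q.I p t := by
    have : ((s - t : ℤ):R) = (q.δ - t) - (q.δ - s) := by push_cast; ring
    rw [this]
    exact Ideal.sub_mem _ (Ideal.mem_sup_right (q.d_mem _ _)) (Ideal.mem_sup_left (q.d_mem _ _))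
  have key : ∀ z : ℤ, ¬ (p:ℤ) ∣ z → (z:R) ∈ q.I m s ⊔ q.I p t → (1:R) ∈ q.I m s ⊔ q.I p t := by
    intro z hz hmem
    obtain ⟨a, b, hab⟩ := (Nat.prime_iff_prime_int.1 hp).irreducible.coprime_iff_not_dvd.2 hz
    have hab' : (a:R) * p + b * z = 1 := by exact_mod_cast congrArg (fun z : ℤ => (z:R)) hab
    rw [← hab']
    exact Ideal.add_mem _ (Ideal.mul_mem_left _ _ hpm) (Ideal.mul_mem_left _ _ hmem)
  by_cases hd : p ∣ m
  · exact key _ (fun hh => h ⟨hd, hh⟩) hst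
  · exact key m (fun hh => hd (Int.natCast_dvd_natCast.1 hh)) (by exact_mod_cast hm)

lemma dvd_uv (q : QR R d) (hd : 0 < d) {m : ℕ} {s : ℤ} (hm : Odd m) (hs : (m:ℤ) ∣ s^2 + d) {α : R} {u v : ℤ}
    (h2 : 2 * α = (u:R) + v * q.δ) (hα : α ∈ q.I m s) : (m:ℤ) ∣ u + v * s := by
  apply q.int_mem hd hm hs
  have : ((u + v * s : ℤ) : R) = 2 * α - v * (q.δ - s) := by rw [h2]; push_cast; ring
  rw [this]
  exact Ideal.sub_mem _ (Ideal.mul_mem_left _ _ hα) (Ideal.mul_mem_left _ _ (q.d_mem _ _))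

lemma v_cop (q : QR R d) (hd : 0 < d) {m n ℓ : ℕ} {s t : ℤ} (hℓ : ℓ ≠ 0) (hm : Nat.Coprime m (2*d))
    (hs : (m:ℤ) ∣ s^2 + d)
    (hno : ∀ p : ℕ, p.Prime → p ∣ m → p ∣ n → ¬ (p:ℤ) ∣ s + t) {α : R} {u v : ℤ}
    (h2 : 2 * α = (u:R) + v * q.δ) (hα : Ideal.span {α} = (q.I m s * q.I n t)^ℓ) (p : ℕ) (hp : p.Prime) (hpm : p ∣ m) :
    ¬ (p:ℤ) ∣ v := by
  intro hpv
  have hmo : Odd m := Nat.coprime_two_right.1 (Nat.Coprime.coprime_mul_right_right hm)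
  have hpo : Odd p := Odd.of_dvd_nat hmo hpm
  have hpc : Nat.Coprime p (2*d) := Nat.Coprime.coprime_dvd_left hpm hm
  have hps : (p:ℤ) ∣ s^2 + d := (Int.natCast_dvd_natCast.2 hpm).trans hs
  have hαm : α ∈ q.I m s := by
    have : α ∈ (q.I m s * q.I n t)^ℓ := by rw [← hα]; exact Ideal.mem_span_singleton_self α
    have h0 : α ∈ q.I m s * q.I n t := Ideal.pow_le_self hℓ this
    have h1 : q.I m s * q.I n t ≤ q.I m s := Ideal.mul_le_left
    exact h1 h0
  have hpu : (p:ℤ) ∣ u := by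
    have h3 := (Int.natCast_dvd_natCast.2 hpm).trans (q.dvd_uv hd hmo hs h2 hαm)
    exact (dvd_add_left (hpv.mul_right s)).1 h3
  obtain ⟨u', hu'⟩ := hpu
  obtain ⟨v', hv'⟩ := hpv
  obtain ⟨k, hk⟩ := id hpo
  have hαp : α = p * (α - k * (u' + v' * q.δ)) := by
    have e : 2 * α = p * (u' + v' * q.δ) := by rw [h2, hu', hv']; push_cast; ring
    have ek : (p:R) = 2 * k + 1 := by rw [hk]; push_cast; ring
    have : α = p * α - k * (2 * α) := by rw [ek]; ring
    nth_rewrite 1 [this]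
    rw [e]; ring
  have hle : Ideal.span {α} ≤ q.I p (-s) := by
    rw [Ideal.span_singleton_le_iff_mem, hαp]
    exact Ideal.mul_mem_right _ _ (q.n_mem _ _)
  have hc1 : IsCoprime (q.I m s) (q.I p (-s)) := by
    apply q.I_coprime hp
    rintro ⟨_, h⟩
    have h5 := cop_t hpc hps
    have h6 : (p:ℤ) ∣ 2 * s := by rwa [sub_neg_eq_add, ← two_mul] at h
    have := h5.isUnit_of_dvd' dvd_rfl h6
    rw [Int.isUnit_iff] at this
    have := hp.one_lt; omega
  have hc2 : IsCoprime (q.I n t) (q.I p (-s)) := by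
    apply q.I_coprime hp
    rintro ⟨h1, h⟩
    rw [sub_neg_eq_add, add_comm] at h
    exact hno p hp hpm h1 h
  have hc : IsCoprime ((q.I m s * q.I n t)^ℓ) (q.I p (-s)) := (hc1.mul_left hc2).pow_left
  rw [← hα, Ideal.isCoprime_iff_sup_eq, sup_eq_right.2 hle, Ideal.eq_top_iff_one] at hc
  have := q.int_mem hd hpo (t := -s) (by simpa using hps) 1 (by simpa using hc)
  have h1 := Int.natCast_dvd_natCast.1 (by simpa using this : (p:ℤ) ∣ (1:ℕ))
  exact hp.one_lt.ne' (Nat.dvd_one.1 h1)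

lemma map_σ (q : QR R d) (n : ℕ) (t : ℤ) : (q.I n t).map q.σ = q.I n (-t) := by
  rw [I, Ideal.map_span, Set.image_pair, map_natCast, map_sub, q.hσ, map_intCast]
  apply le_antisymm
  · rw [Ideal.span_le]
    rintro x hx
    rcases hx with rfl | rfl
    · exact q.n_mem _ _
    · have : -q.δ - (t:R) = -(q.δ - ((-t:ℤ):R)) := by push_cast; ring
      rw [this]; exact (Ideal.neg_mem_iff _).2 (q.d_mem _ _)
  · apply I_le
    · exact Ideal.subset_span (by simp)
    · have : (q.δ - ((-t:ℤ):R)) = -(-q.δ - (t:R)) := by push_cast; ring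
      rw [this]; exact (Ideal.neg_mem_iff _).2 (Ideal.subset_span (by simp))

lemma norm_eq [IsDomain R] (q : QR R d) {m n ℓ : ℕ} {s t : ℤ} (hm : Nat.Coprime m (2*d)) (hn : Nat.Coprime n (2*d))
    (hs : (m:ℤ) ∣ s^2 + d) (ht : (n:ℤ) ∣ t^2 + d) {α : R} {u v : ℤ}
    (h2 : 2 * α = (u:R) + v * q.δ) (hα : Ideal.span {α} = (q.I m s * q.I n t)^ℓ) :
    u^2 + d * v^2 = 4 * ((m:ℤ) * n)^ℓ := by
  have h3 : Ideal.span {q.σ α} = (q.I m (-s) * q.I n (-t))^ℓ := by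
    have := congrArg (Ideal.map q.σ) hα
    rwa [Ideal.map_span, Set.image_singleton, Ideal.map_pow, Ideal.map_mul, map_σ, map_σ] at this
  have h4 : Ideal.span {α * q.σ α} = Ideal.span {((m:R) * n)^ℓ} := by
    rw [← Ideal.span_singleton_mul_span_singleton, hα, h3, ← mul_pow, ← Ideal.span_singleton_pow,
      ← Ideal.span_singleton_mul_span_singleton, ← q.I_mul_neg hm hs, ← q.I_mul_neg hn ht]
    congr 1; ring
  have h5 : 2 * q.σ α = (u:R) - v * q.δ := by
    have := congrArg q.σ h2
    rw [map_mul, map_add, map_mul, map_intCast, map_intCast, map_ofNat, q.hσ] at this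
    rw [this]; ring
  have h6 : ((u^2 + d * v^2 : ℤ) : R) = 4 * (α * q.σ α) := by
    push_cast
    have : (4:R) * (α * q.σ α) = (2 * α) * (2 * q.σ α) := by ring
    rw [this, h2, h5]
    linear_combination (v:R)^2 * q.hδ
  rw [Ideal.span_singleton_eq_span_singleton] at h4
  have h7 : ((u^2 + d * v^2 : ℤ) : R) ∣ ((4 * ((m:ℤ) * n)^ℓ : ℤ) : R) := by
    rw [h6]; push_cast; exact mul_dvd_mul_left _ h4.dvd
  have h8 : ((4 * ((m:ℤ) * n)^ℓ : ℤ) : R) ∣ ((u^2 + d * v^2 : ℤ) : R) := by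
    rw [h6]; push_cast; exact mul_dvd_mul_left _ h4.symm.dvd
  exact Int.dvd_antisymm (by positivity) (by positivity) (q.dvd _ _ h7) (q.dvd _ _ h8)
end QR

lemma tor_pairs {G ι : Type} [CommGroup G] [Finite G] (ℓ : ℕ) (s : Finset ι) (f : ι → G) :
    Nat.card {c : G // c^ℓ = 1} * s.card^2 ≤
      Nat.card G * ((s ×ˢ s).filter (fun x => f x.1 ^ ℓ = f x.2 ^ ℓ)).card := by
  have hfin : Fintype G := Fintype.ofFinite G
  set φ : G →* G := powMonoidHom ℓ with hφ
  have h1 : Nat.card {c : G // c^ℓ = 1} = Nat.card φ.ker := Nat.card_congr (Equiv.subtypeEquivRight (by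
    intro x; rw [MonoidHom.mem_ker]; rfl))
  have h2 : Nat.card φ.ker * Nat.card φ.range = Nat.card G := by
    have := Subgroup.card_mul_index φ.ker
    rwa [Subgroup.index_ker] at this
  have h3 : Nat.card φ.range = (Finset.univ.image φ).card := by
    rw [Nat.subtype_card (Finset.univ.image φ)]
    intro x; simp [MonoidHom.mem_range]
  set B := Finset.univ.image φ with hB
  have h4 : s.card = ∑ b ∈ B, (s.filter (fun x => φ (f x) = b)).card :=
    Finset.card_eq_sum_card_fiberwise (fun x _ => by simp [hB])
  have h5 : ((s ×ˢ s).filter (fun x => f x.1 ^ ℓ = f x.2 ^ ℓ)).card =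
      ∑ b ∈ B, (s.filter (fun x => φ (f x) = b)).card^2 := by
    rw [Finset.card_eq_sum_card_fiberwise (f := fun x => φ (f x.1)) (t := B) (fun x _ => by simp [hB])]
    apply Finset.sum_congr rfl
    intro b _
    rw [sq, ← Finset.card_product]
    congr 1
    ext ⟨x, y⟩
    simp only [Finset.mem_filter, Finset.mem_product, hφ, powMonoidHom_apply]
    constructor
    · rintro ⟨⟨⟨hx, hy⟩, he⟩, hb⟩
      exact ⟨⟨hx, hb⟩, hy, by rw [← he]; exact hb⟩
    · rintro ⟨⟨hx, hb⟩, hy, hb'⟩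
      exact ⟨⟨⟨hx, hy⟩, by rw [hb, hb']⟩, hb⟩
  have h6 : s.card^2 ≤ B.card * ∑ b ∈ B, (s.filter (fun x => φ (f x) = b)).card^2 := by
    rw [h4]
    exact sq_sum_le_card_mul_sum_sq
  rw [h5, h1, ← h2, h3, mul_assoc]
  exact Nat.mul_le_mul_left _ h6

/-- square roots of -d mod n -/
def Rt (d n : ℕ) : Finset ℕ := (Finset.range n).filter (fun t => n ∣ t^2 + d)

lemma Rt_card (d n : ℕ) (hn : 1 ≤ n) : (Rt d n).card = nsq (-(d:ℤ)) n := by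
  have : NeZero n := ⟨by omega⟩
  rw [nsq, Nat.card_eq_fintype_card, Fintype.card_subtype]
  apply Finset.card_bij (fun (t:ℕ) _ => (t : ZMod n))
  · intro t ht
    simp only [Rt, Finset.mem_filter, Finset.mem_range] at ht
    simp only [Finset.mem_filter, Finset.mem_univ, true_and]
    have := (ZMod.natCast_eq_zero_iff _ _).2 ht.2
    push_cast at this ⊢
    linear_combination this
  · intro a ha b hb hab
    simp only [Rt, Finset.mem_filter, Finset.mem_range] at ha hb
    have := (ZMod.natCast_eq_natCast_iff' _ _ _).1 hab
    rwa [Nat.mod_eq_of_lt ha.1, Nat.mod_eq_of_lt hb.1] at this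
  · intro b hb
    simp only [Finset.mem_filter, Finset.mem_univ, true_and] at hb
    refine ⟨b.val, ?_, by simp⟩
    simp only [Rt, Finset.mem_filter, Finset.mem_range]
    refine ⟨ZMod.val_lt b, ?_⟩
    rw [← ZMod.natCast_eq_zero_iff]
    push_cast at hb ⊢
    rw [ZMod.natCast_zmod_val, hb]; ring

def gd (d n : ℕ) : Prop := Squarefree n ∧ Nat.Coprime n (2*d)

noncomputable def Ng (d P : ℕ) : Finset ℕ := (Finset.Icc 1 P).filter (gd d)

noncomputable def Mg (d P : ℕ) : ℕ := ∑ n ∈ Ng d P, nsq (-(d:ℤ)) n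

/-- the counted quadruples -/
noncomputable def Cset (d ℓ Q : ℕ) : Finset (ℕ × ℕ × ℤ × ℕ) :=
  ((Finset.Icc 1 Q) ×ˢ (Finset.Icc 1 Q) ×ˢ (Finset.Icc (-(4 * (Q:ℤ)^(2*ℓ))) (4 * (Q:ℤ)^(2*ℓ))) ×ˢ
    (Finset.Icc 1 (4 * Q^(2*ℓ)))).filter
    (fun x => Odd x.1 ∧ Odd x.2.1 ∧ Nat.Coprime x.2.2.2 (x.1 * x.2.1) ∧
      x.2.2.1^2 + d * (x.2.2.2:ℤ)^2 = 4 * ((x.1:ℤ) * x.2.1)^ℓ)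

noncomputable def Sg (d ℓ P : ℕ) : ℕ := ∑ g ∈ Ng d P, nsq (-(d:ℤ)) g * (Cset d ℓ (P/g)).card

noncomputable section
variable {R : Type} [CommRing R] [IsDedekindDomain R] {d : ℕ}

def cls (J : Ideal R) : ClassGroup R :=
  if h : J ≠ ⊥ then ClassGroup.mk0 ⟨J, mem_nonZeroDivisors_of_ne_zero h⟩ else 1

lemma cls_mul {J K : Ideal R} (hJ : J ≠ ⊥) (hK : K ≠ ⊥) : cls (J * K) = cls J * cls K := by
  have hJK : J * K ≠ ⊥ := mul_ne_zero hJ hK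
  rw [cls, cls, cls, dif_pos hJ, dif_pos hK, dif_pos hJK, ← map_mul]
  rfl

lemma cls_pow {J : Ideal R} (hJ : J ≠ ⊥) (n : ℕ) : cls (J ^ n) = cls J ^ n := by
  have h2 : J ^ n ≠ ⊥ := pow_ne_zero n hJ
  rw [cls, cls, dif_pos hJ, dif_pos h2, ← map_pow]
  rfl

lemma cls_one {J : Ideal R} (hJ : J ≠ ⊥) : cls J = 1 ↔ ∃ α : R, Ideal.span {α} = J := by
  rw [cls, dif_pos hJ, ClassGroup.mk0_eq_one_iff]
  constructor
  · rintro ⟨a, ha⟩; exact ⟨a, ha.symm⟩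
  · rintro ⟨a, ha⟩; exact ⟨a, ha.symm⟩

namespace QR
lemma nat_ne (q : QR R d) {n : ℕ} (hn : 1 ≤ n) : (n:R) ≠ 0 := by
  intro h
  have := congrArg q.φ h
  simp at this; omega

lemma I_ne (q : QR R d) {n : ℕ} (hn : 1 ≤ n) (t : ℤ) : q.I n t ≠ ⊥ := by
  intro h
  have := q.n_mem n t
  rw [h] at this
  exact q.nat_ne hn (by simpa using this)

lemma exists_alpha (q : QR R d) {g m n ℓ : ℕ} {s t : ℤ} (hg : 1 ≤ g) (hm : 1 ≤ m) (hn : 1 ≤ n)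
    (hgm : Nat.Coprime g m) (hgn : Nat.Coprime g n) (hst : (g:ℤ) ∣ s - t)
    (hnc : Nat.Coprime n (2*d)) (ht : (n:ℤ) ∣ t^2 + d)
    (h : cls (q.I (g*m) s) ^ ℓ = cls (q.I (g*n) t) ^ ℓ) :
    ∃ α : R, Ideal.span {α} = (q.I m s * q.I n (-t))^ℓ := by
  rw [q.I_split _ hgm, q.I_split _ hgn, cls_mul (q.I_ne hg _) (q.I_ne hm _), cls_mul (q.I_ne hg _) (q.I_ne hn _),
    ← q.I_congr hst, mul_pow, mul_pow] at h
  have h1 := mul_left_cancel h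
  have hne : q.I m s * q.I n (-t) ≠ ⊥ := mul_ne_zero (q.I_ne hm _) (q.I_ne hn _)
  rw [← cls_one (pow_ne_zero _ hne), cls_pow hne, cls_mul (q.I_ne hm _) (q.I_ne hn _), mul_pow, h1, ← mul_pow,
    ← cls_mul (q.I_ne hn _) (q.I_ne hn _), q.I_mul_neg hnc ht]
  have hb : Ideal.span {(n:R)} ≠ ⊥ := by
    rw [Ne, Ideal.span_singleton_eq_bot]; exact q.nat_ne hn
  rw [(cls_one hb).2 ⟨n, rfl⟩, one_pow]

lemma exists_uv (q : QR R d) (hd : 0 < d) {m n ℓ : ℕ} {s t : ℤ} (hℓ : ℓ ≠ 0)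
    (hmc : Nat.Coprime m (2*d)) (hnc : Nat.Coprime n (2*d)) (hs : (m:ℤ) ∣ s^2 + d) (ht : (n:ℤ) ∣ t^2 + d)
    (hno : ∀ p : ℕ, p.Prime → p ∣ m → p ∣ n → ¬ (p:ℤ) ∣ s - t) (hne : ¬ (m = 1 ∧ n = 1))
    {α : R} (hα : Ideal.span {α} = (q.I m s * q.I n (-t))^ℓ) :
    ∃ u : ℤ, ∃ v : ℕ, 1 ≤ v ∧ Nat.Coprime v (m*n) ∧ u^2 + d * (v:ℤ)^2 = 4 * ((m:ℤ) * n)^ℓ ∧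
      (m:ℤ) ∣ u + v * s ∧ (n:ℤ) ∣ u - v * t := by
  have main : ∀ (α : R) (u v : ℤ), Ideal.span {α} = (q.I m s * q.I n (-t))^ℓ → 2 * α = (u:R) + v * q.δ →
    (∀ p : ℕ, p.Prime → p ∣ m * n → ¬ (p:ℤ) ∣ v) ∧ u^2 + d * (v:ℤ)^2 = 4 * ((m:ℤ) * n)^ℓ ∧
      (m:ℤ) ∣ u + v * s ∧ (n:ℤ) ∣ u - v * t := by
    intro α u v hα h2
    have hmo : Odd m := Nat.coprime_two_right.1 (Nat.Coprime.coprime_mul_right_right hmc)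
    have hnoo : Odd n := Nat.coprime_two_right.1 (Nat.Coprime.coprime_mul_right_right hnc)
    have ht' : (n:ℤ) ∣ (-t)^2 + d := by simpa using ht
    have hmem : α ∈ q.I m s * q.I n (-t) := by
      have : α ∈ (q.I m s * q.I n (-t))^ℓ := by rw [← hα]; exact Ideal.mem_span_singleton_self α
      exact Ideal.pow_le_self hℓ this
    have hm1 : q.I m s * q.I n (-t) ≤ q.I m s := Ideal.mul_le_left
    have hm2 : q.I m s * q.I n (-t) ≤ q.I n (-t) := Ideal.mul_le_right
    refine ⟨?_, q.norm_eq hmc hnc hs ht' h2 hα, q.dvd_uv hd hmo hs h2 (hm1 hmem), ?_⟩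
    · intro p hp hpd
      rcases (Nat.Prime.dvd_mul hp).1 hpd with h | h
      · exact q.v_cop hd hℓ hmc hs (fun p hp h1 h2 h3 => hno p hp h1 h2 (by simpa [sub_eq_add_neg] using h3)) h2 hα p hp h
      · rw [mul_comm (q.I m s)] at hα
        exact q.v_cop hd hℓ hnc ht' (fun p hp h1 h2 h3 => hno p hp h2 h1 (by
          rw [sub_eq_add_neg, add_comm]; exact h3)) h2 hα p hp h
    · have := q.dvd_uv hd hnoo ht' h2 (hm2 hmem)
      rwa [mul_neg, ← sub_eq_add_neg] at this
  have fin : ∀ (α : R) (u v : ℤ), Ideal.span {α} = (q.I m s * q.I n (-t))^ℓ → 2 * α = (u:R) + v * q.δ → 0 ≤ v →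
     ∃ u : ℤ, ∃ v : ℕ, 1 ≤ v ∧ Nat.Coprime v (m*n) ∧ u^2 + d * (v:ℤ)^2 = 4 * ((m:ℤ) * n)^ℓ ∧
      (m:ℤ) ∣ u + v * s ∧ (n:ℤ) ∣ u - v * t := by
    intro α u v hα h2 hv
    lift v to ℕ using hv
    obtain ⟨a1, a2, a3, a4⟩ := main α u v hα h2
    refine ⟨u, v, ?_, ?_, a2, a3, a4⟩
    · by_contra hv
      have hv0 : v = 0 := by omega
      subst hv0
      have : m * n ≠ 1 := by
        intro h; exact hne (mul_eq_one.1 h)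
      obtain ⟨p, hp, hpd⟩ := Nat.exists_prime_and_dvd this
      exact a1 p hp hpd (by simp)
    · apply Nat.Coprime.symm
      apply Nat.coprime_of_dvd
      intro p hp h1 h2
      exact a1 p hp h1 (by exact_mod_cast h2)
  obtain ⟨u, v, h2⟩ := q.half α
  rcases le_or_gt 0 v with hv | hv
  · exact fin α u v hα h2 hv
  · refine fin (-α) (-u) (-v) ?_ ?_ (by omega)
    · rw [Ideal.span_singleton_neg]; exact hα
    · push_cast; linear_combination -h2


set_option maxHeartbeats 1600000 in
lemma pairs_le (q : QR R d) (hd : 0 < d) {ℓ : ℕ} (hℓ : ℓ ≠ 0) (P : ℕ) (𝒢 : Finset ((_ : ℕ) × ℕ))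
    (h𝒢 : 𝒢 = (Ng d P).sigma (Rt d)) :
    ((𝒢 ×ˢ 𝒢).filter (fun x => cls (q.I x.1.1 x.1.2) ^ ℓ = cls (q.I x.2.1 x.2.2) ^ ℓ)).card ≤ Mg d P + Sg d ℓ P := by
  have hcard : 𝒢.card = Mg d P := by
    rw [h𝒢, Finset.card_sigma, Mg]
    apply Finset.sum_congr rfl
    intro n hn
    exact Rt_card d n (Finset.mem_Icc.1 (Finset.mem_filter.1 hn).1).1
  set F := (𝒢 ×ˢ 𝒢).filter (fun x => cls (q.I x.1.1 x.1.2) ^ ℓ = cls (q.I x.2.1 x.2.2) ^ ℓ) with hF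
  rw [← Finset.card_filter_add_card_filter_not (s := F) (fun x => x.1 = x.2)]
  apply add_le_add
  · rw [← hcard]
    apply Finset.card_le_card_of_injOn (fun x => x.1)
    · intro x hx
      have := (Finset.mem_product.1 (Finset.mem_filter.1 (Finset.mem_filter.1 hx).1).1).1
      exact this
    · intro x hx y hy hxy
      have h1 := (Finset.mem_filter.1 hx).2
      have h2 := (Finset.mem_filter.1 hy).2
      exact Prod.ext hxy (by rw [← h1, ← h2]; exact hxy)
  · set Tt : Finset ((_ : ℕ) × (ℕ × (ℕ × ℕ × ℤ × ℕ))) := (Ng d P).sigma (fun g => (Rt d g) ×ˢ (Cset d ℓ (P/g))) with hTt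
    have hTc : Tt.card = Sg d ℓ P := by
      rw [hTt, Finset.card_sigma, Sg]
      apply Finset.sum_congr rfl
      intro n hn
      rw [Finset.card_product, Rt_card d n (Finset.mem_Icc.1 (Finset.mem_filter.1 hn).1).1]
    rw [← hTc]
    apply Finset.card_le_card_of_forall_subsingleton (fun x y =>
      x.1.1 = y.1 * y.2.2.1 ∧ x.2.1 = y.1 * y.2.2.2.1 ∧ Nat.Coprime y.1 y.2.2.1 ∧ Nat.Coprime y.1 y.2.2.2.1 ∧
      (y.1:ℤ) ∣ (x.1.2:ℤ) - y.2.1 ∧ (y.1:ℤ) ∣ (x.2.2:ℤ) - y.2.1 ∧ (y.2.2.1:ℤ) ∣ y.2.2.2.2.1 + y.2.2.2.2.2 * x.1.2 ∧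
        (y.2.2.2.1:ℤ) ∣ y.2.2.2.2.1 - y.2.2.2.2.2 * x.2.2)
    · rintro ⟨⟨m, s⟩, ⟨n, t⟩⟩ hx
      rw [Finset.mem_filter, hF, Finset.mem_filter, Finset.mem_product, h𝒢] at hx
      obtain ⟨⟨⟨hx1, hx2⟩, hcl⟩, hne⟩ := hx
      simp only [Finset.mem_sigma, Rt, Ng, Finset.mem_filter, Finset.mem_Icc, Finset.mem_range, gd] at hx1 hx2
      obtain ⟨⟨⟨hm1, hmP⟩, hmsq, hmc⟩, hsm, hsd⟩ := hx1
      obtain ⟨⟨⟨hn1, hnP⟩, hnsq, hnc⟩, htn, htd⟩ := hx2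
      simp only at hcl hne
      set g := Nat.gcd (Nat.gcd m n) ((s:ℤ) - t).natAbs with hg
      have hgm : g ∣ m := (Nat.gcd_dvd_left _ _).trans (Nat.gcd_dvd_left _ _)
      have hgn : g ∣ n := (Nat.gcd_dvd_left _ _).trans (Nat.gcd_dvd_right _ _)
      have hgst : (g:ℤ) ∣ (s:ℤ) - t := Int.natCast_dvd.2 (Nat.gcd_dvd_right _ _)
      have hg1 : 1 ≤ g := Nat.pos_of_dvd_of_pos hgm hm1
      clear_value g
      obtain ⟨m', rfl⟩ := hgm
      obtain ⟨n', rfl⟩ := hgn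
      have hcm := Nat.coprime_of_squarefree_mul hmsq
      have hcn := Nat.coprime_of_squarefree_mul hnsq
      have hm'1 : 1 ≤ m' := Nat.pos_of_ne_zero (by rintro rfl; simp at hm1)
      have hn'1 : 1 ≤ n' := Nat.pos_of_ne_zero (by rintro rfl; simp at hn1)
      have hm'c : Nat.Coprime m' (2*d) := Nat.Coprime.coprime_dvd_left (dvd_mul_left _ _) hmc
      have hn'c : Nat.Coprime n' (2*d) := Nat.Coprime.coprime_dvd_left (dvd_mul_left _ _) hnc
      have hs' : (m':ℤ) ∣ (s:ℤ)^2 + d := by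
        have := (dvd_mul_left m' g).trans hsd
        exact_mod_cast this
      have ht' : (n':ℤ) ∣ (t:ℤ)^2 + d := by
        have := (dvd_mul_left n' g).trans htd
        exact_mod_cast this
      have hno : ∀ p : ℕ, p.Prime → p ∣ m' → p ∣ n' → ¬ (p:ℤ) ∣ (s:ℤ) - t := by
        intro p hp h1 h2 h3
        have hpg : Nat.Coprime g p := Nat.Coprime.coprime_dvd_right h1 hcm
        have e3 : g * p ∣ ((s:ℤ) - t).natAbs :=
          hpg.mul_dvd_of_dvd_of_dvd (Int.natCast_dvd.1 hgst) (Int.natCast_dvd.1 h3)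
        have e : g * p ∣ g := by
          conv_rhs => rw [hg]
          exact Nat.dvd_gcd (Nat.dvd_gcd (mul_dvd_mul_left _ h1) (mul_dvd_mul_left _ h2)) e3
        have := Nat.le_of_dvd hg1 e
        have := hp.two_le
        nlinarith
      have hne' : ¬ (m' = 1 ∧ n' = 1) := by
        rintro ⟨rfl, rfl⟩
        rw [mul_one] at *
        apply hne
        have : s = t := by
          have := (Int.emod_emod_of_dvd s (dvd_refl (g:ℤ)))
          have h4 := Int.emod_emod_of_dvd
          have h5 : (s:ℤ) % g = t % g := Int.emod_eq_emod_iff_emod_sub_eq_zero.2 (Int.emod_eq_zero_of_dvd hgst)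
          rw [Int.emod_eq_of_lt (by positivity) (by exact_mod_cast hsm), Int.emod_eq_of_lt (by positivity) (by exact_mod_cast htn)] at h5
          exact_mod_cast h5
        rw [this]
      obtain ⟨α, hα⟩ := q.exists_alpha hg1 hm'1 hn'1 hcm hcn hgst hn'c ht' hcl
      obtain ⟨u, v, hv1, hvc, hnorm, hd1, hd2⟩ := q.exists_uv hd hℓ hm'c hn'c hs' ht' hno hne' hα
      refine ⟨⟨g, s % g, m', n', u, v⟩, ?_, rfl, rfl, hcm, hcn, ?_, ?_, hd1, hd2⟩
      · have hgP : g ≤ P := (Nat.le_mul_of_pos_right g hm'1).trans hmP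
        have hgsd : g ∣ s^2 + d := (dvd_mul_right g m').trans hsd
        have hm'Q : m' ≤ P / g := (Nat.le_div_iff_mul_le hg1).2 (by rw [mul_comm]; exact hmP)
        have hn'Q : n' ≤ P / g := (Nat.le_div_iff_mul_le hg1).2 (by rw [mul_comm]; exact hnP)
        set Q := P / g with hQ
        have hb : (u^2 + d * (v:ℤ)^2) ≤ 4 * (Q:ℤ)^(2*ℓ) := by
          rw [hnorm, pow_mul, sq]
          have a1 : (m':ℤ) ≤ Q := by exact_mod_cast hm'Q
          have a2 : (n':ℤ) ≤ Q := by exact_mod_cast hn'Q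
          gcongr
        have hd1' : (1:ℤ) ≤ d := by exact_mod_cast hd
        have hu2 : u^2 ≤ 4 * (Q:ℤ)^(2*ℓ) := by nlinarith [sq_nonneg (v:ℤ)]
        have hv2 : (v:ℤ)^2 ≤ 4 * (Q:ℤ)^(2*ℓ) := by nlinarith [sq_nonneg (v:ℤ), sq_nonneg u]
        have hua : |u| ≤ 4 * (Q:ℤ)^(2*ℓ) := by
          have := Int.natAbs_le_self_sq u
          rw [Int.abs_eq_natAbs]; omega
        have hva : (v:ℤ) ≤ 4 * (Q:ℤ)^(2*ℓ) := by
          have : (1:ℤ) ≤ v := by exact_mod_cast hv1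
          nlinarith
        simp only [hTt, Finset.mem_sigma, Finset.mem_product, Rt, Ng, Finset.mem_filter, Finset.mem_Icc, Finset.mem_range, gd, Cset]
        refine ⟨⟨⟨hg1, hgP⟩, hmsq.squarefree_of_dvd (dvd_mul_right _ _), Nat.Coprime.coprime_dvd_left (dvd_mul_right _ _) hmc⟩,
          ⟨Nat.mod_lt _ hg1, ?_⟩, ⟨⟨hm'1, hm'Q⟩, ⟨hn'1, hn'Q⟩, abs_le.1 hua, hv1, by exact_mod_cast hva⟩, ?_, ?_, hvc, hnorm⟩
        · rw [Nat.dvd_iff_mod_eq_zero] at hgsd ⊢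
          rw [← hgsd]
          simp [Nat.add_mod, Nat.pow_mod]
        · exact Nat.coprime_two_right.1 (Nat.Coprime.coprime_mul_right_right hm'c)
        · exact Nat.coprime_two_right.1 (Nat.Coprime.coprime_mul_right_right hn'c)
      · push_cast
        exact Int.dvd_self_sub_emod
      · push_cast
        have h1 : (g:ℤ) ∣ (s:ℤ) - (s:ℤ) % g := Int.dvd_self_sub_emod
        have := dvd_sub h1 hgst
        simpa using this
    · rintro ⟨g, r, m', n', u, v⟩ hy
      simp only [hTt, Finset.mem_sigma, Finset.mem_product, Finset.mem_filter, Cset] at hy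
      obtain ⟨_, _, _, _, _, hvc, _⟩ := hy
      have key : ∀ (m : ℕ) (s s' : ℕ) (w : ℤ), Nat.Coprime g m → Nat.Coprime v m → s < g * m → s' < g * m → (g:ℤ) ∣ (s:ℤ) - r →
         (g:ℤ) ∣ (s':ℤ) - r → (m:ℤ) ∣ w + v * s → (m:ℤ) ∣ w + v * s' → s = s' := by
        intro m s s' w hgm hvm h1 h2 h3 h4 h5 h6
        have e1 : (g:ℤ) ∣ (s:ℤ) - s' := by have := dvd_sub h3 h4; simpa using this
        have e2 : (m:ℤ) ∣ (s:ℤ) - s' := by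
          have := dvd_sub h5 h6
          have e : (w + v * s) - (w + v * s') = (v:ℤ) * ((s:ℤ) - s') := by ring
          rw [e] at this
          exact (Nat.isCoprime_iff_coprime.2 hvm).symm.dvd_of_dvd_mul_left this
        have e3 : ((g * m : ℕ):ℤ) ∣ (s:ℤ) - s' := by
          push_cast
          exact (Nat.isCoprime_iff_coprime.2 hgm).mul_dvd e1 e2
        have h5 : (s:ℤ) % (g*m:ℕ) = s' % (g*m:ℕ) := Int.emod_eq_emod_iff_emod_sub_eq_zero.2 (Int.emod_eq_zero_of_dvd e3)
        rw [Int.emod_eq_of_lt (by positivity) (by exact_mod_cast h1), Int.emod_eq_of_lt (by positivity) (by exact_mod_cast h2)] at h5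
        exact_mod_cast h5
      rintro ⟨⟨m, s⟩, ⟨n, t⟩⟩ ⟨hx, hr⟩ ⟨⟨m2, s2⟩, ⟨n2, t2⟩⟩ ⟨hx', hr'⟩
      rw [Finset.mem_filter, hF, Finset.mem_filter, Finset.mem_product, h𝒢] at hx hx'
      simp only [Finset.mem_sigma, Rt, Finset.mem_filter, Finset.mem_range] at hx hx' hr hr'
      obtain ⟨rfl, rfl, c1, c2, c3, c4, c5, c6⟩ := hr
      obtain ⟨rfl, rfl, -, -, c3', c4', c5', c6'⟩ := hr'
      have hvm : Nat.Coprime v m' := Nat.Coprime.coprime_mul_right_right hvc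
      have hvn : Nat.Coprime v n' := Nat.Coprime.coprime_mul_left_right hvc
      have f1 : s = s2 := key m' s s2 u c1 hvm hx.1.1.1.2.1 hx'.1.1.1.2.1 c3 c3' c5 c5'
      have f2 : t = t2 := key n' t t2 (-u) c2 hvn hx.1.1.2.2.1 hx'.1.1.2.2.1 c4 c4' (by
        rw [← dvd_neg, show -(-u + (v:ℤ) * t) = u - v * t by ring]; exact c6) (by rw [← dvd_neg, show -(-u + (v:ℤ) * t2) = u - v * t2 by ring]; exact c6')
      rw [f1, f2]

theorem main_ineq [Finite (ClassGroup R)] (q : QR R d) (hd : 0 < d) {ℓ : ℕ} (hℓ : ℓ ≠ 0) (P : ℕ) :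
    Nat.card {c : ClassGroup R // c^ℓ = 1} * (Mg d P)^2 ≤ Nat.card (ClassGroup R) * (Mg d P + Sg d ℓ P) := by
  have hcard : ((Ng d P).sigma (Rt d)).card = Mg d P := by
    rw [Finset.card_sigma, Mg]
    apply Finset.sum_congr rfl
    intro n hn
    exact Rt_card d n (Finset.mem_Icc.1 (Finset.mem_filter.1 hn).1).1
  have h1 := tor_pairs ℓ ((Ng d P).sigma (Rt d)) (fun x => cls (q.I x.1 x.2))
  rw [hcard] at h1
  exact h1.trans (Nat.mul_le_mul_left _ (q.pairs_le hd hℓ P _ rfl))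
end QR
end

lemma card_le_of_diam (A : Finset ℕ) (K : ℕ) (h : ∀ a ∈ A, ∀ b ∈ A, a ≤ b + K) : A.card ≤ K + 1 := by
  rcases A.eq_empty_or_nonempty with rfl | hne
  · simp
  · have : A ⊆ Finset.Icc (A.min' hne) (A.min' hne + K) := by
      intro a ha
      rw [Finset.mem_Icc]
      exact ⟨A.min'_le a ha, h a ha _ (A.min'_mem hne)⟩
    refine (Finset.card_le_card this).trans ?_
    simp only [Nat.card_Icc]
    omega

lemma fib_count (N : ℤ) (v X : ℕ) (hv : 1 ≤ v) (U : Finset ℕ) (h1 : ∀ u ∈ U, ((v:ℤ)^2) ∣ N - (u:ℤ)^2)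
    (h2 : ∀ u ∈ U, (X:ℤ) * v^2 ≤ N - (u:ℤ)^2 ∧ N - (u:ℤ)^2 ≤ 2 * X * v^2) :
    (U.card : ℝ) ≤ nsq N (v^2) * (Real.sqrt X / v + 1) := by
  have hM : 1 ≤ v^2 := Nat.one_le_pow _ _ hv
  have : NeZero (v^2) := ⟨by omega⟩
  have hf := Finset.card_le_mul_card_image (f := fun u : ℕ => (u : ZMod (v^2))) U (⌊Real.sqrt X / v⌋₊ + 1) (by
    intro b _
    set F := U.filter (fun u : ℕ => (u : ZMod (v^2)) = b) with hF
    have hinj : Set.InjOn (fun u : ℕ => u / v^2) F := by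
      intro a ha c hc hac
      have ha' := (Finset.mem_filter.1 (Finset.mem_coe.1 ha)).2
      have hc' := (Finset.mem_filter.1 (Finset.mem_coe.1 hc)).2
      have hmod := (ZMod.natCast_eq_natCast_iff' a c (v^2)).1 (by rw [ha', hc'])
      simp only at hac
      rw [← Nat.div_add_mod a (v^2), ← Nat.div_add_mod c (v^2), hac, hmod]
    rw [← Finset.card_image_of_injOn hinj]
    apply card_le_of_diam
    intro x hx y hy
    rw [Finset.mem_image] at hx hy
    obtain ⟨a, ha, rfl⟩ := hx
    obtain ⟨c, hc, rfl⟩ := hy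
    rcases le_or_gt a c with hac | hac
    · exact (Nat.div_le_div_right hac).trans (Nat.le_add_right _ _)
    have ha' := (Finset.mem_filter.1 ha)
    have hc' := (Finset.mem_filter.1 hc)
    have hmod := (ZMod.natCast_eq_natCast_iff' a c (v^2)).1 (by rw [ha'.2, hc'.2])
    rw [← Nat.sub_le_iff_le_add']
    apply Nat.le_floor
    have hda : a / v^2 ≥ c / v^2 := Nat.div_le_div_right hac.le
    have e : ((a / v^2 - c / v^2 : ℕ) : ℝ) * (v:ℝ)^2 = (a:ℝ) - c := by
      rw [Nat.cast_sub hda]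
      have e1 : (a:ℝ) = (v:ℝ)^2 * ((a / v^2 : ℕ):ℝ) + ((a % v^2 : ℕ):ℝ) := by exact_mod_cast (Nat.div_add_mod a (v^2)).symm
      have e2 : (c:ℝ) = (v:ℝ)^2 * ((c / v^2 : ℕ):ℝ) + ((c % v^2 : ℕ):ℝ) := by exact_mod_cast (Nat.div_add_mod c (v^2)).symm
      rw [hmod] at e1
      linear_combination e2 - e1
    have hv0 : (0:ℝ) < v := by exact_mod_cast hv
    have hsq : ((a:ℝ) - c)^2 ≤ X * v^2 := by
      have g1 := (h2 a ha'.1).1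
      have g2 := (h2 c hc'.1).2
      have g3 : (a:ℤ)^2 - (c:ℤ)^2 ≤ X * v^2 := by linarith
      have g4 : (a:ℝ)^2 - (c:ℝ)^2 ≤ X * v^2 := by exact_mod_cast g3
      have g5 : (c:ℝ) ≤ a := by exact_mod_cast hac.le
      have g6 : (0:ℝ) ≤ c := by positivity
      nlinarith
    have hle : (a:ℝ) - c ≤ Real.sqrt X * v := by
      apply le_of_sq_le_sq _ (by positivity)
      rw [mul_pow, Real.sq_sqrt (by positivity)]; exact hsq
    rw [le_div_iff₀ hv0]
    rw [← e] at hle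
    have : ((a / v^2 - c / v^2 : ℕ) : ℝ) * v * v ≤ Real.sqrt X * v := by rw [mul_assoc, ← sq]; exact hle
    exact le_of_mul_le_mul_right this hv0)
  have him : (U.image (fun u : ℕ => (u : ZMod (v^2)))).card ≤ nsq N (v^2) := by
    rw [nsq, Nat.card_eq_fintype_card, Fintype.card_subtype]
    apply Finset.card_le_card
    intro x hx
    rw [Finset.mem_image] at hx
    obtain ⟨u, hu, rfl⟩ := hx
    simp only [Finset.mem_filter, Finset.mem_univ, true_and]
    have := (ZMod.intCast_zmod_eq_zero_iff_dvd (N - (u:ℤ)^2) (v^2)).2 (by exact_mod_cast h1 u hu)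
    push_cast at this ⊢
    linear_combination -this
  calc (U.card:ℝ) ≤ ((⌊Real.sqrt X / v⌋₊ + 1 : ℕ):ℝ) * (U.image (fun u : ℕ => (u : ZMod (v^2)))).card := by exact_mod_cast hf
    _ ≤ (Real.sqrt X / v + 1) * nsq N (v^2) := by
        push_cast
        gcongr
        exact Nat.floor_le (by positivity)
    _ = _ := by ring

theorem F1 (ℓ X Q V : ℕ) (hV : ∀ v : ℕ, v^2 * X ≤ 4 * Q^(2*ℓ) → v ≤ V) :
    ∑ d ∈ Finset.Ico X (2*X), ((Cset d ℓ Q).card : ℝ) ≤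
      ∑ m ∈ (Finset.Icc 1 Q).filter Odd, ∑ n ∈ (Finset.Icc 1 Q).filter Odd, ∑ v ∈ Finset.Ioc 0 V,
        2 * ((fk ℓ (m*n) v : ℝ) * (Real.sqrt X / v + 1)) := by
  set W := (Finset.Ico X (2*X)).sigma (fun d => Cset d ℓ Q) with hW
  set A := (Finset.Icc 1 Q).filter Odd with hA
  have h1 : ∑ d ∈ Finset.Ico X (2*X), ((Cset d ℓ Q).card : ℝ) = (W.card : ℝ) := by
    rw [hW, Finset.card_sigma]; push_cast; rfl
  have memW : ∀ w, w ∈ W → (X ≤ w.1 ∧ w.1 < 2*X) ∧ (1 ≤ w.2.1 ∧ w.2.1 ≤ Q) ∧ (1 ≤ w.2.2.1 ∧ w.2.2.1 ≤ Q) ∧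
      1 ≤ w.2.2.2.2 ∧ Odd w.2.1 ∧ Odd w.2.2.1 ∧ Nat.Coprime w.2.2.2.2 (w.2.1 * w.2.2.1) ∧
      w.2.2.2.1^2 + w.1 * (w.2.2.2.2:ℤ)^2 = 4 * ((w.2.1:ℤ) * w.2.2.1)^ℓ := by
    rintro ⟨d, m, n, u, v⟩ hw
    simp only [hW, Finset.mem_sigma, Finset.mem_Ico, Cset, Finset.mem_filter, Finset.mem_product, Finset.mem_Icc] at hw
    obtain ⟨a1, ⟨a2, a3, a4, a5⟩, a6, a7, a8, a9⟩ := hw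
    exact ⟨a1, a2, a3, a5.1, a6, a7, a8, a9⟩
  have h2 : W.card = ∑ x ∈ A ×ˢ A ×ˢ Finset.Ioc 0 V, (W.filter (fun w => (w.2.1, w.2.2.1, w.2.2.2.2) = x)).card := by
    apply Finset.card_eq_sum_card_fiberwise
    intro w hw
    obtain ⟨a1, a2, a3, a4, a5, a6, a7, a8⟩ := memW w hw
    simp only [Finset.coe_product, Set.mem_prod, Finset.mem_coe, hA, Finset.mem_filter, Finset.mem_Icc, Finset.mem_Ioc]
    refine ⟨⟨a2, a5⟩, ⟨a3, a6⟩, a4, hV _ ?_⟩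
    have b1 : (w.2.2.2.2:ℤ)^2 * X ≤ 4 * (Q:ℤ)^(2*ℓ) := by
      have c1 : (w.2.1:ℤ) ≤ Q := by exact_mod_cast a2.2
      have c2 : (w.2.2.1:ℤ) ≤ Q := by exact_mod_cast a3.2
      have c3 : (X:ℤ) ≤ w.1 := by exact_mod_cast a1.1
      calc (w.2.2.2.2:ℤ)^2 * X ≤ (w.2.2.2.2:ℤ)^2 * w.1 := by gcongr
        _ ≤ 4 * ((w.2.1:ℤ) * w.2.2.1)^ℓ := by nlinarith [sq_nonneg w.2.2.2.1]
        _ ≤ 4 * ((Q:ℤ) * Q)^ℓ := by gcongr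
        _ = _ := by rw [pow_mul, sq]
    exact_mod_cast b1
  rw [h1, h2]
  push_cast
  rw [Finset.sum_product]
  apply Finset.sum_le_sum
  intro m hm
  rw [Finset.sum_product]
  apply Finset.sum_le_sum
  intro n hn
  apply Finset.sum_le_sum
  intro v hv
  have hv1 : 1 ≤ v := (Finset.mem_Ioc.1 hv).1
  set F := W.filter (fun w => (w.2.1, w.2.2.1, w.2.2.2.2) = (m, n, v)) with hF
  have memF : ∀ w ∈ F, (X ≤ w.1 ∧ w.1 < 2*X) ∧ w.2.1 = m ∧ w.2.2.1 = n ∧ w.2.2.2.2 = v ∧ Nat.Coprime v (m*n) ∧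
     w.2.2.2.1^2 + w.1 * (v:ℤ)^2 = 4 * ((m:ℤ) * n)^ℓ := by
    intro w hw
    rw [hF, Finset.mem_filter] at hw
    obtain ⟨a1, a2, a3, a4, a5, a6, a7, a8⟩ := memW w hw.1
    have e := hw.2
    rw [Prod.mk.injEq, Prod.mk.injEq] at e
    obtain ⟨e1, e2, e3⟩ := e
    rw [e1, e2, e3] at a7 a8
    exact ⟨a1, e1, e2, e3, a7, a8⟩
  by_cases hc : Nat.Coprime v (m*n)
  · set U := F.image (fun w => w.2.2.2.1.natAbs) with hU
    have hcard : F.card ≤ (U ×ˢ (Finset.univ : Finset Bool)).card := by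
      apply Finset.card_le_card_of_injOn (fun w => (w.2.2.2.1.natAbs, decide (0 ≤ w.2.2.2.1)))
      · intro w hw
        simp only [Finset.coe_product, Set.mem_prod, Finset.mem_coe, Finset.mem_univ, and_true]
        exact Finset.mem_image_of_mem _ hw
      · rintro ⟨d, m1, n1, u, v1⟩ hw ⟨d', m2, n2, u', v2⟩ hw' he
        obtain ⟨a1, e1, e2, e3, a7, a8⟩ := memF _ hw
        obtain ⟨a1', e1', e2', e3', a7', a8'⟩ := memF _ hw'
        simp only at e1 e2 e3 e1' e2' e3' a8 a8'
        subst e1 e2 e3 e1' e2' e3'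
        simp only [Prod.mk.injEq, decide_eq_decide] at he
        have hu : u = u' := by
          have := he.1
          have := he.2
          omega
        subst hu
        have hdd : (d:ℤ) = d' := by
          have hv0 : (v2:ℤ)^2 ≠ 0 := by positivity
          apply mul_right_cancel₀ hv0
          linarith
        have : d = d' := by exact_mod_cast hdd
        subst this
        rfl
    have hfc := fib_count (4 * ((m*n:ℕ):ℤ)^ℓ) v X hv1 U (by
      intro u hu
      rw [hU, Finset.mem_image] at hu
      obtain ⟨w, hw, rfl⟩ := hu
      obtain ⟨_, _, _, _, _, a8⟩ := memF w hw
      refine ⟨w.1, ?_⟩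
      rw [Int.natAbs_sq]
      push_cast
      linarith) (by
      intro u hu
      rw [hU, Finset.mem_image] at hu
      obtain ⟨w, hw, rfl⟩ := hu
      obtain ⟨a1, _, _, _, _, a8⟩ := memF w hw
      have c1 : (X:ℤ) ≤ w.1 := by exact_mod_cast a1.1
      have c2 : (w.1:ℤ) ≤ 2 * X := by exact_mod_cast a1.2.le
      rw [Int.natAbs_sq]
      push_cast
      have e : 4 * ((m:ℤ) * n)^ℓ - w.2.2.2.1^2 = w.1 * (v:ℤ)^2 := by linarith
      rw [e]
      constructor <;> gcongr)
    rw [fk, if_pos hc]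
    rw [Finset.card_product, Finset.card_univ, Fintype.card_bool] at hcard
    calc (F.card:ℝ) ≤ (U.card * 2 : ℕ) := by exact_mod_cast hcard
      _ = 2 * (U.card:ℝ) := by push_cast; ring
      _ ≤ _ := by gcongr
  · have : F = ∅ := by
      rw [Finset.eq_empty_iff_forall_notMem]
      intro w hw
      exact hc (memF w hw).2.2.2.2.1
    rw [this, Finset.card_empty, Nat.cast_zero]
    positivity

lemma pr_zero_two : pr 0 2 = {2} := by
  ext p
  rw [mem_pr, Finset.mem_singleton]
  constructor
  · rintro ⟨_, h2, h3⟩; have := h3.two_le; omega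
  · rintro rfl; exact ⟨by norm_num, le_rfl, Nat.prime_two⟩

lemma fk_sum_le {ℓ k V : ℕ} (hℓ : Odd ℓ) (hk : Odd k) (hV : 2 ≤ V) :
    ∑ p ∈ pr 0 V, (fk ℓ k p : ℝ) / p ≤ 4 + rp 0 V + ∑ p ∈ pr 2 V, (jacobiSym k p : ℝ) / p := by
  rw [sum_pr_split (Nat.zero_le 2) hV, pr_zero_two, Finset.sum_singleton]
  have h2 := (MF_fk hℓ hk).bd 2 1 Nat.prime_two le_rfl
  rw [pow_one] at h2
  have h3 : ∑ p ∈ pr 2 V, (fk ℓ k p : ℝ) / p ≤ rp 2 V + ∑ p ∈ pr 2 V, (jacobiSym k p : ℝ) / p := by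
    rw [rp, ← Finset.sum_add_distrib]
    apply Finset.sum_le_sum
    intro p hp
    rw [mem_pr] at hp
    have := fk_prime_pow (k := k) hℓ hp.2.2 (by omega) (le_refl 1)
    rw [pow_one] at this
    have h4 : (fk ℓ k p : ℝ) ≤ 1 + (jacobiSym k p : ℝ) := by exact_mod_cast this
    rw [← add_div]
    gcongr
  have h4 := rp_anti (c := V) (Nat.zero_le 2)
  have : (fk ℓ k 2 : ℝ) / (2:ℕ) ≤ 4 := by push_cast; linarith
  linarith

lemma exp_rp_log : ∃ C : ℝ, 1 ≤ C ∧ ∀ V : ℕ, 2 ≤ V → Real.exp (rp 0 V) ≤ C * Real.log V := by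
  obtain ⟨C, hC0, hC⟩ := mertens_upper
  refine ⟨Real.exp C, Real.one_le_exp hC0, ?_⟩
  intro V hV
  have hl : 0 < Real.log V := Real.log_pos (by exact_mod_cast (by omega : 1 < V))
  calc Real.exp (rp 0 V) ≤ Real.exp (Real.log (Real.log V) + C) := Real.exp_le_exp.2 (hC V hV)
    _ = _ := by rw [Real.exp_add, Real.exp_log hl]; ring

lemma exp_rp_ratio : ∃ C : ℝ, 1 ≤ C ∧ ∀ w V : ℕ, 2 ≤ w → w ≤ V → Real.exp (rp w V) * Real.log w ≤ C * Real.log V := by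
  obtain ⟨C, hC0, hC⟩ := exp_rp_log
  obtain ⟨C2, hC20, hC2⟩ := mertens_lower
  refine ⟨C * Real.exp C2, by nlinarith [Real.one_le_exp hC20], ?_⟩
  intro w V hw hwV
  have hl : 0 < Real.log w := Real.log_pos (by exact_mod_cast (by omega : 1 < w))
  have h1 := hC V (by omega)
  rw [rp_split (Nat.zero_le w) hwV, Real.exp_add] at h1
  have h2 : Real.log w ≤ Real.exp (rp 0 w) * Real.exp C2 := by
    rw [← Real.exp_add]
    calc Real.log w = Real.exp (Real.log (Real.log w)) := (Real.exp_log hl).symm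
      _ ≤ _ := Real.exp_le_exp.2 (hC2 w hw)
  calc Real.exp (rp w V) * Real.log w ≤ Real.exp (rp w V) * (Real.exp (rp 0 w) * Real.exp C2) := by gcongr
    _ = (Real.exp (rp 0 w) * Real.exp (rp w V)) * Real.exp C2 := by ring
    _ ≤ (C * Real.log V) * Real.exp C2 := by gcongr
    _ = _ := by ring

lemma jac_sum_le (k : ℤ) (a b : ℕ) : ∑ p ∈ pr a b, (jacobiSym k p : ℝ) / p ≤ rp a b :=
  (le_abs_self _).trans (abs_sum_pr_le (fun p => (jacobiSym k p : ℝ)) (fun p => by exact_mod_cast jac_abs k p) a b)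

lemma A_bound {ℓ : ℕ} (hℓ : Odd ℓ) : ∃ C : ℝ, 0 ≤ C ∧ ∀ X Q V k : ℕ, 2 ≤ X → 1 ≤ Q → Q ≤ X → V ≤ 2 * Q^ℓ → Odd k →
    ∑ v ∈ Finset.Ioc 0 V, (fk ℓ k v : ℝ) / v ≤ C * (Real.log X)^2 := by
  obtain ⟨C, hC0, hC⟩ := exp_rp_log
  refine ⟨Real.exp 36 * C^2 * (ℓ+1)^2 + 4, by positivity, ?_⟩
  intro X Q V k hX hQ hQX hV hk
  have hX0 : (0:ℝ) < X := by positivity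
  have hlX : Real.log 2 ≤ Real.log X := Real.log_le_log (by norm_num) (by exact_mod_cast hX)
  have hl2 : 1/2 ≤ Real.log 2 := by linarith [Real.log_two_gt_d9]
  have hl4 : 1/4 ≤ (Real.log X)^2 := by nlinarith
  rcases Nat.lt_or_ge V 2 with h | h
  · have hs : ∑ v ∈ Finset.Ioc 0 V, (fk ℓ k v : ℝ) / v ≤ 1 := by
      have h01 : V = 0 ∨ V = 1 := by omega
      rcases h01 with rfl | rfl
      · simp
      · have : ((fk ℓ k 1 : ℕ) : ℝ) = 1 := (MF_fk hℓ hk).one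
        simp [this]
    have : (0:ℝ) ≤ Real.exp 36 * C^2 * (ℓ+1)^2 * (Real.log X)^2 := by positivity
    nlinarith
  · refine ((MF_fk hℓ hk).sum_div_le V).trans ?_
    have h1 := fk_sum_le hℓ hk h
    have h2 := jac_sum_le k 2 V
    have h3 := rp_anti (c := V) (Nat.zero_le 2)
    have hlV : Real.log V ≤ (ℓ+1) * Real.log X := by
      have : (V:ℝ) ≤ (X:ℝ)^(ℓ+1) := by
        have : V ≤ X^(ℓ+1) := by
          calc V ≤ 2 * Q^ℓ := hV
            _ ≤ X * X^ℓ := Nat.mul_le_mul hX (Nat.pow_le_pow_left hQX ℓ)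
            _ = _ := by ring
        exact_mod_cast this
      calc Real.log V ≤ Real.log ((X:ℝ)^(ℓ+1)) := Real.log_le_log (by positivity) this
        _ = _ := by rw [Real.log_pow]; push_cast; ring
    have hlV0 : 0 ≤ Real.log V := Real.log_natCast_nonneg V
    calc Real.exp (∑ p ∈ pr 0 V, (fk ℓ k p : ℝ) / p + 32) ≤ Real.exp (36 + (rp 0 V + rp 0 V)) := by
          apply Real.exp_le_exp.2; linarith
      _ = Real.exp 36 * (Real.exp (rp 0 V) * Real.exp (rp 0 V)) := by rw [Real.exp_add, Real.exp_add (rp 0 V)]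
      _ ≤ Real.exp 36 * ((C * ((ℓ+1) * Real.log X)) * (C * ((ℓ+1) * Real.log X))) := by
          have h5 : Real.exp (rp 0 V) ≤ C * ((ℓ+1) * Real.log X) := (hC V h).trans (by gcongr)
          gcongr
      _ = Real.exp 36 * C^2 * (ℓ+1)^2 * (Real.log X)^2 := by ring
      _ ≤ _ := by nlinarith

lemma B_bound {ℓ : ℕ} (hℓ : Odd ℓ) : ∃ C : ℝ, 0 ≤ C ∧ ∀ Q V : ℕ, 1 ≤ Q → V ≤ 2 * Q^ℓ →
    ∑ m ∈ (Finset.Icc 1 Q).filter Odd, ∑ n ∈ (Finset.Icc 1 Q).filter Odd, ∑ v ∈ Finset.Ioc 0 V, (fk ℓ (m*n) v : ℝ)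
      ≤ C * (Q:ℝ)^2 * V := by
  obtain ⟨C1, hC10, hC1⟩ := exp_rp_log
  obtain ⟨C2, hC20, hC2⟩ := exp_rp_ratio
  obtain ⟨C3, hC30, hC3⟩ := toolU
  obtain ⟨C4, hC40, hC4⟩ := D2
  -- pointwise
  have hpt : ∃ K : ℝ, 0 ≤ K ∧ ∀ Q V : ℕ, 1 ≤ Q → V ≤ 2 * Q^ℓ → ∃ z : ℕ, z^5 ≤ Q^2 ∧ ∀ k : ℕ, Odd k →
      ∑ v ∈ Finset.Ioc 0 V, (fk ℓ k v : ℝ) ≤ K * V * Real.exp (∑ p ∈ pr 2 z, (jacobiSym k p : ℝ) / p) := by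
    set K : ℝ := C3 * Real.exp 4 * C1 * C2 * (10 * (ℓ + 1)) + 1 + C3 * Real.exp 4 * C1 * (C1 * (10*(ℓ+1))) with hK
    have hKK : 0 ≤ K := by positivity
    refine ⟨K, hKK, ?_⟩
    intro Q V hQ hV
    rcases Nat.lt_or_ge V 2 with h | h
    · refine ⟨0, by positivity, ?_⟩
      intro k hk
      rw [pr_empty (by norm_num), Finset.sum_empty, Real.exp_zero, mul_one]
      have hK1 : 1 ≤ K := by rw [hK]; have : 0 ≤ C3 * Real.exp 4 * C1 * C2 * (10 * (ℓ + 1)) := by positivity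
                             have : 0 ≤ C3 * Real.exp 4 * C1 * (C1 * (10*(ℓ+1))) := by positivity
                             linarith
      have h01 : V = 0 ∨ V = 1 := by omega
      rcases h01 with rfl | rfl
      · simp
      · have : ((fk ℓ k 1 : ℕ) : ℝ) = 1 := (MF_fk hℓ hk).one
        simp [this, hK1]
    have hlV : 0 < Real.log V := Real.log_pos (by exact_mod_cast (by omega : 1 < V))
    have base : ∀ k : ℕ, Odd k → ∑ v ∈ Finset.Ioc 0 V, (fk ℓ k v : ℝ) ≤
        C3 * Real.exp 4 * C1 * V * Real.exp (∑ p ∈ pr 2 V, (jacobiSym k p : ℝ) / p) := by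
      intro k hk
      refine (hC3 _ (MF_fk hℓ hk) V h).trans ?_
      have h1 := fk_sum_le hℓ hk h
      calc C3 * (V / Real.log V) * Real.exp (∑ p ∈ pr 0 V, (fk ℓ k p : ℝ) / p)
          ≤ C3 * (V / Real.log V) * Real.exp (4 + rp 0 V + ∑ p ∈ pr 2 V, (jacobiSym k p : ℝ) / p) := by gcongr
        _ = C3 * (V / Real.log V) * (Real.exp 4 * Real.exp (rp 0 V) * Real.exp (∑ p ∈ pr 2 V, (jacobiSym k p : ℝ) / p)) := by
            rw [Real.exp_add, Real.exp_add]
        _ ≤ C3 * (V / Real.log V) * (Real.exp 4 * (C1 * Real.log V) * Real.exp (∑ p ∈ pr 2 V, (jacobiSym k p : ℝ) / p)) := by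
            have := hC1 V h
            gcongr
        _ = _ := by field_simp
    rcases Nat.lt_or_ge Q 6 with hQ6 | hQ6
    · -- small Q
      refine ⟨0, by positivity, ?_⟩
      intro k hk
      rw [pr_empty (by norm_num), Finset.sum_empty, Real.exp_zero, mul_one]
      refine (base k hk).trans ?_
      have h2 := jac_sum_le k 2 V
      have h3 := rp_anti (c := V) (Nat.zero_le 2)
      have hlV' : Real.log V ≤ 10 * (ℓ+1) := by
        have : (V:ℝ) ≤ (6:ℝ)^(ℓ+1) := by
          have : V ≤ 6^(ℓ+1) := by
            calc V ≤ 2 * Q^ℓ := hV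
              _ ≤ 6 * 6^ℓ := Nat.mul_le_mul (by norm_num) (Nat.pow_le_pow_left hQ6.le ℓ)
              _ = _ := by ring
          exact_mod_cast this
        calc Real.log V ≤ Real.log ((6:ℝ)^(ℓ+1)) := Real.log_le_log (by positivity) this
          _ = (ℓ+1) * Real.log 6 := by rw [Real.log_pow]; push_cast; ring
          _ ≤ (ℓ+1) * 10 := by
              have := Real.log_le_sub_one_of_pos (by norm_num : (0:ℝ) < 6)
              gcongr; linarith
          _ = _ := by ring
      have h5 : Real.exp (∑ p ∈ pr 2 V, (jacobiSym k p : ℝ) / p) ≤ C1 * (10*(ℓ+1)) := by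
        calc _ ≤ Real.exp (rp 0 V) := Real.exp_le_exp.2 (by linarith)
          _ ≤ C1 * Real.log V := hC1 V h
          _ ≤ _ := by gcongr
      calc C3 * Real.exp 4 * C1 * V * Real.exp (∑ p ∈ pr 2 V, (jacobiSym k p : ℝ) / p)
          ≤ C3 * Real.exp 4 * C1 * V * (C1 * (10*(ℓ+1))) := by gcongr
        _ = (C3 * Real.exp 4 * C1 * (C1 * (10*(ℓ+1)))) * V := by ring
        _ ≤ K * V := by
            gcongr
            rw [hK]
            have : 0 ≤ C3 * Real.exp 4 * C1 * C2 * (10 * (ℓ + 1)) := by positivity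
            linarith
    · -- large Q : choose z
      obtain ⟨z, hz1, hz2, hz3⟩ : ∃ z : ℕ, 2 ≤ z ∧ z^5 ≤ Q^2 ∧ Q^2 ≤ (z+1)^5 := by
        have hex : ∃ n, Q^2 < (n+1)^5 := ⟨Q^2, by
          calc Q^2 < Q^2 + 1 := by omega
            _ ≤ (Q^2+1)^5 := Nat.le_self_pow (by norm_num) _⟩
        refine ⟨Nat.find hex, ?_, ?_, (Nat.find_spec hex).le⟩
        · by_contra hlt
          have := Nat.find_spec hex
          have h3 : (Nat.find hex + 1)^5 ≤ 2^5 := Nat.pow_le_pow_left (by omega) 5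
          nlinarith
        · rcases Nat.eq_zero_or_pos (Nat.find hex) with h0 | h0
          · rw [h0]; positivity
          · have := Nat.find_min hex (m := Nat.find hex - 1) (by omega)
            rw [Nat.sub_add_cancel h0] at this
            omega
      rcases le_or_gt V z with hVz | hVz
      · refine ⟨V, (Nat.pow_le_pow_left hVz 5).trans hz2, ?_⟩
        intro k hk
        refine (base k hk).trans ?_
        have hK2 : C3 * Real.exp 4 * C1 ≤ K := by
          have a1 : C3 * Real.exp 4 * C1 * 1 ≤ C3 * Real.exp 4 * C1 * (C2 * (10 * (ℓ + 1))) := by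
            gcongr
            have : (0:ℝ) ≤ ℓ := by positivity
            nlinarith
          have a2 : 0 ≤ C3 * Real.exp 4 * C1 * (C1 * (10*(ℓ+1))) := by positivity
          rw [hK]; linarith
        gcongr
      refine ⟨z, hz2, ?_⟩
      intro k hk
      refine (base k hk).trans ?_
      have hlz : 0 < Real.log z := Real.log_pos (by exact_mod_cast (by omega : 1 < z))
      have hQz : Q ≤ z^5 := by
        have h1 : (z+1)^5 ≤ (z^2)^5 := Nat.pow_le_pow_left (by nlinarith) 5
        have h2 : Q^2 ≤ (z^5)^2 := by
          calc Q^2 ≤ (z^2)^5 := hz3.trans h1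
            _ = (z^5)^2 := by ring
        exact (Nat.pow_le_pow_iff_left (by norm_num)).1 h2
      have hlV' : Real.log V ≤ 10 * (ℓ+1) * Real.log z := by
        have : (V:ℝ) ≤ (z:ℝ)^(5*ℓ+1) := by
          have : V ≤ z^(5*ℓ+1) := by
            calc V ≤ 2 * Q^ℓ := hV
              _ ≤ z * (z^5)^ℓ := Nat.mul_le_mul hz1 (Nat.pow_le_pow_left hQz ℓ)
              _ = _ := by rw [← pow_mul]; ring
          exact_mod_cast this
        calc Real.log V ≤ Real.log ((z:ℝ)^(5*ℓ+1)) := Real.log_le_log (by positivity) this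
          _ = (5*ℓ+1) * Real.log z := by rw [Real.log_pow]; push_cast; ring
          _ ≤ _ := by gcongr; nlinarith [(Nat.cast_nonneg ℓ : (0:ℝ) ≤ ℓ)]
      have hE : Real.exp (∑ p ∈ pr 2 V, (jacobiSym k p : ℝ) / p) ≤
          C2 * (10 * (ℓ+1)) * Real.exp (∑ p ∈ pr 2 z, (jacobiSym k p : ℝ) / p) := by
        have hE1 : ∀ w : ℕ, z ≤ w → Real.exp (rp z w) * Real.log z ≤ C2 * Real.log w := fun w hw => hC2 z w hz1 hw
        have hzV := hVz.le
        · rw [sum_pr_split hz1 hzV, Real.exp_add, mul_comm]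
          gcongr
          have e1 := hE1 V hzV
          have e2 : Real.exp (rp z V) ≤ C2 * (10 * (ℓ+1)) := by
            have : Real.exp (rp z V) * Real.log z ≤ C2 * (10 * (ℓ+1)) * Real.log z := by
              calc _ ≤ _ := e1
                _ ≤ C2 * (10 * (ℓ+1) * Real.log z) := by gcongr
                _ = _ := by ring
            exact le_of_mul_le_mul_right this hlz
          exact (Real.exp_le_exp.2 (jac_sum_le k z V)).trans e2
      calc C3 * Real.exp 4 * C1 * V * Real.exp (∑ p ∈ pr 2 V, (jacobiSym k p : ℝ) / p)
          ≤ C3 * Real.exp 4 * C1 * V * (C2 * (10 * (ℓ+1)) * Real.exp (∑ p ∈ pr 2 z, (jacobiSym k p : ℝ) / p)) := by gcongr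
        _ = (C3 * Real.exp 4 * C1 * C2 * (10 * (ℓ + 1))) * V * Real.exp (∑ p ∈ pr 2 z, (jacobiSym k p : ℝ) / p) := by ring
        _ ≤ K * V * Real.exp (∑ p ∈ pr 2 z, (jacobiSym k p : ℝ) / p) := by
            gcongr
            rw [hK]
            have : 0 ≤ C3 * Real.exp 4 * C1 * (C1 * (10*(ℓ+1))) := by positivity
            linarith
  obtain ⟨K, hK0, hK⟩ := hpt
  refine ⟨K * C4, by positivity, ?_⟩
  intro Q V hQ hV
  obtain ⟨z, hz, hkz⟩ := hK Q V hQ hV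
  calc ∑ m ∈ (Finset.Icc 1 Q).filter Odd, ∑ n ∈ (Finset.Icc 1 Q).filter Odd, ∑ v ∈ Finset.Ioc 0 V, (fk ℓ (m*n) v : ℝ)
      ≤ ∑ m ∈ (Finset.Icc 1 Q).filter Odd, ∑ n ∈ (Finset.Icc 1 Q).filter Odd,
          K * V * Real.exp (∑ p ∈ pr 2 z, (jacobiSym ((m:ℤ)*n) p : ℝ) / p) := by
        apply Finset.sum_le_sum
        intro m hm
        apply Finset.sum_le_sum
        intro n hn
        have := hkz (m*n) ((Finset.mem_filter.1 hm).2.mul (Finset.mem_filter.1 hn).2)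
        push_cast at this
        exact this
    _ ≤ ∑ m ∈ Finset.Icc 1 Q, ∑ n ∈ Finset.Icc 1 Q,
          K * V * Real.exp (∑ p ∈ pr 2 z, (jacobiSym ((m:ℤ)*n) p : ℝ) / p) := by
        refine (Finset.sum_le_sum_of_subset_of_nonneg (Finset.filter_subset _ _) (fun _ _ _ => Finset.sum_nonneg (fun _ _ => by positivity))).trans ?_
        apply Finset.sum_le_sum
        intro m _
        exact Finset.sum_le_sum_of_subset_of_nonneg (Finset.filter_subset _ _) (fun _ _ _ => by positivity)
    _ = K * V * ∑ m ∈ Finset.Icc 1 Q, ∑ n ∈ Finset.Icc 1 Q,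
          Real.exp (∑ p ∈ pr 2 z, (jacobiSym ((m:ℤ)*n) p : ℝ) / p) := by simp only [Finset.mul_sum]
    _ ≤ K * V * (C4 * (Q:ℝ)^2) := by
        have := hC4 Q z hz
        gcongr
    _ = _ := by ring

lemma F2 {ℓ : ℕ} (hℓ : Odd ℓ) : ∃ C : ℝ, 0 ≤ C ∧ ∀ X Q : ℕ, 2 ≤ X → 1 ≤ Q → Q ≤ X →
    ∑ d ∈ Finset.Ico X (2*X), ((Cset d ℓ Q).card : ℝ) ≤
      C * ((Q:ℝ)^2 * Real.sqrt X * (Real.log X)^2 + (Q:ℝ)^(ℓ+2) / Real.sqrt X) := by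
  obtain ⟨C1, hC10, hC1⟩ := A_bound hℓ
  obtain ⟨C2, hC20, hC2⟩ := B_bound hℓ
  refine ⟨2 * C1 + 4 * C2, by positivity, ?_⟩
  intro X Q hX hQ hQX
  set V := Nat.sqrt (4 * Q^(2*ℓ) / X) with hV
  have hXp : 0 < X := by omega
  have h1 : ∀ v : ℕ, v^2 * X ≤ 4 * Q^(2*ℓ) → v ≤ V := by
    intro v hv
    rw [hV, Nat.le_sqrt, ← sq]
    exact (Nat.le_div_iff_mul_le hXp).2 hv
  have h2 : V^2 * X ≤ 4 * Q^(2*ℓ) := by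
    have : V^2 ≤ 4 * Q^(2*ℓ) / X := by rw [sq]; exact Nat.sqrt_le _
    exact (Nat.le_div_iff_mul_le hXp).1 this
  have h3 : V ≤ 2 * Q^ℓ := by
    have : V^2 ≤ (2 * Q^ℓ)^2 := by
      calc V^2 ≤ V^2 * X := Nat.le_mul_of_pos_right _ hXp
        _ ≤ 4 * Q^(2*ℓ) := h2
        _ = _ := by ring
    exact (Nat.pow_le_pow_iff_left (by norm_num)).1 this
  have hsX : 0 < Real.sqrt X := Real.sqrt_pos.2 (by exact_mod_cast hXp)
  have h4 : (V:ℝ) ≤ 2 * (Q:ℝ)^ℓ / Real.sqrt X := by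
    rw [le_div_iff₀ hsX]
    apply le_of_sq_le_sq _ (by positivity)
    rw [mul_pow, Real.sq_sqrt (by positivity)]
    have : (V:ℝ)^2 * X ≤ 4 * (Q:ℝ)^(2*ℓ) := by exact_mod_cast h2
    calc (V:ℝ)^2 * X ≤ 4 * (Q:ℝ)^(2*ℓ) := this
      _ = _ := by ring
  refine (F1 ℓ X Q V h1).trans ?_
  set A := (Finset.Icc 1 Q).filter Odd with hA
  have hAc : (A.card : ℝ) ≤ Q := by
    have : A.card ≤ Q := (Finset.card_filter_le _ _).trans (by simp)
    exact_mod_cast this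
  have e : ∑ m ∈ A, ∑ n ∈ A, ∑ v ∈ Finset.Ioc 0 V, 2 * ((fk ℓ (m*n) v : ℝ) * (Real.sqrt X / v + 1)) =
     2 * Real.sqrt X * ∑ m ∈ A, ∑ n ∈ A, ∑ v ∈ Finset.Ioc 0 V, (fk ℓ (m*n) v : ℝ) / v +
     2 * ∑ m ∈ A, ∑ n ∈ A, ∑ v ∈ Finset.Ioc 0 V, (fk ℓ (m*n) v : ℝ) := by
    simp only [Finset.mul_sum, ← Finset.sum_add_distrib]
    apply Finset.sum_congr rfl; intro m _
    apply Finset.sum_congr rfl; intro n _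
    apply Finset.sum_congr rfl; intro v _
    ring
  rw [e]
  have hAA : ∑ m ∈ A, ∑ n ∈ A, ∑ v ∈ Finset.Ioc 0 V, (fk ℓ (m*n) v : ℝ) / v ≤ (Q:ℝ) * (Q * (C1 * (Real.log X)^2)) := by
    calc _ ≤ ∑ m ∈ A, ∑ n ∈ A, C1 * (Real.log X)^2 := by
          apply Finset.sum_le_sum; intro m hm
          apply Finset.sum_le_sum; intro n hn
          exact hC1 X Q V (m*n) hX hQ hQX h3 ((Finset.mem_filter.1 hm).2.mul (Finset.mem_filter.1 hn).2)
      _ = (A.card:ℝ) * (A.card * (C1 * (Real.log X)^2)) := by simp [Finset.sum_const]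
      _ ≤ _ := by gcongr
  have hBB := hC2 Q V hQ h3
  calc _ ≤ 2 * Real.sqrt X * ((Q:ℝ) * (Q * (C1 * (Real.log X)^2))) + 2 * (C2 * (Q:ℝ)^2 * (2 * (Q:ℝ)^ℓ / Real.sqrt X)) := by
        gcongr
        exact hBB.trans (by gcongr)
    _ = (2 * C1) * ((Q:ℝ)^2 * Real.sqrt X * (Real.log X)^2) + (4 * C2) * ((Q:ℝ)^(ℓ+2) / Real.sqrt X) := by ring
    _ ≤ _ := by
        have a1 : 0 ≤ (Q:ℝ)^2 * Real.sqrt X * (Real.log X)^2 := by positivity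
        have a2 : 0 ≤ (Q:ℝ)^(ℓ+2) / Real.sqrt X := by positivity
        nlinarith

lemma nsq_le (a : ℤ) {g : ℕ} (hg : 1 ≤ g) : nsq a g ≤ g := by
  have : NeZero g := ⟨by omega⟩
  rw [nsq]
  calc _ ≤ Nat.card (ZMod g) := Nat.card_le_card_of_injective _ Subtype.val_injective
    _ = g := Nat.card_zmod g

lemma sum_inv_sq_le (P : ℕ) : ∑ g ∈ Finset.Icc 1 P, 1 / (g:ℝ)^2 ≤ 2 := by
  have key : ∀ P : ℕ, ∑ g ∈ Finset.Icc 1 (P+1), 1 / (g:ℝ)^2 ≤ 2 - 1 / ((P:ℝ)+1) := by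
    intro P
    induction P with
    | zero => norm_num
    | succ n ih =>
      rw [Finset.sum_Icc_succ_top (by omega)]
      have : 1 / (((n+1+1:ℕ):ℝ))^2 ≤ 1 / ((n:ℝ)+1) - 1 / (((n+1:ℕ):ℝ)+1) := by
        push_cast
        have hn : (0:ℝ) ≤ n := by positivity
        rw [div_sub_div _ _ (by positivity) (by positivity), div_le_div_iff₀ (by positivity) (by positivity)]
        nlinarith
      linarith
  rcases P with _ | P
  · simp
  · have : (0:ℝ) ≤ 1 / ((P:ℝ)+1) := by positivity
    linarith [key P]

lemma sum_inv_le (P X : ℕ) (hX : 2 ≤ X) (h : P ≤ X) : ∑ g ∈ Finset.Icc 1 P, 1 / (g:ℝ) ≤ 3 * Real.log X := by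
  have hl2 : 1/2 ≤ Real.log 2 := by linarith [Real.log_two_gt_d9]
  have hlX : Real.log 2 ≤ Real.log X := Real.log_le_log (by norm_num) (by exact_mod_cast hX)
  have h1 := harmonic_le_one_add_log P
  have e : ((harmonic P : ℚ) : ℝ) = ∑ n ∈ Finset.Icc 1 P, 1 / (n:ℝ) := by
    rw [harmonic_eq_sum_Icc]; push_cast
    apply Finset.sum_congr rfl
    intro x _; simp
  rw [← e]
  have h2 : Real.log P ≤ Real.log X := by
    rcases Nat.eq_zero_or_pos P with rfl | hp
    · simp; exact Real.log_natCast_nonneg X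
    · exact Real.log_le_log (by exact_mod_cast hp) (by exact_mod_cast h)
  linarith

theorem FF {ℓ : ℕ} (hℓ : Odd ℓ) : ∃ C : ℝ, 0 ≤ C ∧ ∀ X P : ℕ, 2 ≤ X → 1 ≤ P → P ≤ X →
    ∑ d ∈ Finset.Ico X (2*X), (Sg d ℓ P : ℝ) ≤
      C * ((P:ℝ)^2 * Real.sqrt X * (Real.log X)^3 + (P:ℝ)^(ℓ+2) / Real.sqrt X) := by
  obtain ⟨C, hC0, hC⟩ := F2 hℓ
  refine ⟨3 * C, by positivity, ?_⟩
  intro X P hX hP hPX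
  have hl : 0 ≤ Real.log X := Real.log_natCast_nonneg X
  calc ∑ d ∈ Finset.Ico X (2*X), (Sg d ℓ P : ℝ)
      ≤ ∑ d ∈ Finset.Ico X (2*X), ∑ g ∈ Finset.Icc 1 P, (g:ℝ) * ((Cset d ℓ (P/g)).card : ℝ) := by
        apply Finset.sum_le_sum
        intro d _
        rw [Sg]
        push_cast
        refine (Finset.sum_le_sum_of_subset_of_nonneg (Finset.filter_subset _ _) (fun _ _ _ => by positivity)).trans ?_
        apply Finset.sum_le_sum
        intro g hg
        have := nsq_le (-(d:ℤ)) (Finset.mem_Icc.1 hg).1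
        gcongr
    _ = ∑ g ∈ Finset.Icc 1 P, (g:ℝ) * ∑ d ∈ Finset.Ico X (2*X), ((Cset d ℓ (P/g)).card : ℝ) := by
        rw [Finset.sum_comm]
        simp only [Finset.mul_sum]
    _ ≤ ∑ g ∈ Finset.Icc 1 P, C * ((P:ℝ)^2 * Real.sqrt X * (Real.log X)^2 * (1 / g) + (P:ℝ)^(ℓ+2) / Real.sqrt X * (1/(g:ℝ)^2)) := by
        apply Finset.sum_le_sum
        intro g hg
        rw [Finset.mem_Icc] at hg
        have hg0 : (0:ℝ) < g := by exact_mod_cast hg.1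
        have hg1 : (1:ℝ) ≤ g := by exact_mod_cast hg.1
        have hQ1 : 1 ≤ P / g := (Nat.one_le_div_iff hg.1).2 hg.2
        have h1 := hC X (P/g) hX hQ1 ((Nat.div_le_self P g).trans hPX)
        have h2 : ((P/g : ℕ):ℝ) ≤ P / g := Nat.cast_div_le
        obtain ⟨k, rfl⟩ := hℓ
        calc (g:ℝ) * ∑ d ∈ Finset.Ico X (2*X), ((Cset d (2*k+1) (P/g)).card : ℝ)
            ≤ g * (C * ((((P:ℝ)/g))^2 * Real.sqrt X * (Real.log X)^2 + ((P:ℝ)/g)^(2*k+1+2) / Real.sqrt X)) := by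
              gcongr
              refine h1.trans ?_
              gcongr
          _ = C * ((P:ℝ)^2 * Real.sqrt X * (Real.log X)^2 * (1 / g) + (P:ℝ)^(2*k+1+2) / Real.sqrt X * (1/(g:ℝ)^(2*k+2))) := by
              rw [div_pow, div_pow]
              field_simp
              ring
          _ ≤ _ := by
              gcongr
              omega
    _ = C * ((P:ℝ)^2 * Real.sqrt X * (Real.log X)^2 * ∑ g ∈ Finset.Icc 1 P, 1 / (g:ℝ) +
          (P:ℝ)^(ℓ+2) / Real.sqrt X * ∑ g ∈ Finset.Icc 1 P, 1/(g:ℝ)^2) := by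
        rw [← Finset.mul_sum, Finset.sum_add_distrib, ← Finset.mul_sum, ← Finset.mul_sum]
    _ ≤ C * ((P:ℝ)^2 * Real.sqrt X * (Real.log X)^2 * (3 * Real.log X) + (P:ℝ)^(ℓ+2) / Real.sqrt X * 3) := by
        have a1 := sum_inv_le P X hX hPX
        have a2 := sum_inv_sq_le P
        have a3 : ∑ g ∈ Finset.Icc 1 P, 1/(g:ℝ)^2 ≤ 3 := by linarith
        gcongr
    _ = _ := by ring

/-- no quadruples when P is small -/
lemma Sg_zero {d ℓ P : ℕ} (h : 4 * P^(2*ℓ) < d) : Sg d ℓ P = 0 := by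
  rw [Sg]
  apply Finset.sum_eq_zero
  intro g hg
  have : Cset d ℓ (P/g) = ∅ := by
    rw [Finset.eq_empty_iff_forall_notMem]
    rintro ⟨m, n, u, v⟩ hw
    simp only [Cset, Finset.mem_filter, Finset.mem_product, Finset.mem_Icc] at hw
    obtain ⟨⟨a2, a3, a4, a5⟩, a6, a7, a8, a9⟩ := hw
    have c1 : (m:ℤ) ≤ P := by exact_mod_cast a2.2.trans (Nat.div_le_self _ _)
    have c2 : (n:ℤ) ≤ P := by exact_mod_cast a3.2.trans (Nat.div_le_self _ _)
    have c3 : (1:ℤ) ≤ (v:ℤ)^2 := by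
      have : (1:ℤ) ≤ v := by exact_mod_cast a5.1
      nlinarith
    have : (d:ℤ) ≤ 4 * (P:ℤ)^(2*ℓ) := by
      calc (d:ℤ) ≤ u^2 + d * (v:ℤ)^2 := by nlinarith [sq_nonneg u]
        _ ≤ 4 * ((P:ℤ) * P)^ℓ := by rw [a9]; gcongr
        _ = _ := by rw [pow_mul, sq]
    have : d ≤ 4 * P^(2*ℓ) := by exact_mod_cast this
    omega
  rw [this]; simp

noncomputable def hcl (d : ℕ) : ℕ := Nat.card (ClassGroup (𝓞 (Qneg d)))

theorem G1 (k : ℕ) : ∃ C : ℝ, 0 ≤ C ∧ ∀ z X d : ℕ, 2 ≤ z → z^5 ≤ X → X ≤ z^k → X ≤ d → d < 2 * X → Squarefree d →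
    (hcl d : ℝ) ≤ C * Real.sqrt X * idx z d := by
  obtain ⟨C1, hC10, hC1⟩ := exp_rp_log
  obtain ⟨C2, hC20, hC2⟩ := exp_rp_ratio
  obtain ⟨C3, hC30, hC3⟩ := toolU
  obtain ⟨C4, hC40, hC4⟩ := exp_rp_le
  refine ⟨2 * C3 * Real.exp 4 * C1 * (Real.exp 1 * C4) * (C2 * (2 * k)), by positivity, ?_⟩
  intro z X d hz hzX hXz hXd hdX hd
  have hX2 : 2 ≤ X := by
    have : 2^5 ≤ z^5 := Nat.pow_le_pow_left hz 5
    omega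
  set A := Nat.sqrt (2*d) with hA
  have hzA : z ≤ A := by
    rw [hA, Nat.le_sqrt]
    have : z * z ≤ z^5 := by
      calc z * z = z^2 := by ring
        _ ≤ z^5 := Nat.pow_le_pow_right (by omega) (by norm_num)
    omega
  have hA2 : 2 ≤ A := hz.trans hzA
  have hAX : (A:ℝ) ≤ 2 * Real.sqrt X := by
    apply le_of_sq_le_sq _ (by positivity)
    rw [mul_pow, Real.sq_sqrt (by positivity)]
    have : A^2 ≤ 2^2 * X := by
      have : A * A ≤ 2 * d := Nat.sqrt_le _
      rw [sq]; omega
    exact_mod_cast this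
  have hcount : hcl d ≤ ∑ a ∈ Finset.Icc 1 A, nsq (-(d:ℤ)) a := by
    apply (QRi d hd).card_class_le (by omega)
    intro a ha
    rw [hA, Nat.le_sqrt]
    nlinarith
  have hlA : 0 < Real.log A := Real.log_pos (by exact_mod_cast (by omega : 1 < A))
  have hlz : 0 < Real.log z := Real.log_pos (by exact_mod_cast (by omega : 1 < z))
  have h1 : (hcl d : ℝ) ≤ C3 * (A / Real.log A) * Real.exp (∑ p ∈ pr 0 A, (nsq (-(d:ℤ)) p : ℝ) / p) := by
    refine le_trans ?_ (hC3 _ (MF_rho hd) A hA2)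
    exact_mod_cast hcount
  have h2 : ∑ p ∈ pr 0 A, (nsq (-(d:ℤ)) p : ℝ) / p ≤ 4 + rp 0 A + ∑ p ∈ pr 2 A, chi d p / p := by
    rw [sum_pr_split (Nat.zero_le 2) hA2, pr_zero_two, Finset.sum_singleton]
    have h2 := (MF_rho hd).bd 2 1 Nat.prime_two le_rfl
    rw [pow_one] at h2
    have h3 : ∑ p ∈ pr 2 A, (nsq (-(d:ℤ)) p : ℝ) / p ≤ rp 2 A + ∑ p ∈ pr 2 A, chi d p / p := by
      rw [rp, ← Finset.sum_add_distrib]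
      apply Finset.sum_le_sum
      intro p hp
      rw [mem_pr] at hp
      have := nsq_prime (-(d:ℤ)) hp.2.2 (by omega)
      have h4 : (nsq (-(d:ℤ)) p : ℝ) = 1 + chi d p := by unfold chi; exact_mod_cast this
      rw [h4, ← add_div]
    have h4 := rp_anti (c := A) (Nat.zero_le 2)
    have : (nsq (-(d:ℤ)) 2 : ℝ) / (2:ℕ) ≤ 4 := by push_cast at h2 ⊢; linarith
    linarith
  have hk : Real.log A ≤ 2 * k * Real.log z := by
    have : (A:ℝ) ≤ (z:ℝ)^(2*k) := by
      have : A ≤ z^(2*k) := by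
        calc A ≤ 2 * d := Nat.sqrt_le_self _
          _ ≤ X * X := by
              have : 2 * d ≤ 4 * X := by omega
              have : 32 ≤ X := le_trans (Nat.pow_le_pow_left hz 5) hzX
              nlinarith
          _ ≤ z^k * z^k := Nat.mul_le_mul hXz hXz
          _ = _ := by ring
      exact_mod_cast this
    calc Real.log A ≤ Real.log ((z:ℝ)^(2*k)) := Real.log_le_log (by positivity) this
      _ = _ := by rw [Real.log_pow]; push_cast; ring
  have hgood := idx_good z d
  rw [badd, not_or, not_not, not_not] at hgood
  have h3 := sum_pr_two_le (chi d) (chi_abs d) z (idx z d) (idx_pos z d) hgood.1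
  have h4 := hC4 (idx z d) (idx_pos z d)
  have h5 : Real.exp (rp z A) ≤ C2 * (2 * k) := by
    have : Real.exp (rp z A) * Real.log z ≤ C2 * (2 * k) * Real.log z := by
      calc _ ≤ _ := hC2 z A hz hzA
        _ ≤ C2 * (2 * k * Real.log z) := by gcongr
        _ = _ := by ring
    exact le_of_mul_le_mul_right this hlz
  have h6 : Real.exp (∑ p ∈ pr 2 A, chi d p / p) ≤ (Real.exp 1 * C4) * (C2 * (2 * k)) * idx z d := by
    rw [sum_pr_split hz hzA, Real.exp_add]
    have e1 : Real.exp (∑ p ∈ pr 2 z, chi d p / p) ≤ Real.exp 1 * C4 * idx z d := by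
      calc _ ≤ Real.exp (rp 0 (2^(idx z d)) + 1) := Real.exp_le_exp.2 ((le_abs_self _).trans h3)
        _ = Real.exp 1 * Real.exp (rp 0 (2^(idx z d))) := by rw [Real.exp_add]; ring
        _ ≤ Real.exp 1 * (C4 * idx z d) := by gcongr
        _ = _ := by ring
    have e2 : Real.exp (∑ p ∈ pr z A, chi d p / p) ≤ C2 * (2 * k) :=
      (Real.exp_le_exp.2 ((le_abs_self _).trans (abs_sum_pr_le (chi d) (chi_abs d) z A))).trans h5
    calc _ ≤ (Real.exp 1 * C4 * idx z d) * (C2 * (2 * k)) := by gcongr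
      _ = _ := by ring
  calc (hcl d : ℝ) ≤ _ := h1
    _ ≤ C3 * (A / Real.log A) * Real.exp (4 + rp 0 A + ∑ p ∈ pr 2 A, chi d p / p) := by gcongr
    _ = C3 * (A / Real.log A) * (Real.exp 4 * Real.exp (rp 0 A) * Real.exp (∑ p ∈ pr 2 A, chi d p / p)) := by
        rw [Real.exp_add, Real.exp_add]
    _ ≤ C3 * (A / Real.log A) * (Real.exp 4 * (C1 * Real.log A) * ((Real.exp 1 * C4) * (C2 * (2 * k)) * idx z d)) := by
        have := hC1 A hA2
        gcongr
    _ = C3 * A * (Real.exp 4 * C1 * ((Real.exp 1 * C4) * (C2 * (2 * k)) * idx z d)) := by field_simp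
    _ ≤ C3 * (2 * Real.sqrt X) * (Real.exp 4 * C1 * ((Real.exp 1 * C4) * (C2 * (2 * k)) * idx z d)) := by gcongr
    _ = _ := by ring

lemma nsq_prod (a : ℤ) (A : Finset ℕ) (hA : ∀ p ∈ A, p.Prime) : nsq a (∏ p ∈ A, p) = ∏ p ∈ A, nsq a p := by
  induction A using Finset.induction with
  | empty => simp [nsq_one]
  | insert p s hp ih =>
    rw [Finset.prod_insert hp, Finset.prod_insert hp, nsq_mul, ih (fun q hq => hA q (Finset.mem_insert_of_mem hq))]
    apply Nat.Coprime.prod_right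
    intro q hq
    exact (Nat.coprime_primes (hA p (Finset.mem_insert_self _ _)) (hA q (Finset.mem_insert_of_mem hq))).2 (by
      rintro rfl; exact hp hq)

lemma sqfree_prod (A : Finset ℕ) (hA : ∀ p ∈ A, p.Prime) : Squarefree (∏ p ∈ A, p) := by
  induction A using Finset.induction with
  | empty => simp
  | insert p s hp ih =>
    rw [Finset.prod_insert hp, Nat.squarefree_mul_iff]
    refine ⟨?_, (hA p (Finset.mem_insert_self _ _)).squarefree, ih (fun q hq => hA q (Finset.mem_insert_of_mem hq))⟩
    apply Nat.Coprime.prod_right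
    intro q hq
    exact (Nat.coprime_primes (hA p (Finset.mem_insert_self _ _)) (hA q (Finset.mem_insert_of_mem hq))).2 (by
      rintro rfl; exact hp hq)

/-- lower bound for M by products -/
lemma Mg_ge (d z P : ℕ) (𝒜 : Finset ℕ) (h𝒜 : ∀ p ∈ 𝒜, p.Prime ∧ p ≠ 2 ∧ p ≤ z ∧ ¬ p ∣ d) (S : Finset (Finset ℕ))
    (hS : ∀ A ∈ S, A ⊆ 𝒜) (Ps : Finset ℕ → Finset ℕ) (hz : 2 ≤ z)
    (hPs : ∀ A ∈ S, ∀ p ∈ Ps A, p.Prime ∧ z < p ∧ ¬ p ∣ d ∧ (∏ q ∈ A, q) * p ≤ P) :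
    ∑ A ∈ S, (∏ q ∈ A, (1 + chi d q)) * ∑ p ∈ Ps A, (1 + chi d p) ≤ (Mg d P : ℝ) := by
  have hchi : ∀ p : ℕ, p.Prime → p ≠ 2 → (nsq (-(d:ℤ)) p : ℝ) = 1 + chi d p := by
    intro p hp h2
    have := nsq_prime (-(d:ℤ)) hp h2
    unfold chi; exact_mod_cast this
  have hcop : ∀ A ∈ S, ∀ p ∈ Ps A, Nat.Coprime (∏ q ∈ A, q) p := by
    intro A hA p hp
    apply Nat.Coprime.prod_left
    intro q hq
    have h1 := h𝒜 q (hS A hA hq)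
    have h2 := hPs A hA p hp
    exact (Nat.coprime_primes h1.1 h2.1).2 (by omega)
  have hpc : ∀ p : ℕ, p.Prime → p ≠ 2 → ¬ p ∣ d → Nat.Coprime p (2*d) := by
    intro p hp h2 hd
    apply Nat.Coprime.mul_right
    · exact (Nat.coprime_primes hp Nat.prime_two).2 h2
    · exact (Nat.Prime.coprime_iff_not_dvd hp).2 hd
  set W := S.sigma Ps with hW
  set e : (_ : Finset ℕ) × ℕ → ℕ := fun x => (∏ q ∈ x.1, q) * x.2 with he
  have hinj : Set.InjOn e W := by
    rintro ⟨A, p⟩ hx ⟨B, q⟩ hy hxy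
    rw [Finset.mem_coe, hW, Finset.mem_sigma] at hx hy
    simp only [he] at hxy hx hy
    have key : ∀ A ∈ S, ∀ p : ℕ, p.Prime → z < p → ¬ p ∣ ∏ q ∈ A, q := by
      intro A hA p hp hzp hdvd
      obtain ⟨r, hr, hpr⟩ := (Prime.dvd_finset_prod_iff hp.prime _).1 hdvd
      have h1 := h𝒜 r (hS A hA hr)
      have := (Nat.prime_dvd_prime_iff_eq hp h1.1).1 hpr
      omega
    have hp := hPs A hx.1 p hx.2
    have hq := hPs B hy.1 q hy.2
    have hpq : p = q := by
      have : p ∣ (∏ q ∈ B, q) * q := by rw [← hxy]; exact dvd_mul_left _ _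
      rcases (Nat.Prime.dvd_mul hp.1).1 this with h | h
      · exact absurd h (key B hy.1 p hp.1 hp.2.1)
      · exact (Nat.prime_dvd_prime_iff_eq hp.1 hq.1).1 h
    subst hpq
    have hAB : ∏ q ∈ A, q = ∏ q ∈ B, q := Nat.eq_of_mul_eq_mul_right hp.1.pos hxy
    have hA' := Nat.primeFactors_prod (s := A) (fun r hr => (h𝒜 r (hS A hx.1 hr)).1)
    have hB' := Nat.primeFactors_prod (s := B) (fun r hr => (h𝒜 r (hS B hy.1 hr)).1)
    have : A = B := by rw [← hA', ← hB', hAB]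
    subst this
    rfl
  calc ∑ A ∈ S, (∏ q ∈ A, (1 + chi d q)) * ∑ p ∈ Ps A, (1 + chi d p)
      = ∑ x ∈ W, (nsq (-(d:ℤ)) (e x) : ℝ) := by
        rw [hW, Finset.sum_sigma]
        apply Finset.sum_congr rfl
        intro A hA
        rw [Finset.mul_sum]
        apply Finset.sum_congr rfl
        intro p hp
        have h2 := hPs A hA p hp
        simp only [he]
        rw [nsq_mul _ (hcop A hA p hp), nsq_prod _ _ (fun q hq => (h𝒜 q (hS A hA hq)).1)]
        push_cast
        rw [hchi p h2.1 (by omega)]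
        congr 1
        apply Finset.prod_congr rfl
        intro q hq
        have h1 := h𝒜 q (hS A hA hq)
        rw [hchi q h1.1 h1.2.1]
    _ = ∑ n ∈ W.image e, (nsq (-(d:ℤ)) n : ℝ) := (by rw [Finset.sum_image hinj])
    _ ≤ ∑ n ∈ Ng d P, (nsq (-(d:ℤ)) n : ℝ) := by
        apply Finset.sum_le_sum_of_subset_of_nonneg
        · intro n hn
          rw [Finset.mem_image] at hn
          obtain ⟨⟨A, p⟩, hx, rfl⟩ := hn
          rw [hW, Finset.mem_sigma] at hx
          have h2 := hPs A hx.1 p hx.2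
          simp only at hx h2
          have hAp : ∀ q ∈ A, q.Prime := fun q hq => (h𝒜 q (hS A hx.1 hq)).1
          rw [Ng, Finset.mem_filter, Finset.mem_Icc, gd]
          refine ⟨⟨?_, h2.2.2.2⟩, ?_, ?_⟩
          · exact Nat.mul_pos (Finset.prod_pos (fun q hq => (hAp q hq).pos)) h2.1.pos
          · rw [he, Nat.squarefree_mul_iff]
            exact ⟨hcop A hx.1 p hx.2, sqfree_prod A hAp, h2.1.squarefree⟩
          · apply Nat.Coprime.mul_left
            · apply Nat.Coprime.prod_left
              intro q hq
              have h1 := h𝒜 q (hS A hx.1 hq)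
              exact hpc q h1.1 h1.2.1 h1.2.2.2
            · exact hpc p h2.1 (by omega) h2.2.2.1
        · intros; positivity
    _ = _ := by rw [Mg]; push_cast; rfl

/-- Rankin trick: restricting the Euler product to small moduli. -/
lemma rankin (z : ℕ) (hz : 2 ≤ z) (𝒜 : Finset ℕ) (h𝒜 : 𝒜 ⊆ pr 0 z) (g : ℕ → ℝ) (hg0 : ∀ p, 0 ≤ g p) (hg2 : ∀ p, g p ≤ 2) :
    (1/2) * ∏ p ∈ 𝒜, (1 + g p / p) ≤ ∑ A ∈ 𝒜.powerset.filter (fun A => ∏ q ∈ A, q ≤ z^13), ∏ q ∈ A, (g q / q) := by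
  have hlz : 0 < Real.log z := Real.log_pos (by exact_mod_cast (by omega : 1 < z))
  have hpos : ∀ p ∈ 𝒜, (0:ℝ) < p := fun p hp => by
    have := mem_pr.1 (h𝒜 hp); exact_mod_cast this.1
  set u : ℕ → ℝ := fun p => Real.exp (Real.log p / Real.log z) with hu
  have htot : ∏ p ∈ 𝒜, (1 + g p / p) = ∑ A ∈ 𝒜.powerset.filter (fun A => ∏ q ∈ A, q ≤ z^13), ∏ q ∈ A, (g q / q)
      + ∑ A ∈ 𝒜.powerset.filter (fun A => ¬ ∏ q ∈ A, q ≤ z^13), ∏ q ∈ A, (g q / q) := by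
    rw [Finset.prod_one_add, Finset.sum_filter_add_sum_filter_not]
  have hB : ∏ p ∈ 𝒜, (1 + g p * u p / p) ≤ (∏ p ∈ 𝒜, (1 + g p / p)) * Real.exp 12 := by
    have h1 : ∏ p ∈ 𝒜, (1 + g p * u p / p) ≤ ∏ p ∈ 𝒜, ((1 + g p / p) * Real.exp (4 / Real.log z * (Real.log p / p))) := by
      apply Finset.prod_le_prod
      · intro p hp
        have := hpos p hp; have := hg0 p
        have : 0 < u p := Real.exp_pos _
        positivity
      · intro p hp
        have hp0 := hpos p hp
        have hp1 := mem_pr.1 (h𝒜 hp)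
        set t := Real.log p / Real.log z with ht
        have ht0 : 0 ≤ t := div_nonneg (Real.log_nonneg (by exact_mod_cast hp1.2.2.one_lt.le)) hlz.le
        have ht1 : t ≤ 1 := by
          rw [ht, div_le_one hlz]
          exact Real.log_le_log hp0 (by exact_mod_cast hp1.2.1)
        have hut : u p ≤ 1 + 2 * t := by
          have := Real.abs_exp_sub_one_sub_id_le (x := t) (by rw [abs_of_nonneg ht0]; exact ht1)
          have h2 := (abs_le.1 this).2
          simp only [hu]
          nlinarith
        have e1 : g p * u p / p ≤ g p / p + 4 * t / p := by
          rw [← add_div]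
          apply div_le_div_of_nonneg_right _ hp0.le
          have := hg0 p; have := hg2 p
          nlinarith
        have e2 : 4 / Real.log z * (Real.log p / p) = 4 * t / p := by rw [ht]; field_simp
        rw [e2]
        have e3 := Real.add_one_le_exp (4 * t / p)
        have e4 : 0 ≤ g p / p := div_nonneg (hg0 p) hp0.le
        have e5 : 0 ≤ 4 * t / p := by positivity
        nlinarith
    refine h1.trans ?_
    rw [Finset.prod_mul_distrib]
    have hP : 0 ≤ ∏ p ∈ 𝒜, (1 + g p / p) := Finset.prod_nonneg (fun p hp => by
      have := hpos p hp; have := hg0 p; positivity)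
    apply mul_le_mul_of_nonneg_left _ hP
    rw [← Real.exp_sum, Real.exp_le_exp, ← Finset.mul_sum]
    have h2 : ∑ p ∈ 𝒜, Real.log p / p ≤ ∑ p ∈ pr 0 z, Real.log p / p := by
      apply Finset.sum_le_sum_of_subset_of_nonneg h𝒜
      intro p hp _
      exact div_nonneg (Real.log_natCast_nonneg p) (Nat.cast_nonneg p)
    have h3 := mertens_one z (by omega)
    have h4 : Real.log 4 ≤ 2 * Real.log z := by
      have : Real.log 4 = 2 * Real.log 2 := by
        rw [show (4:ℝ) = 2^2 by norm_num, Real.log_pow]; norm_num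
      rw [this]
      have : Real.log 2 ≤ Real.log z := Real.log_le_log (by norm_num) (by exact_mod_cast hz)
      linarith
    calc 4 / Real.log z * ∑ p ∈ 𝒜, Real.log p / p ≤ 4 / Real.log z * (3 * Real.log z) := by
          gcongr; linarith
      _ = 12 := by field_simp; norm_num
  have hN : ∑ A ∈ 𝒜.powerset.filter (fun A => ¬ ∏ q ∈ A, q ≤ z^13), ∏ q ∈ A, (g q / q)
      ≤ Real.exp (-13) * ∏ p ∈ 𝒜, (1 + g p * u p / p) := by
    rw [Finset.prod_one_add, Finset.mul_sum]
    have hnn : ∀ A ∈ 𝒜.powerset, 0 ≤ Real.exp (-13) * ∏ q ∈ A, (g q * u q / q) := by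
      intro A hA
      rw [Finset.mem_powerset] at hA
      apply mul_nonneg (Real.exp_pos _).le
      apply Finset.prod_nonneg
      intro q hq
      have := hpos q (hA hq); have := hg0 q; have : 0 < u q := Real.exp_pos _
      positivity
    refine le_trans ?_ (Finset.sum_le_sum_of_subset_of_nonneg (Finset.filter_subset (fun A => ¬ ∏ q ∈ A, q ≤ z^13) _) (fun A hA _ => hnn A hA))
    apply Finset.sum_le_sum
    intro A hA
    rw [Finset.mem_filter, Finset.mem_powerset] at hA
    obtain ⟨hA, hm⟩ := hA
    push Not at hm
    have h1 : ∏ q ∈ A, (g q * u q / q) = (∏ q ∈ A, (g q / q)) * ∏ q ∈ A, u q := by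
      rw [← Finset.prod_mul_distrib]
      apply Finset.prod_congr rfl
      intro q hq; ring
    have h2 : Real.exp 13 ≤ ∏ q ∈ A, u q := by
      simp only [hu]
      rw [← Real.exp_sum, Real.exp_le_exp, ← Finset.sum_div, le_div_iff₀ hlz, ← Real.log_prod (fun q hq => (hpos q (hA hq)).ne')]
      have : (13:ℝ) * Real.log z = Real.log ((z:ℝ)^13) := by rw [Real.log_pow]; norm_num
      rw [this]
      apply Real.log_le_log (by positivity)
      have e := (Nat.cast_le (α := ℝ)).2 hm.le
      rw [Nat.cast_prod, Nat.cast_pow] at e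
      exact e
    rw [h1]
    have h3 : 0 ≤ ∏ q ∈ A, (g q / q) := Finset.prod_nonneg (fun q hq => div_nonneg (hg0 q) (hpos q (hA hq)).le)
    have h4 : 1 ≤ Real.exp (-13) * ∏ q ∈ A, u q := by
      rw [Real.exp_neg]
      rw [inv_mul_eq_div, le_div_iff₀ (Real.exp_pos _)]
      linarith
    calc ∏ q ∈ A, (g q / q) = (∏ q ∈ A, (g q / q)) * 1 := by ring
      _ ≤ (∏ q ∈ A, (g q / q)) * (Real.exp (-13) * ∏ q ∈ A, u q) := by gcongr
      _ = _ := by ring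
  have hP : 0 ≤ ∏ p ∈ 𝒜, (1 + g p / p) := Finset.prod_nonneg (fun p hp => by
      have := hpos p hp; have := hg0 p; positivity)
  have h5 : Real.exp (-13) * ∏ p ∈ 𝒜, (1 + g p * u p / p) ≤ (1/2) * ∏ p ∈ 𝒜, (1 + g p / p) := by
    calc _ ≤ Real.exp (-13) * ((∏ p ∈ 𝒜, (1 + g p / p)) * Real.exp 12) := by gcongr
      _ = Real.exp (-1) * ∏ p ∈ 𝒜, (1 + g p / p) := by
          rw [show (-1:ℝ) = -13 + 12 by norm_num, Real.exp_add]; ring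
      _ ≤ _ := by
          apply mul_le_mul_of_nonneg_right _ hP
          rw [Real.exp_neg, one_div]
          apply inv_anti₀ (by norm_num)
          have := Real.add_one_le_exp (1:ℝ); linarith
  linarith

lemma exp_sub_sq_le {x : ℝ} (hx : 0 ≤ x) : Real.exp (x - x^2) ≤ 1 + x := by
  have h := Real.one_sub_le_exp_neg (x - x^2)
  have h1 : 0 < 1 - (x - x^2) := by nlinarith [sq_nonneg (x - 1/2)]
  rw [Real.exp_neg] at h
  have h2 := (le_inv_comm₀ h1 (Real.exp_pos _)).1 h
  refine h2.trans ?_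
  rw [inv_le_iff_one_le_mul₀ h1]
  have : 0 ≤ x^3 := by positivity
  nlinarith

lemma prod_ge (z d : ℕ) :
    Real.exp (rp (2^(idx z d)) z - 6) ≤ ∏ p ∈ (pr (2^(idx z d)) z).filter (fun p => ¬ p ∣ d), (1 + (1 + chi d p) / p) := by
  set w := 2^(idx z d) with hw
  have hw2 : 2 ≤ w := by
    calc 2 = 2^1 := rfl
      _ ≤ _ := Nat.pow_le_pow_right (by norm_num) (idx_pos z d)
  have hgood := idx_good z d
  rw [badd, not_or, not_not, not_not, ← hw] at hgood
  have hc0 : ∀ p, 0 ≤ 1 + chi d p := fun p => by have := abs_le.1 (chi_abs d p); linarith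
  have hc2 : ∀ p, 1 + chi d p ≤ 2 := fun p => by have := abs_le.1 (chi_abs d p); linarith
  calc Real.exp (rp w z - 6) ≤ Real.exp (∑ p ∈ (pr w z).filter (fun p => ¬ p ∣ d), ((1 + chi d p) / p - ((1 + chi d p) / p)^2)) := by
        rw [Real.exp_le_exp, Finset.sum_sub_distrib]
        have h1 : ∑ p ∈ (pr w z).filter (fun p => ¬ p ∣ d), ((1 + chi d p) / (p:ℝ))^2 ≤ 3 := by
          calc _ ≤ ∑ p ∈ pr w z, ((1 + chi d p) / (p:ℝ))^2 := 
                Finset.sum_le_sum_of_subset_of_nonneg (Finset.filter_subset _ _) (fun _ _ _ => by positivity)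
            _ ≤ ∑ p ∈ pr w z, 4 * (1 / (p:ℝ)^2) := by
                apply Finset.sum_le_sum
                intro p hp
                rw [div_pow, mul_one_div]
                apply div_le_div_of_nonneg_right _ (by positivity)
                have := hc0 p; have := hc2 p
                nlinarith
            _ = 4 * ∑ p ∈ pr w z, 1 / (p:ℝ)^2 := by rw [Finset.mul_sum]
            _ ≤ 4 * (2 / ((w:ℝ) + 1)) := by
                have := sum_inv_sq_pr_le w z
                gcongr
            _ ≤ 4 * (2 / ((2:ℝ) + 1)) := by
                have : (2:ℝ) ≤ w := by exact_mod_cast hw2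
                gcongr
            _ ≤ 3 := by norm_num
        have h2 : ∑ p ∈ pr w z, (1 + chi d p) / (p:ℝ) = rp w z + ∑ p ∈ pr w z, chi d p / p := by
          rw [rp, ← Finset.sum_add_distrib]
          apply Finset.sum_congr rfl
          intro p _; rw [add_div]
        have h3 := Finset.sum_filter_add_sum_filter_not (pr w z) (fun p => p ∣ d) (fun p => (1 + chi d p) / (p:ℝ))
        have h4 : ∑ p ∈ (pr w z).filter (fun p => p ∣ d), (1 + chi d p) / (p:ℝ) ≤ 2 * ∑ p ∈ (pr w z).filter (fun p => p ∣ d), (1:ℝ) / p := by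
          rw [Finset.mul_sum]
          apply Finset.sum_le_sum
          intro p _
          rw [mul_one_div]
          exact div_le_div_of_nonneg_right (hc2 p) (Nat.cast_nonneg p)
        have h5 := (abs_le.1 hgood.1).1
        have h6 := hgood.2
        linarith
    _ = ∏ p ∈ (pr w z).filter (fun p => ¬ p ∣ d), Real.exp ((1 + chi d p) / p - ((1 + chi d p) / p)^2) := Real.exp_sum _ _
    _ ≤ _ := by
        apply Finset.prod_le_prod (fun _ _ => (Real.exp_pos _).le)
        intro p _
        exact exp_sub_sq_le (div_nonneg (hc0 p) (Nat.cast_nonneg p))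

lemma exp_rp_idx : ∃ c : ℝ, 0 < c ∧ ∀ z d : ℕ, 2 ≤ z → c * Real.log z ≤ Real.exp (rp (2^(idx z d)) z) * idx z d := by
  obtain ⟨C1, hC1, h1⟩ := mertens_lower
  obtain ⟨C2, hC2, h2⟩ := exp_rp_le
  refine ⟨Real.exp (-C1) / C2, by positivity, ?_⟩
  intro z d hz
  have hlz : 0 < Real.log z := Real.log_pos (by exact_mod_cast (by omega : 1 < z))
  have h3 : Real.exp (-C1) * Real.log z ≤ Real.exp (rp 0 z) := by
    have := Real.exp_le_exp.2 (h1 z hz)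
    rw [Real.exp_log hlz, Real.exp_add] at this
    rw [Real.exp_neg, inv_mul_le_iff₀ (Real.exp_pos _)]
    linarith
  have h4 : rp 0 z ≤ rp 0 (2^(idx z d)) + rp (2^(idx z d)) z := by
    rcases le_total (2^(idx z d)) z with h | h
    · exact (rp_split (Nat.zero_le _) h).le
    · have e1 := rp_mono (a := 0) h
      have e2 := rp_nonneg (2^(idx z d)) z
      linarith
  have h5 := h2 (idx z d) (idx_pos z d)
  rw [div_mul_eq_mul_div, div_le_iff₀ (by positivity)]
  calc _ ≤ _ := h3
    _ ≤ Real.exp (rp 0 (2^(idx z d))) * Real.exp (rp (2^(idx z d)) z) := by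
        rw [← Real.exp_add, Real.exp_le_exp]; exact h4
    _ ≤ (C2 * idx z d) * Real.exp (rp (2^(idx z d)) z) := by gcongr
    _ = _ := by ring

lemma card_dvd_le (z d K a b : ℕ) (hz : 2 ≤ z) (hza : z ≤ a) (hd0 : 0 < d) (hd : d < z^(K+1)) :
    ((pr a b).filter (fun p => p ∣ d)).card ≤ K := by
  set T := (pr a b).filter (fun p => p ∣ d) with hT
  have h1 : ∏ p ∈ T, p ∣ d := by
    apply Finset.prod_primes_dvd
    · intro p hp
      rw [hT, Finset.mem_filter, mem_pr] at hp
      exact hp.1.2.2.prime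
    · intro p hp
      exact (Finset.mem_filter.1 hp).2
  have h2 : z^T.card ≤ ∏ p ∈ T, p := by
    apply Finset.pow_card_le_prod
    intro p hp
    rw [hT, Finset.mem_filter, mem_pr] at hp
    omega
  have h3 := Nat.le_of_dvd hd0 h1
  have h4 : z^T.card < z^(K+1) := by omega
  have := (Nat.pow_lt_pow_iff_right (by omega : 1 < z)).1 h4
  omega

/-- inner prime sum -/
lemma innerPrimeSum (k : ℕ) : ∃ c : ℝ, 0 < c ∧ ∃ z0 : ℕ, ∀ z d x : ℕ, z0 ≤ z → 0 < d → d < z^(k+1) → 4 * z ≤ x → x ≤ z^(k+1) → 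
    (-(1/2) * ((pr (x/4) x).card : ℝ) < ∑ p ∈ pr (x/4) x, chi d p) →
    c * (x / Real.log z) ≤ ∑ p ∈ (pr (x/4) x).filter (fun p => ¬ p ∣ d), (1 + chi d p) := by
  obtain ⟨c, hc, x0, h⟩ := cheb_lower
  refine ⟨c / (4 * (k+1)), by positivity, max (max 2 x0) (⌈(16 * (k:ℝ) / c)^2⌉₊ + 1), ?_⟩
  intro z d x hz hd0 hd hx hxk hE
  have hz2 : 2 ≤ z := le_trans (le_max_left _ _) ((le_max_left _ _).trans hz)
  have hzx0 : x0 ≤ z := le_trans (le_max_right _ _) ((le_max_left _ _).trans hz)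
  have hz3 : (16 * (k:ℝ) / c)^2 ≤ z := by
    have h1 : ⌈(16 * (k:ℝ) / c)^2⌉₊ ≤ z := by
      have := (le_max_right (max 2 x0) _).trans hz; omega
    exact Nat.ceil_le.1 h1
  have hlz : 0 < Real.log z := Real.log_pos (by exact_mod_cast (by omega : 1 < z))
  have hlx : 0 < Real.log x := Real.log_pos (by exact_mod_cast (by omega : 1 < x))
  have hc0 : ∀ p, 0 ≤ 1 + chi d p := fun p => by have := abs_le.1 (chi_abs d p); linarith
  have hc2 : ∀ p, 1 + chi d p ≤ 2 := fun p => by have := abs_le.1 (chi_abs d p); linarith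
  have h1 := h x (by omega)
  have h2 := card_dvd_le z d k (x/4) x hz2 (by omega) hd0 hd
  have h3 : ∑ p ∈ (pr (x/4) x).filter (fun p => p ∣ d), (1 + chi d p) ≤ 2 * k := by
    calc _ ≤ ∑ p ∈ (pr (x/4) x).filter (fun p => p ∣ d), (2:ℝ) := Finset.sum_le_sum (fun p _ => hc2 p)
      _ = 2 * (((pr (x/4) x).filter (fun p => p ∣ d)).card : ℝ) := by rw [Finset.sum_const, nsmul_eq_mul]; ring
      _ ≤ _ := by gcongr
  have h4 := Finset.sum_filter_add_sum_filter_not (pr (x/4) x) (fun p => p ∣ d) (fun p => (1 + chi d p))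
  have h5 : ∑ p ∈ pr (x/4) x, (1 + chi d p) = ((pr (x/4) x).card : ℝ) + ∑ p ∈ pr (x/4) x, chi d p := by
    rw [Finset.sum_add_distrib]; simp
  set N : ℝ := ((pr (x/4) x).card : ℝ) with hN
  have hx0 : (0:ℝ) < x := by exact_mod_cast (by omega : 0 < x)
  have h6 : 8 * (k:ℝ) ≤ N := by
    have e1 : Real.log x ≤ 2 * Real.sqrt x := by
      have : Real.log x = 2 * Real.log (Real.sqrt x) := by rw [Real.log_sqrt hx0.le]; ring
      rw [this]
      have := Real.log_le_sub_one_of_pos (Real.sqrt_pos.2 hx0)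
      linarith
    have e2 : 16 * (k:ℝ) / c ≤ Real.sqrt x := by
      apply Real.le_sqrt_of_sq_le
      refine hz3.trans ?_
      exact_mod_cast (by omega : z ≤ x)
    have e3 : 16 * (k:ℝ) ≤ c * Real.sqrt x := by
      rw [div_le_iff₀ hc] at e2; linarith
    refine le_trans ?_ h1
    rw [le_div_iff₀ hlx]
    have e4 := Real.mul_self_sqrt hx0.le
    calc 8 * (k:ℝ) * Real.log x ≤ 8 * (k:ℝ) * (2 * Real.sqrt x) := by gcongr
      _ = 16 * k * Real.sqrt x := by ring
      _ ≤ c * Real.sqrt x * Real.sqrt x := by gcongr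
      _ = c * x := by rw [mul_assoc, e4]
  have h7 : c / (k+1) * (x / Real.log z) ≤ N := by
    refine le_trans ?_ h1
    have e1 : Real.log x ≤ (k+1) * Real.log z := by
      calc Real.log x ≤ Real.log ((z:ℝ)^(k+1)) := Real.log_le_log hx0 (by exact_mod_cast hxk)
        _ = _ := by rw [Real.log_pow]; push_cast; ring
    calc c / (k+1) * (x / Real.log z) = c * x / ((k+1) * Real.log z) := by field_simp
      _ ≤ _ := by gcongr
  have h8 : c / (4 * (k+1)) * (x / Real.log z) = 1/4 * (c / (k+1) * (x / Real.log z)) := by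
    field_simp
  rw [h8]
  linarith

lemma G2_arith {c1 c2 e6 L P i R S1 P1 M : ℝ} (hL : 0 < L) (h0 : 0 ≤ c1 / 2 * (P / L)) (he : 0 ≤ e6) (hi : 0 ≤ i)
    (h1 : c2 * L ≤ R * i) (h2 : R * e6 ≤ P1) (h3 : (1/2) * P1 ≤ S1) (h4 : c1 / 2 * (P / L) * S1 ≤ M) :
    c1 / 2 * (1/2) * (e6 * c2) * P ≤ M * i := by
  calc c1 / 2 * (1/2) * (e6 * c2) * P = c1 / 2 * (P / L) * ((1/2) * (e6 * (c2 * L))) := by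
        field_simp
    _ ≤ c1 / 2 * (P / L) * ((1/2) * (e6 * (R * i))) := by gcongr
    _ = c1 / 2 * (P / L) * ((1/2) * (R * e6)) * i := by ring
    _ ≤ c1 / 2 * (P / L) * ((1/2) * P1) * i := by gcongr
    _ ≤ c1 / 2 * (P / L) * S1 * i := by gcongr
    _ ≤ _ := by gcongr

theorem G2 (k : ℕ) : ∃ c : ℝ, 0 < c ∧ ∃ z0 : ℕ, 2 ≤ z0 ∧ ∀ z X d P : ℕ, z0 ≤ z → X ≤ z^k → 0 < d → d < 2 * X → P ≤ X → z^16 ≤ P →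
    (∀ j : ℕ, 4 * z ≤ 2^j → 2^j ≤ X → 
      -(1/2) * ((pr (2^j/4) (2^j)).card : ℝ) < ∑ p ∈ pr (2^j/4) (2^j), chi d p) →
    c * P ≤ (Mg d P : ℝ) * idx z d := by
  obtain ⟨c1, hc1, z1, h1⟩ := innerPrimeSum k
  obtain ⟨c2, hc2, h2⟩ := exp_rp_idx
  refine ⟨c1 / 2 * (1/2) * (Real.exp (-6) * c2), by positivity, max z1 4, le_max_of_le_right (by norm_num), ?_⟩
  intro z X d P hz hXk hd0 hdX hPX hzP hE
  have hz1 : z1 ≤ z := (le_max_left _ _).trans hz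
  have hz4 : 4 ≤ z := (le_max_right _ _).trans hz
  have hlz : 0 < Real.log z := Real.log_pos (by exact_mod_cast (by omega : 1 < z))
  have hX : X * 2 ≤ z^(k+1) := by
    rw [pow_succ]; exact Nat.mul_le_mul hXk (by omega)
  have hc0 : ∀ p, 0 ≤ 1 + chi d p := fun p => by have := abs_le.1 (chi_abs d p); linarith
  have hcc2 : ∀ p, 1 + chi d p ≤ 2 := fun p => by have := abs_le.1 (chi_abs d p); linarith
  set w := 2^(idx z d) with hw
  have hw2 : 2 ≤ w := by
    calc 2 = 2^1 := rfl
      _ ≤ _ := Nat.pow_le_pow_right (by norm_num) (idx_pos z d)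
  set 𝒜 := (pr w z).filter (fun p => ¬ p ∣ d) with h𝒜
  set S := 𝒜.powerset.filter (fun A => ∏ q ∈ A, q ≤ z^13) with hS
  set xx : Finset ℕ → ℕ := fun A => 2^(Nat.log 2 (P / ∏ q ∈ A, q)) with hxx
  set Ps : Finset ℕ → Finset ℕ := fun A => (pr (xx A / 4) (xx A)).filter (fun p => ¬ p ∣ d) with hPs
  have hAp : ∀ p ∈ 𝒜, p.Prime ∧ p ≠ 2 ∧ p ≤ z ∧ ¬ p ∣ d := by
    intro p hp
    rw [h𝒜, Finset.mem_filter, mem_pr] at hp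
    exact ⟨hp.1.2.2, by omega, hp.1.2.1, hp.2⟩
  have hSm : ∀ A ∈ S, A ⊆ 𝒜 ∧ 0 < ∏ q ∈ A, q ∧ ∏ q ∈ A, q ≤ z^13 := by
    intro A hA
    rw [hS, Finset.mem_filter, Finset.mem_powerset] at hA
    exact ⟨hA.1, Finset.prod_pos (fun q hq => (hAp q (hA.1 hq)).1.pos), hA.2⟩
  have hx : ∀ A ∈ S, 4 * z ≤ xx A ∧ (∏ q ∈ A, q) * xx A ≤ P ∧ P ≤ 2 * ((∏ q ∈ A, q) * xx A) := by
    intro A hA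
    obtain ⟨_, hm0, hm⟩ := hSm A hA
    set m := ∏ q ∈ A, q with hmdef
    have e1 : z^3 ≤ P / m := by
      rw [Nat.le_div_iff_mul_le hm0]
      calc z^3 * m ≤ z^3 * z^13 := Nat.mul_le_mul_left _ hm
        _ = z^16 := by ring
        _ ≤ P := hzP
    have e0 : P / m ≠ 0 := by
      have : 0 < z^3 := by positivity
      omega
    have e2 : xx A ≤ P / m := Nat.pow_log_le_self 2 e0
    have e3 : P / m < 2 * xx A := by
      have := Nat.lt_pow_succ_log_self (b := 2) (by norm_num) (P / m)
      simp only [hxx, ← hmdef]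
      rw [pow_succ] at this; omega
    refine ⟨?_, ?_, ?_⟩
    · have : 16 * z ≤ z^3 := by nlinarith [Nat.mul_le_mul hz4 hz4]
      omega
    · calc m * xx A ≤ m * (P / m) := Nat.mul_le_mul_left _ e2
        _ ≤ P := Nat.mul_div_le _ _
    · have := (Nat.div_lt_iff_lt_mul hm0).1 e3
      nlinarith
  have hM := Mg_ge d z P 𝒜 hAp S (fun A hA => (hSm A hA).1) Ps (by omega) (by
    intro A hA p hp
    simp only [hPs] at hp
    rw [Finset.mem_filter, mem_pr] at hp
    obtain ⟨⟨hp1, hp2, hp3⟩, hp4⟩ := hp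
    have := hx A hA
    refine ⟨hp3, by omega, hp4, le_trans (Nat.mul_le_mul_left _ hp2) this.2.1⟩)
  have hinner : ∀ A ∈ S, c1 * (P / (2 * (∏ q ∈ A, (q:ℝ)) * Real.log z)) ≤ ∑ p ∈ Ps A, (1 + chi d p) := by
    intro A hA
    obtain ⟨hx1, hx2, hx3⟩ := hx A hA
    obtain ⟨_, hm0, hm⟩ := hSm A hA
    have hxP : xx A ≤ P := le_trans (Nat.le_mul_of_pos_left _ hm0) hx2
    have := h1 z d (xx A) hz1 hd0 (by omega) hx1 (by omega) (hE _ hx1 (by simp only [hxx] at hxP; omega))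
    refine le_trans ?_ this
    apply mul_le_mul_of_nonneg_left _ hc1.le
    rw [← Nat.cast_prod]
    have hm0' : (0:ℝ) < ((∏ q ∈ A, q : ℕ):ℝ) := by exact_mod_cast hm0
    rw [div_le_div_iff₀ (by positivity) hlz]
    have e : (P:ℝ) ≤ 2 * (((∏ q ∈ A, q : ℕ):ℝ) * xx A) := by exact_mod_cast hx3
    calc (P:ℝ) * Real.log z ≤ 2 * (((∏ q ∈ A, q : ℕ):ℝ) * xx A) * Real.log z := by gcongr
      _ = _ := by ring
  have hsum : c1 / 2 * (P / Real.log z) * ∑ A ∈ S, ∏ q ∈ A, ((1 + chi d q) / q) ≤ (Mg d P : ℝ) := by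
    refine le_trans ?_ hM
    rw [Finset.mul_sum]
    apply Finset.sum_le_sum
    intro A hA
    have e1 : 0 ≤ ∏ q ∈ A, (1 + chi d q) := Finset.prod_nonneg (fun q _ => hc0 q)
    calc c1 / 2 * (P / Real.log z) * ∏ q ∈ A, ((1 + chi d q) / q) 
        = (∏ q ∈ A, (1 + chi d q)) * (c1 * (P / (2 * (∏ q ∈ A, (q:ℝ)) * Real.log z))) := by
          rw [Finset.prod_div_distrib]
          ring
      _ ≤ _ := mul_le_mul_of_nonneg_left (hinner A hA) e1
  have hr := rankin z (by omega) 𝒜 (by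
    intro p hp
    rw [h𝒜, Finset.mem_filter, mem_pr] at hp
    rw [mem_pr]
    exact ⟨hp.1.2.2.pos, hp.1.2.1, hp.1.2.2⟩) (fun p => 1 + chi d p) hc0 hcc2
  have hp := prod_ge z d
  have hi := h2 z d (by omega)
  have hidx : (0:ℝ) ≤ idx z d := Nat.cast_nonneg _
  have hPl : 0 ≤ c1 / 2 * ((P:ℝ) / Real.log z) := by positivity
  rw [sub_eq_add_neg, Real.exp_add] at hp
  exact G2_arith hlz hPl (Real.exp_pos _).le hidx hi hp hr hsum

lemma G3_arith {T M S h A P i c : ℝ} (hc : 0 < c) (hP : 0 < P) (hi : 1 ≤ i) (hM : 0 ≤ M) (hA : 0 ≤ A) (hT : 0 ≤ T)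
    (h1 : T * M^2 ≤ h * (M + S)) (h2 : h ≤ A * i) (h3 : c * P ≤ M * i) (h4 : S ≤ P) (hS : 0 ≤ S) :
    T ≤ A * (1/c + 1/c^2) * i^3 / P := by
  have hi0 : 0 < i := by linarith
  have hM0 : 0 < M := by
    rcases hM.lt_or_eq with h | h
    · exact h
    · rw [← h] at h3; nlinarith [mul_pos hc hP]
  have e1 : T ≤ h * (M + S) / M^2 := by rw [le_div_iff₀ (by positivity)]; exact h1
  have e2 : 1 / M ≤ i / (c * P) := by
    rw [div_le_div_iff₀ hM0 (by positivity)]; linarith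
  have e3 : (M + S) / M^2 = 1 / M + S * (1/M)^2 := by field_simp
  have e4 : (M + S) / M^2 ≤ i / (c * P) + P * (i / (c*P))^2 := by
    rw [e3]; gcongr
  have e5 : i / (c * P) + P * (i / (c*P))^2 ≤ (1/c + 1/c^2) * i^2 / P := by
    have : (1/c + 1/c^2) * i^2 / P = i^2 / (c * P) + P * (i / (c*P))^2 := by field_simp
    rw [this]
    have : i ≤ i^2 := by nlinarith
    gcongr
  calc T ≤ h * ((M + S) / M^2) := by rw [← mul_div_assoc]; exact e1
    _ ≤ (A * i) * ((1/c + 1/c^2) * i^2 / P) := by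
        apply mul_le_mul h2 (e4.trans e5) (by positivity) (by positivity)
    _ = _ := by ring

theorem G3 (ℓ k : ℕ) (hℓ : ℓ ≠ 0) : ∃ C : ℝ, 0 ≤ C ∧ ∃ z0 : ℕ, 2 ≤ z0 ∧ ∀ z X d P : ℕ, z0 ≤ z → z^5 ≤ X → X ≤ z^k → X ≤ d → d < 2 * X → 
    Squarefree d → P ≤ X → z^16 ≤ P →
    (∀ j : ℕ, 4 * z ≤ 2^j → 2^j ≤ X → 
      -(1/2) * ((pr (2^j/4) (2^j)).card : ℝ) < ∑ p ∈ pr (2^j/4) (2^j), chi d p) →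
    Sg d ℓ P ≤ P → 
    (clTor (Qneg d) ℓ : ℝ) ≤ C * Real.sqrt X * (idx z d : ℝ)^3 / P := by
  obtain ⟨C1, hC1, h1⟩ := G1 k
  obtain ⟨c, hc, z0, hz0, h2⟩ := G2 k
  refine ⟨C1 * (1/c + 1/c^2), by positivity, z0, hz0, ?_⟩
  intro z X d P hz hzX hXk hXd hdX hd hPX hzP hE hS
  have hd0 : 0 < d := Nat.pos_of_ne_zero hd.ne_zero
  have g1 := h1 z X d (by omega) hzX hXk hXd hdX hd
  have g2 := h2 z X d P hz hXk hd0 hdX hPX hzP hE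
  have g3 := (QRi d hd).main_ineq hd0 hℓ P
  have g3' : (clTor (Qneg d) ℓ : ℝ) * (Mg d P : ℝ)^2 ≤ (hcl d : ℝ) * ((Mg d P : ℝ) + (Sg d ℓ P : ℝ)) := by
    unfold clTor hcl
    exact_mod_cast g3
  have hP0 : 0 < P := lt_of_lt_of_le (by have : 0 < z := by omega
                                         positivity) hzP
  have := G3_arith hc (by exact_mod_cast hP0) (by exact_mod_cast idx_pos z d) (Nat.cast_nonneg _) (by positivity) (Nat.cast_nonneg _) g3' g1 g2 (by exact_mod_cast hS) (Nat.cast_nonneg _)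
  refine this.trans (le_of_eq ?_)
  ring

/-- Parameters -/
def zz (ℓ i : ℕ) : ℕ := 2^(i/(40*ℓ))
def ea (ℓ i : ℕ) : ℕ := (i-3)/(2*ℓ)
def eb (ℓ i : ℕ) : ℕ := 3*i/(2*(ℓ+1))

lemma zz_pow (ℓ i n : ℕ) : (zz ℓ i)^n = 2^(i/(40*ℓ)*n) := by rw [zz, ← pow_mul]

lemma zz_facts (ℓ i : ℕ) (hℓ : 5 ≤ ℓ) (hi : 1000 * ℓ ≤ i) : 
    (zz ℓ i)^5 ≤ 2^i ∧ 2^i ≤ (zz ℓ i)^(80*ℓ) ∧ (zz ℓ i)^16 ≤ 2^(ea ℓ i) ∧ ea ℓ i ≤ eb ℓ i ∧ eb ℓ i ≤ i ∧ i/(40*ℓ) ≤ zz ℓ i 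
    ∧ 2 + ea ℓ i * (2*ℓ) < i ∧ 2 ≤ zz ℓ i := by
  set b := i/(40*ℓ) with hb
  have h1 : b * (40*ℓ) ≤ i := Nat.div_mul_le_self _ _
  have h2 : i < (b+1) * (40*ℓ) := (Nat.div_lt_iff_lt_mul (by omega)).1 (Nat.lt_succ_self b)
  have hb1 : 25 ≤ b := by rw [hb, Nat.le_div_iff_mul_le (by omega)]; omega
  set a := ea ℓ i with ha
  have h3 : a * (2*ℓ) ≤ i - 3 := Nat.div_mul_le_self _ _
  have h4 : 16 * b ≤ a := by
    rw [ha, ea, Nat.le_div_iff_mul_le (by omega)]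
    have : 8 * b * ℓ ≥ 200 * ℓ := by nlinarith
    have e : 16 * b * (2*ℓ) + 8 * b * ℓ = b * (40*ℓ) := by ring
    omega
  refine ⟨?_, ?_, ?_, ?_, ?_, ?_, ?_, ?_⟩
  · rw [zz_pow]; apply Nat.pow_le_pow_right (by norm_num)
    rw [← hb]; nlinarith
  · rw [zz_pow]; apply Nat.pow_le_pow_right (by norm_num)
    rw [← hb]; nlinarith
  · rw [zz_pow]; apply Nat.pow_le_pow_right (by norm_num)
    rw [← hb]; omega
  · rw [eb, Nat.le_div_iff_mul_le (by omega)]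
    have : a * (2 * (ℓ+1)) ≤ 2 * (a * (2*ℓ)) := by nlinarith
    omega
  · rw [eb]
    apply Nat.div_le_of_le_mul
    nlinarith
  · rw [zz, ← hb]; exact Nat.lt_two_pow_self.le
  · omega
  · rw [zz, ← hb]
    calc 2 = 2^1 := rfl
      _ ≤ _ := Nat.pow_le_pow_right (by norm_num) (by omega)

/-- exceptional predicate -/
def exc (z X d : ℕ) : Prop := ∃ j : ℕ, 4 * z ≤ 2^j ∧ 2^j ≤ X ∧ ∑ p ∈ pr (2^j/4) (2^j), chi d p ≤ -(1/2) * ((pr (2^j/4) (2^j)).card : ℝ)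

theorem H1 (ℓ : ℕ) (hℓ : 5 ≤ ℓ) : ∃ C : ℝ, 0 ≤ C ∧ ∃ i0 : ℕ, 1000 * ℓ ≤ i0 ∧ ∀ i : ℕ, i0 ≤ i → ∀ d : ℕ, 2^i ≤ d → d < 2 * 2^i → Squarefree d →
    ¬ exc (zz ℓ i) (2^i) d → 
    (clTor (Qneg d) ℓ : ℝ)^2 ≤ C * 2^i * (idx (zz ℓ i) d : ℝ)^6 * 
      (1/4^(eb ℓ i) + 4 * ∑ b ∈ Finset.Ioc (ea ℓ i) (eb ℓ i), if 2^b ≤ Sg d ℓ (2^b) then (1:ℝ)/4^b else 0) := by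
  obtain ⟨C, hC, z0, hz0, h⟩ := G3 ℓ (80*ℓ) (by omega)
  refine ⟨C^2, by positivity, max (1000*ℓ) (z0 * (40*ℓ)), le_max_left _ _, ?_⟩
  intro i hi d hd1 hd2 hd hexc
  obtain ⟨f1, f2, f3, f4, f5, f6, f7, f8⟩ := zz_facts ℓ i hℓ ((le_max_left _ _).trans hi)
  have hz : z0 ≤ zz ℓ i := by
    refine le_trans ?_ f6
    rw [Nat.le_div_iff_mul_le (by omega)]
    exact (le_max_right _ _).trans hi
  have hE : ∀ j : ℕ, 4 * (zz ℓ i) ≤ 2^j → 2^j ≤ 2^i → 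
      -(1/2) * ((pr (2^j/4) (2^j)).card : ℝ) < ∑ p ∈ pr (2^j/4) (2^j), chi d p := by
    intro j h1 h2
    by_contra hcon
    push Not at hcon
    exact hexc ⟨j, h1, h2, hcon⟩
  set D : ℝ := C^2 * 2^i * (idx (zz ℓ i) d : ℝ)^6 with hD
  have hD0 : 0 ≤ D := by positivity
  have key : ∀ a : ℕ, ea ℓ i ≤ a → a ≤ eb ℓ i → Sg d ℓ (2^a) ≤ 2^a → (clTor (Qneg d) ℓ : ℝ)^2 ≤ D * (1/4^a) := by
    intro a h1 h2 h3
    have g := h (zz ℓ i) (2^i) d (2^a) hz f1 f2 hd1 hd2 hd (Nat.pow_le_pow_right (by norm_num) (by omega))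
      (f3.trans (Nat.pow_le_pow_right (by norm_num) h1)) hE h3
    have g2 := pow_le_pow_left₀ (Nat.cast_nonneg _) g 2
    refine g2.trans (le_of_eq ?_)
    rw [hD, div_pow, mul_pow, mul_pow, Real.sq_sqrt (by positivity)]
    push_cast
    rw [← pow_mul, ← pow_mul, Nat.mul_comm a 2, pow_mul (2:ℝ) 2 a]
    norm_num
    ring
  have main : ∀ n : ℕ, ea ℓ i ≤ n → n ≤ eb ℓ i → (clTor (Qneg d) ℓ : ℝ)^2 ≤ D * 
      (1/4^n + 4 * ∑ b ∈ Finset.Ioc (ea ℓ i) n, if 2^b ≤ Sg d ℓ (2^b) then (1:ℝ)/4^b else 0) := by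
    intro n hn
    induction n, hn using Nat.le_induction with
    | base =>
      intro h1
      rw [Finset.Ioc_self, Finset.sum_empty, mul_zero, add_zero]
      apply key _ le_rfl h1
      rw [Sg_zero]
      · positivity
      · refine lt_of_lt_of_le ?_ hd1
        rw [← pow_mul, show 4 = 2^2 by norm_num, ← pow_add]
        exact Nat.pow_lt_pow_right (by norm_num) f7
    | succ n hn ih =>
      intro h1
      have hsplit : Finset.Ioc (ea ℓ i) (n+1) = insert (n+1) (Finset.Ioc (ea ℓ i) n) := by
        ext x; simp only [Finset.mem_Ioc, Finset.mem_insert]; omega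
      rw [hsplit, Finset.sum_insert (by simp)]
      have hnn : 0 ≤ ∑ b ∈ Finset.Ioc (ea ℓ i) n, if 2^b ≤ Sg d ℓ (2^b) then (1:ℝ)/4^b else 0 :=
        Finset.sum_nonneg (fun b _ => by split_ifs <;> positivity)
      by_cases hS : 2^(n+1) ≤ Sg d ℓ (2^(n+1))
      · rw [if_pos hS]
        refine (ih (by omega)).trans ?_
        apply mul_le_mul_of_nonneg_left _ hD0
        have e : (1:ℝ)/4^n = 4 * (1/4^(n+1)) := by rw [pow_succ]; field_simp
        have : (0:ℝ) ≤ 1/4^(n+1) := by positivity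
        rw [e]; linarith
      · rw [if_neg hS, zero_add]
        refine (key (n+1) (by omega) h1 (by omega)).trans ?_
        apply mul_le_mul_of_nonneg_left _ hD0
        linarith
  exact main _ f4 le_rfl

lemma poly_exp (K : ℕ) (δ : ℝ) (hδ : 0 < δ) : ∃ C : ℝ, 0 ≤ C ∧ ∀ i : ℕ, (i:ℝ)^K ≤ C * (2:ℝ)^(δ * i) := by
  have hr : 1 < (2:ℝ)^δ := Real.one_lt_rpow (by norm_num) hδ
  obtain ⟨C, hC⟩ := (tendsto_pow_const_div_const_pow_of_one_lt K hr).bddAbove_range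
  refine ⟨max C 0, le_max_right _ _, ?_⟩
  intro i
  have h := hC (Set.mem_range_self i)
  have h0 : 0 < ((2:ℝ)^δ)^i := by positivity
  change (i:ℝ)^K / ((2:ℝ)^δ)^i ≤ C at h
  rw [div_le_iff₀ h0] at h
  rw [Real.rpow_mul (by norm_num), Real.rpow_natCast]
  refine h.trans ?_
  gcongr
  exact le_max_left _ _

noncomputable def blk (i : ℕ) : Finset ℕ := Finset.Ico (2^i) (2*2^i)

noncomputable def Bb (ℓ i b : ℕ) : Finset ℕ := (blk i).filter (fun d => 2^b ≤ Sg d ℓ (2^b))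

lemma Bb_card (ℓ : ℕ) (hℓ : Odd ℓ) : ∃ C : ℝ, 0 ≤ C ∧ ∀ i b : ℕ, 1 ≤ i → b ≤ i → 
    ((Bb ℓ i b).card : ℝ) ≤ C * ((2:ℝ)^b * Real.sqrt (2^i) * (i:ℝ)^3 + 2^(b*(ℓ+1)) / Real.sqrt (2^i)) := by
  obtain ⟨C, hC, h⟩ := FF hℓ
  refine ⟨C, hC, ?_⟩
  intro i b hi hb
  have h1 := h (2^i) (2^b) (by calc 2 = 2^1 := rfl
                                _ ≤ _ := Nat.pow_le_pow_right (by norm_num) hi) Nat.one_le_two_pow (Nat.pow_le_pow_right (by norm_num) hb)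
  have h2 : (2:ℝ)^b * ((Bb ℓ i b).card : ℝ) ≤ ∑ d ∈ blk i, (Sg d ℓ (2^b) : ℝ) := by
    calc (2:ℝ)^b * ((Bb ℓ i b).card : ℝ) = ∑ d ∈ Bb ℓ i b, (2:ℝ)^b := by rw [Finset.sum_const, nsmul_eq_mul]; ring
      _ ≤ ∑ d ∈ Bb ℓ i b, (Sg d ℓ (2^b) : ℝ) := by
          apply Finset.sum_le_sum
          intro d hd
          exact_mod_cast (Finset.mem_filter.1 hd).2
      _ ≤ _ := Finset.sum_le_sum_of_subset_of_nonneg (Finset.filter_subset _ _) (fun _ _ _ => Nat.cast_nonneg _)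
  have h3 : Real.log ((2^i:ℕ):ℝ) ≤ i := by
    push_cast
    rw [Real.log_pow]
    have := Real.log_two_lt_d9
    have hi0 : (0:ℝ) ≤ i := Nat.cast_nonneg i
    nlinarith
  have h30 : 0 ≤ Real.log ((2^i:ℕ):ℝ) := Real.log_natCast_nonneg _
  have h4 := h2.trans h1
  push_cast at h4 h3 h30
  have h5 : (2:ℝ)^b * ((Bb ℓ i b).card : ℝ) ≤ (2:ℝ)^b * (C * ((2:ℝ)^b * Real.sqrt (2^i) * (i:ℝ)^3 + 2^(b*(ℓ+1)) / Real.sqrt (2^i))) := by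
    refine h4.trans ?_
    calc C * (((2:ℝ)^b)^2 * Real.sqrt (2^i) * (Real.log (2^i))^3 + ((2:ℝ)^b)^(ℓ+2) / Real.sqrt (2^i))
        ≤ C * (((2:ℝ)^b)^2 * Real.sqrt (2^i) * (i:ℝ)^3 + ((2:ℝ)^b)^(ℓ+2) / Real.sqrt (2^i)) := by gcongr
      _ = _ := by
        rw [pow_mul (2:ℝ) b (ℓ+1)]; ring
  exact le_of_mul_le_mul_left h5 (by positivity)

lemma idx_le_i (ℓ i d : ℕ) (hℓ : 5 ≤ ℓ) (hi : 1000 * ℓ ≤ i) : (idx (zz ℓ i) d : ℝ) ≤ i := by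
  obtain ⟨f1, f2, f3, f4, f5, f6, f7, f8⟩ := zz_facts ℓ i hℓ hi
  refine (idx_le_log (zz ℓ i) d f8).trans ?_
  rw [zz]; push_cast
  rw [Real.log_pow]
  have h1 : i/(40*ℓ) * 4 ≤ i := by
    have := Nat.div_mul_le_self i (40*ℓ)
    nlinarith
  have h2 : ((i/(40*ℓ) : ℕ):ℝ) * 4 ≤ i := by exact_mod_cast h1
  have := Real.log_two_lt_d9
  have h0 : (0:ℝ) ≤ ((i/(40*ℓ) : ℕ):ℝ) := Nat.cast_nonneg _
  nlinarith

lemma Bb_sum (ℓ : ℕ) (hℓ : Odd ℓ) (hℓ5 : 5 ≤ ℓ) : ∃ C : ℝ, 0 ≤ C ∧ ∀ i b : ℕ, 1000 * ℓ ≤ i → b ≤ i → 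
    ∑ d ∈ Bb ℓ i b, (idx (zz ℓ i) d : ℝ)^6 ≤ C * ((2:ℝ)^b * Real.sqrt (2^i) * (i:ℝ)^9 + Real.sqrt (2^i) * Real.sqrt (2^(b*(ℓ+1)) / Real.sqrt (2^i))) := by
  obtain ⟨C, hC, h⟩ := Bb_card ℓ hℓ
  obtain ⟨C1, hC1, h1⟩ := D1
  refine ⟨2 * C + Real.sqrt (2 * C * C1), by positivity, ?_⟩
  intro i b hi hb
  obtain ⟨f1, f2, f3, f4, f5, f6, f7, f8⟩ := zz_facts ℓ i hℓ5 hi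
  have g := h i b (by omega) hb
  have g1 := h1 (2^i) (zz ℓ i) f1
  set u : ℝ := (2:ℝ)^b * Real.sqrt (2^i) * (i:ℝ)^3 with hu
  set v : ℝ := 2^(b*(ℓ+1)) / Real.sqrt (2^i) with hv
  have hu0 : 0 ≤ u := by positivity
  have hv0 : 0 ≤ v := by positivity
  have e : (2:ℝ)^b * Real.sqrt (2^i) * (i:ℝ)^9 = u * (i:ℝ)^6 := by rw [hu]; ring
  rw [e]
  have hui : 0 ≤ u * (i:ℝ)^6 := by positivity
  have hvi : 0 ≤ Real.sqrt (2^i) * Real.sqrt v := by positivity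
  have hq : 0 ≤ Real.sqrt (2 * C * C1) := Real.sqrt_nonneg _
  rcases le_total v u with huv | huv
  · calc ∑ d ∈ Bb ℓ i b, (idx (zz ℓ i) d : ℝ)^6 ≤ ∑ d ∈ Bb ℓ i b, (i:ℝ)^6 := by
          apply Finset.sum_le_sum
          intro d _
          exact pow_le_pow_left₀ (Nat.cast_nonneg _) (idx_le_i ℓ i d hℓ5 hi) 6
      _ = ((Bb ℓ i b).card : ℝ) * (i:ℝ)^6 := by rw [Finset.sum_const, nsmul_eq_mul]
      _ ≤ (C * (u + v)) * (i:ℝ)^6 := by gcongr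
      _ ≤ (C * (u + u)) * (i:ℝ)^6 := by gcongr
      _ = 2 * C * (u * (i:ℝ)^6) := by ring
      _ ≤ (2 * C + Real.sqrt (2 * C * C1)) * (u * (i:ℝ)^6 + Real.sqrt (2^i) * Real.sqrt v) := by
          apply mul_le_mul <;> first | linarith | positivity
  · have hcs : (∑ d ∈ Bb ℓ i b, (idx (zz ℓ i) d : ℝ)^6)^2 ≤ (2 * C * C1) * (2^i * v) := by
      calc (∑ d ∈ Bb ℓ i b, (idx (zz ℓ i) d : ℝ)^6)^2 ≤ ((Bb ℓ i b).card : ℝ) * ∑ d ∈ Bb ℓ i b, ((idx (zz ℓ i) d : ℝ)^6)^2 := sq_sum_le_card_mul_sum_sq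
        _ = ((Bb ℓ i b).card : ℝ) * ∑ d ∈ Bb ℓ i b, (idx (zz ℓ i) d : ℝ)^12 := by
            congr 1; apply Finset.sum_congr rfl; intro d _; rw [← pow_mul]
        _ ≤ (C * (v + v)) * (C1 * 2^i) := by
            apply mul_le_mul (g.trans (by gcongr)) _ (Finset.sum_nonneg (fun _ _ => by positivity)) (by positivity)
            refine le_trans (Finset.sum_le_sum_of_subset_of_nonneg (Finset.filter_subset _ _) (fun _ _ _ => by positivity)) (g1.trans (le_of_eq ?_))
            push_cast; rfl
        _ = _ := by ring
    have := Real.le_sqrt_of_sq_le hcs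
    rw [Real.sqrt_mul (by positivity : (0:ℝ) ≤ 2 * C * C1), Real.sqrt_mul (by positivity : (0:ℝ) ≤ 2^i)] at this
    refine this.trans ?_
    apply mul_le_mul <;> first | linarith | positivity

lemma sqrt_two_pow (i : ℕ) : Real.sqrt ((2:ℝ)^i) = (2:ℝ)^((i:ℝ)/2) := by
  rw [Real.sqrt_eq_rpow, ← Real.rpow_natCast, ← Real.rpow_mul (by norm_num)]
  congr 1; ring

noncomputable def tht (ℓ : ℕ) : ℝ := 1 - 3 / ((ℓ:ℝ) + 1)

lemma eb_facts (ℓ i : ℕ) : (eb ℓ i : ℝ) * (2 * (ℓ + 1)) ≤ 3 * i ∧ (3 * i : ℝ) ≤ ((eb ℓ i : ℝ) + 1) * (2 * (ℓ + 1)) := by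
  have h1 : eb ℓ i * (2*(ℓ+1)) ≤ 3 * i := Nat.div_mul_le_self _ _
  have h2 : 3 * i < (eb ℓ i + 1) * (2*(ℓ+1)) := (Nat.div_lt_iff_lt_mul (by omega)).1 (Nat.lt_succ_self _)
  constructor
  · exact_mod_cast h1
  · exact_mod_cast h2.le

lemma Q3 (ℓ i : ℕ) : (2:ℝ)^i / 4^(eb ℓ i) ≤ 4 * (2:ℝ)^(tht ℓ * i) := by
  obtain ⟨h1, h2⟩ := eb_facts ℓ i
  have e1 : (2:ℝ)^i / 4^(eb ℓ i) = (2:ℝ)^((i:ℝ) - 2 * eb ℓ i) := by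
    rw [Real.rpow_sub (by norm_num), Real.rpow_natCast]
    congr 1
    rw [Real.rpow_mul (by norm_num), Real.rpow_natCast]; norm_num
  have e2 : (4:ℝ) * (2:ℝ)^(tht ℓ * i) = (2:ℝ)^(2 + tht ℓ * i) := by
    rw [Real.rpow_add (by norm_num)]; norm_num
  rw [e1, e2]
  apply Real.rpow_le_rpow_of_exponent_le (by norm_num)
  rw [tht]
  have hl : (0:ℝ) < (ℓ:ℝ) + 1 := by positivity
  have : 3 / ((ℓ:ℝ) + 1) * i ≤ 2 * eb ℓ i + 2 := by
    rw [div_mul_eq_mul_div, div_le_iff₀ hl]; linarith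
  linarith

lemma geo_le (r : ℝ) (hr : 2 ≤ r) (n : ℕ) : ∑ b ∈ Finset.range (n+1), r^b ≤ 2 * r^n := by
  induction n with
  | zero => simp
  | succ n ih =>
    rw [Finset.sum_range_succ, pow_succ]
    have : 0 ≤ r^n := by positivity
    nlinarith

lemma geo2_le (a n : ℕ) : ∑ b ∈ Finset.Ioc a n, (1:ℝ)/2^b ≤ 1/2^a := by
  rcases le_total a n with h | h
  · have : ∑ b ∈ Finset.Ioc a n, (1:ℝ)/2^b = 1/2^a - 1/2^n := by
      induction n, h using Nat.le_induction with
      | base => simp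
      | succ n hn ih =>
        have hsplit : Finset.Ioc a (n+1) = insert (n+1) (Finset.Ioc a n) := by
          ext x; simp only [Finset.mem_Ioc, Finset.mem_insert]; omega
        rw [hsplit, Finset.sum_insert (by simp), ih, pow_succ]
        field_simp
        ring
    rw [this]
    have : (0:ℝ) ≤ 1/2^n := by positivity
    linarith
  · rw [Finset.Ioc_eq_empty (by omega), Finset.sum_empty]; positivity

lemma Q2 (ℓ i m : ℕ) (hm : ℓ = 2 * m + 3) (hm1 : 1 ≤ m) : 
    ∑ b ∈ Finset.Ioc (ea ℓ i) (eb ℓ i), 1/4^b * (Real.sqrt ((2:ℝ)^i) * Real.sqrt (2^(b*(ℓ+1)) / Real.sqrt ((2:ℝ)^i))) ≤ 8 * (2:ℝ)^(tht ℓ * i) := by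
  have e : ∀ b : ℕ, 1/4^b * (Real.sqrt ((2:ℝ)^i) * Real.sqrt (2^(b*(ℓ+1)) / Real.sqrt ((2:ℝ)^i))) = (2:ℝ)^((i:ℝ)/4) * ((2:ℝ)^m)^b := by
    intro b
    have e1 : (1:ℝ)/4^b = (2:ℝ)^(-(2*(b:ℝ))) := by
      rw [Real.rpow_neg (by norm_num), Real.rpow_mul (by norm_num), Real.rpow_natCast]; norm_num
    have e2 : ((2:ℝ)^m)^b = (2:ℝ)^((m:ℝ)*b) := by
      rw [Real.rpow_mul (by norm_num), Real.rpow_natCast, Real.rpow_natCast]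
    have e3 : (2:ℝ)^(b*(ℓ+1)) / Real.sqrt ((2:ℝ)^i) = (2:ℝ)^((b:ℝ)*(2*m+4) - (i:ℝ)/2) := by
      rw [sqrt_two_pow, Real.rpow_sub (by norm_num), hm, ← Real.rpow_natCast]
      congr 2; push_cast; ring
    rw [e1, e2, e3, sqrt_two_pow, Real.sqrt_eq_rpow, ← Real.rpow_mul (by norm_num), ← Real.rpow_add (by norm_num),
      ← Real.rpow_add (by norm_num), ← Real.rpow_add (by norm_num)]
    congr 1; ring
  rw [Finset.sum_congr rfl (fun b _ => e b), ← Finset.mul_sum]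
  have h2m : (2:ℝ) ≤ 2^m := by
    calc (2:ℝ) = 2^1 := by norm_num
      _ ≤ _ := pow_le_pow_right₀ (by norm_num) hm1
  have h1 : ∑ b ∈ Finset.Ioc (ea ℓ i) (eb ℓ i), ((2:ℝ)^m)^b ≤ 2 * ((2:ℝ)^m)^(eb ℓ i) := by
    refine le_trans ?_ (geo_le _ h2m (eb ℓ i))
    apply Finset.sum_le_sum_of_subset_of_nonneg
    · intro b hb
      rw [Finset.mem_Ioc] at hb; rw [Finset.mem_range]; omega
    · intro _ _ _; positivity
  obtain ⟨h3, h4⟩ := eb_facts ℓ i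
  have h5 : (2:ℝ)^((i:ℝ)/4) * ((2:ℝ)^m)^(eb ℓ i) ≤ (2:ℝ)^i / 4^(eb ℓ i) := by
    rw [le_div_iff₀ (by positivity)]
    have e2 : ((2:ℝ)^m)^(eb ℓ i) = (2:ℝ)^((m:ℝ)*eb ℓ i) := by
      rw [Real.rpow_mul (by norm_num), Real.rpow_natCast, Real.rpow_natCast]
    have e1 : (4:ℝ)^(eb ℓ i) = (2:ℝ)^((2:ℝ)*(eb ℓ i:ℝ)) := by
      rw [Real.rpow_mul (by norm_num), Real.rpow_natCast]; norm_num
    rw [e1, e2, ← Real.rpow_natCast 2 i, ← Real.rpow_add (by norm_num), ← Real.rpow_add (by norm_num)]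
    apply Real.rpow_le_rpow_of_exponent_le (by norm_num)
    have : (ℓ:ℝ) = 2 * m + 3 := by exact_mod_cast hm
    rw [this] at h3
    linarith
  have h6 := Q3 ℓ i
  calc (2:ℝ)^((i:ℝ)/4) * ∑ b ∈ Finset.Ioc (ea ℓ i) (eb ℓ i), ((2:ℝ)^m)^b ≤ (2:ℝ)^((i:ℝ)/4) * (2 * ((2:ℝ)^m)^(eb ℓ i)) := by gcongr
    _ = 2 * ((2:ℝ)^((i:ℝ)/4) * ((2:ℝ)^m)^(eb ℓ i)) := by ring
    _ ≤ 2 * (4 * (2:ℝ)^(tht ℓ * i)) := mul_le_mul_of_nonneg_left (h5.trans h6) (by norm_num)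
    _ = _ := by ring

lemma Q1 (ℓ : ℕ) (hℓ : 5 ≤ ℓ) : ∃ C : ℝ, 0 ≤ C ∧ ∀ i : ℕ, 
    ∑ b ∈ Finset.Ioc (ea ℓ i) (eb ℓ i), 1/4^b * ((2:ℝ)^b * Real.sqrt (2^i) * (i:ℝ)^9) ≤ C * (2:ℝ)^(tht ℓ * i) := by
  have hl5 : (5:ℝ) ≤ ℓ := by exact_mod_cast hℓ
  have hl0 : (0:ℝ) < ℓ := by linarith
  set δ : ℝ := tht ℓ - 1/2 + 1/(2*ℓ) with hδ
  have hδ0 : 0 < δ := by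
    have : δ = ((ℓ:ℝ)^2 - 4 * ℓ + 1) / (2 * ℓ * (ℓ + 1)) := by
      rw [hδ, tht]; field_simp; ring
    rw [this]
    apply div_pos _ (by positivity)
    nlinarith
  obtain ⟨C, hC, h⟩ := poly_exp 9 δ hδ0
  refine ⟨4 * C, by positivity, ?_⟩
  intro i
  have e : ∀ b : ℕ, 1/4^b * ((2:ℝ)^b * Real.sqrt (2^i) * (i:ℝ)^9) = Real.sqrt (2^i) * (i:ℝ)^9 * (1/2^b) := by
    intro b
    rw [show (4:ℝ) = 2 * 2 by norm_num, mul_pow]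
    field_simp
  rw [Finset.sum_congr rfl (fun b _ => e b), ← Finset.mul_sum]
  have h1 : (i:ℝ) - 3 ≤ ((ea ℓ i : ℝ) + 1) * (2*ℓ) := by
    have h2 : i - 3 < (ea ℓ i + 1) * (2*ℓ) := (Nat.div_lt_iff_lt_mul (by omega)).1 (Nat.lt_succ_self _)
    have h3 : i ≤ (ea ℓ i + 1) * (2*ℓ) + 3 := by omega
    have h4 : (i:ℝ) ≤ ((ea ℓ i : ℝ) + 1) * (2*ℓ) + 3 := by exact_mod_cast h3
    linarith
  have h2 : (i:ℝ) / (2*ℓ) - 2 ≤ ea ℓ i := by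
    rw [sub_le_iff_le_add, div_le_iff₀ (by positivity)]
    nlinarith
  have h3 : (1:ℝ)/2^(ea ℓ i) ≤ (2:ℝ)^(2 - (i:ℝ)/(2*ℓ)) := by
    rw [one_div, ← Real.rpow_natCast, ← Real.rpow_neg (by norm_num)]
    apply Real.rpow_le_rpow_of_exponent_le (by norm_num)
    linarith
  calc Real.sqrt (2^i) * (i:ℝ)^9 * ∑ b ∈ Finset.Ioc (ea ℓ i) (eb ℓ i), (1:ℝ)/2^b
      ≤ Real.sqrt (2^i) * (C * (2:ℝ)^(δ * i)) * (2:ℝ)^(2 - (i:ℝ)/(2*ℓ)) := by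
        have := (geo2_le (ea ℓ i) (eb ℓ i)).trans h3
        have := h i
        gcongr
    _ = C * ((2:ℝ)^((i:ℝ)/2) * (2:ℝ)^(δ * i) * (2:ℝ)^(2 - (i:ℝ)/(2*ℓ))) := by rw [sqrt_two_pow]; ring
    _ = C * (2:ℝ)^(2 + tht ℓ * i) := by
        rw [← Real.rpow_add (by norm_num), ← Real.rpow_add (by norm_num)]
        congr 2
        rw [hδ]; field_simp; ring
    _ = _ := by rw [Real.rpow_add (by norm_num)]; norm_num; ring

theorem H3 (ℓ : ℕ) (hℓo : Odd ℓ) (hℓ : 5 ≤ ℓ) : ∃ C : ℝ, 0 ≤ C ∧ ∃ i0 : ℕ, 1000 * ℓ ≤ i0 ∧ ∀ i : ℕ, i0 ≤ i → 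
    ∑ d ∈ (blk i).filter (fun d => Squarefree d ∧ ¬ exc (zz ℓ i) (2^i) d), (clTor (Qneg d) ℓ : ℝ)^2 ≤ C * (2^i * (2:ℝ)^(tht ℓ * i)) := by
  obtain ⟨C0, hC0, i0, hi0, h⟩ := H1 ℓ hℓ
  obtain ⟨C1, hC1, h1⟩ := D1
  obtain ⟨C2, hC2, h2⟩ := Bb_sum ℓ hℓo hℓ
  obtain ⟨C3, hC3, h3⟩ := Q1 ℓ hℓ
  obtain ⟨m, hm⟩ : ∃ m, ℓ = 2 * m + 3 := by
    obtain ⟨t, ht⟩ := hℓo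
    exact ⟨t - 1, by omega⟩
  refine ⟨C0 * (C1 * 4 + 4 * (C2 * (C3 + 8))), by positivity, i0, hi0, ?_⟩
  intro i hi
  have hil : 1000 * ℓ ≤ i := hi0.trans hi
  obtain ⟨f1, f2, f3, f4, f5, f6, f7, f8⟩ := zz_facts ℓ i hℓ hil
  set z := zz ℓ i with hz
  set Y : ℝ := (2:ℝ)^(tht ℓ * i) with hY
  have s1 : ∑ d ∈ blk i, (idx z d : ℝ)^6 ≤ C1 * 2^i := by
    have := h1 (2^i) z f1
    push_cast at this
    refine le_trans ?_ this
    apply Finset.sum_le_sum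
    intro d _
    exact pow_le_pow_right₀ (by exact_mod_cast idx_pos z d) (by norm_num)
  calc ∑ d ∈ (blk i).filter (fun d => Squarefree d ∧ ¬ exc z (2^i) d), (clTor (Qneg d) ℓ : ℝ)^2 
      ≤ ∑ d ∈ (blk i).filter (fun d => Squarefree d ∧ ¬ exc z (2^i) d), C0 * 2^i * (idx z d : ℝ)^6 * 
      (1/4^(eb ℓ i) + 4 * ∑ b ∈ Finset.Ioc (ea ℓ i) (eb ℓ i), if 2^b ≤ Sg d ℓ (2^b) then (1:ℝ)/4^b else 0) := by
        apply Finset.sum_le_sum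
        intro d hd
        rw [Finset.mem_filter, blk, Finset.mem_Ico] at hd
        exact h i hi d hd.1.1 hd.1.2 hd.2.1 hd.2.2
    _ ≤ ∑ d ∈ blk i, C0 * 2^i * (idx z d : ℝ)^6 * 
      (1/4^(eb ℓ i) + 4 * ∑ b ∈ Finset.Ioc (ea ℓ i) (eb ℓ i), if 2^b ≤ Sg d ℓ (2^b) then (1:ℝ)/4^b else 0) := by
        apply Finset.sum_le_sum_of_subset_of_nonneg (Finset.filter_subset _ _)
        intro d _ _
        have : 0 ≤ ∑ b ∈ Finset.Ioc (ea ℓ i) (eb ℓ i), if 2^b ≤ Sg d ℓ (2^b) then (1:ℝ)/4^b else 0 :=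
          Finset.sum_nonneg (fun b _ => by split_ifs <;> positivity)
        positivity
    _ = C0 * 2^i * ((∑ d ∈ blk i, (idx z d : ℝ)^6) * (1/4^(eb ℓ i)) + 
          4 * ∑ b ∈ Finset.Ioc (ea ℓ i) (eb ℓ i), 1/4^b * ∑ d ∈ Bb ℓ i b, (idx z d : ℝ)^6) := by
        have e1 : ∑ b ∈ Finset.Ioc (ea ℓ i) (eb ℓ i), (1:ℝ)/4^b * ∑ d ∈ Bb ℓ i b, (idx z d : ℝ)^6 = 
            ∑ d ∈ blk i, (idx z d : ℝ)^6 * ∑ b ∈ Finset.Ioc (ea ℓ i) (eb ℓ i), if 2^b ≤ Sg d ℓ (2^b) then (1:ℝ)/4^b else 0 := by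
          simp_rw [Finset.mul_sum, Bb, Finset.sum_filter]
          rw [Finset.sum_comm]
          apply Finset.sum_congr rfl
          intro d _
          apply Finset.sum_congr rfl
          intro b _
          split_ifs <;> ring
        rw [e1, Finset.sum_mul, Finset.mul_sum, ← Finset.sum_add_distrib, Finset.mul_sum]
        apply Finset.sum_congr rfl
        intro d _
        ring
    _ ≤ C0 * 2^i * ((C1 * 4) * Y + 4 * (C2 * (C3 + 8) * Y)) := by
        have t1 : (∑ d ∈ blk i, (idx z d : ℝ)^6) * (1/4^(eb ℓ i)) ≤ (C1 * 4) * Y := by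
          calc _ ≤ (C1 * 2^i) * (1/4^(eb ℓ i)) := by gcongr
            _ = C1 * ((2:ℝ)^i / 4^(eb ℓ i)) := by ring
            _ ≤ C1 * (4 * Y) := by
                have := Q3 ℓ i
                gcongr
            _ = _ := by ring
        have t2 : ∑ b ∈ Finset.Ioc (ea ℓ i) (eb ℓ i), (1:ℝ)/4^b * ∑ d ∈ Bb ℓ i b, (idx z d : ℝ)^6 ≤ C2 * (C3 + 8) * Y := by
          calc _ ≤ ∑ b ∈ Finset.Ioc (ea ℓ i) (eb ℓ i), (1:ℝ)/4^b * (C2 * ((2:ℝ)^b * Real.sqrt (2^i) * (i:ℝ)^9 + Real.sqrt (2^i) * Real.sqrt (2^(b*(ℓ+1)) / Real.sqrt (2^i)))) := by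
                apply Finset.sum_le_sum
                intro b hb
                rw [Finset.mem_Ioc] at hb
                exact mul_le_mul_of_nonneg_left (h2 i b hil (hb.2.trans f5)) (by positivity)
            _ = C2 * (∑ b ∈ Finset.Ioc (ea ℓ i) (eb ℓ i), 1/4^b * ((2:ℝ)^b * Real.sqrt (2^i) * (i:ℝ)^9) + 
                ∑ b ∈ Finset.Ioc (ea ℓ i) (eb ℓ i), 1/4^b * (Real.sqrt ((2:ℝ)^i) * Real.sqrt (2^(b*(ℓ+1)) / Real.sqrt ((2:ℝ)^i)))) := by
                rw [← Finset.sum_add_distrib, Finset.mul_sum]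
                apply Finset.sum_congr rfl
                intro b _
                ring
            _ ≤ C2 * (C3 * Y + 8 * Y) := by
                apply mul_le_mul_of_nonneg_left _ hC2
                exact add_le_add (h3 i) (Q2 ℓ i m hm (by omega))
            _ = _ := by ring
        apply mul_le_mul_of_nonneg_left _ (by positivity)
        linarith
    _ = _ := by ring

lemma tht_pos (ℓ : ℕ) (hℓ : 5 ≤ ℓ) : 1/2 ≤ tht ℓ := by
  have hl5 : (5:ℝ) ≤ ℓ := by exact_mod_cast hℓ
  rw [tht]
  have : 3 / ((ℓ:ℝ) + 1) ≤ 1/2 := by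
    rw [div_le_div_iff₀ (by linarith) (by norm_num)]; linarith
  linarith

lemma clTor_le_hcl (d ℓ : ℕ) : clTor (Qneg d) ℓ ≤ hcl d := by
  unfold clTor hcl
  exact Nat.card_le_card_of_injective _ Subtype.val_injective

theorem H4 (ℓ : ℕ) (hℓ : 5 ≤ ℓ) : ∃ C : ℝ, 0 ≤ C ∧ ∃ i0 : ℕ, ∀ i : ℕ, i0 ≤ i → 
    ∑ d ∈ (blk i).filter (fun d => Squarefree d ∧ exc (zz ℓ i) (2^i) d), (clTor (Qneg d) ℓ : ℝ)^2 ≤ C * (2^i * (2:ℝ)^(tht ℓ * i)) := by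
  obtain ⟨C1, hC1, h1⟩ := G1 (80*ℓ)
  obtain ⟨C2, hC2, x0, h2⟩ := D3 (80*ℓ) (by omega)
  obtain ⟨C3, hC3, h3⟩ := poly_exp (6*(80*ℓ) + 3) (tht ℓ) (by have := tht_pos ℓ hℓ; linarith)
  refine ⟨C1^2 * 2 * C2 * C3, by positivity, max (1000*ℓ) (x0 * (40*ℓ)), ?_⟩
  intro i hi
  have hil := (le_max_left _ _).trans hi
  obtain ⟨f1, f2, f3, f4, f5, f6, f7, f8⟩ := zz_facts ℓ i hℓ hil
  have hx0 : x0 ≤ zz ℓ i := by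
    refine le_trans ?_ f6
    rw [Nat.le_div_iff_mul_le (by omega)]
    exact (le_max_right _ _).trans hi
  have hi1 : (1:ℝ) ≤ i := by exact_mod_cast (by omega : 1 ≤ i)
  set z := zz ℓ i with hz
  set E := (blk i).filter (fun d => Squarefree d ∧ exc z (2^i) d) with hE
  have hT : ∀ d ∈ E, (clTor (Qneg d) ℓ : ℝ)^2 ≤ C1^2 * 2^i * (i:ℝ)^2 := by
    intro d hd
    rw [hE, Finset.mem_filter, blk, Finset.mem_Ico] at hd
    have g := h1 z (2^i) d f8 f1 f2 hd.1.1 hd.1.2 hd.2.1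
    have g1 : (clTor (Qneg d) ℓ : ℝ) ≤ C1 * Real.sqrt ((2^i:ℕ):ℝ) * i := by
      calc (clTor (Qneg d) ℓ : ℝ) ≤ hcl d := by exact_mod_cast clTor_le_hcl d ℓ
        _ ≤ _ := g
        _ ≤ _ := by
          have := idx_le_i ℓ i d hℓ hil
          gcongr
    have g2 := pow_le_pow_left₀ (Nat.cast_nonneg _) g1 2
    refine g2.trans (le_of_eq ?_)
    rw [mul_pow, mul_pow, Real.sq_sqrt (by positivity)]
    push_cast; rfl
  have hcard : (E.card : ℝ) ≤ 2 * C2 * (i:ℝ)^(6*(80*ℓ)+1) := by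
    set J := (Finset.range (i+1)).filter (fun j => 4 * z ≤ 2^j) with hJ
    set F : ℕ → Finset ℕ := fun j => (Finset.Ico (2^i) (2*2^i)).filter (fun d => Squarefree d ∧ 
      ∑ p ∈ pr (2^j/4) (2^j), chi d p ≤ -(1/2) * ((pr (2^j/4) (2^j)).card:ℝ)) with hF
    have hsub : E ⊆ J.biUnion F := by
      intro d hd
      rw [hE, Finset.mem_filter, blk] at hd
      obtain ⟨hd1, hd2, j, hj1, hj2, hj3⟩ := hd
      rw [Finset.mem_biUnion]
      refine ⟨j, ?_, ?_⟩
      · rw [hJ, Finset.mem_filter, Finset.mem_range]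
        have := (Nat.pow_le_pow_iff_right (by norm_num : 1 < 2)).1 hj2
        exact ⟨by omega, hj1⟩
      · rw [hF, Finset.mem_filter]
        exact ⟨hd1, hd2, hj3⟩
    have hFc : ∀ j ∈ J, ((F j).card : ℝ) ≤ C2 * (i:ℝ)^(6*(80*ℓ)) := by
      intro j hj
      rw [hJ, Finset.mem_filter, Finset.mem_range] at hj
      have g := h2 (2^i) (2^j) (by omega) (f2.trans (Nat.pow_le_pow_left (by omega) _))
      refine g.trans ?_
      have g1 : Real.log ((2^j:ℕ):ℝ) ≤ i := by
        push_cast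
        rw [Real.log_pow]
        have := Real.log_two_lt_d9
        have : (j:ℝ) ≤ i := by exact_mod_cast (by omega : j ≤ i)
        have hj0 : (0:ℝ) ≤ j := Nat.cast_nonneg j
        nlinarith
      have g0 : 0 ≤ Real.log ((2^j:ℕ):ℝ) := Real.log_natCast_nonneg _
      exact mul_le_mul_of_nonneg_left (pow_le_pow_left₀ g0 g1 _) hC2
    calc (E.card : ℝ) ≤ ((J.biUnion F).card : ℝ) := by exact_mod_cast Finset.card_le_card hsub
      _ ≤ ∑ j ∈ J, ((F j).card : ℝ) := by exact_mod_cast Finset.card_biUnion_le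
      _ ≤ ∑ j ∈ J, C2 * (i:ℝ)^(6*(80*ℓ)) := Finset.sum_le_sum hFc
      _ = (J.card : ℝ) * (C2 * (i:ℝ)^(6*(80*ℓ))) := by rw [Finset.sum_const, nsmul_eq_mul]
      _ ≤ (2 * i) * (C2 * (i:ℝ)^(6*(80*ℓ))) := by
          have : (J.card : ℝ) ≤ 2 * i := by
            have e : J.card ≤ i + 1 := by
              have := Finset.card_filter_le (Finset.range (i+1)) (fun j => 4 * z ≤ 2^j)
              rwa [Finset.card_range] at this
            have e2 : (J.card:ℝ) ≤ i + 1 := by exact_mod_cast e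
            linarith
          gcongr
      _ = _ := by rw [pow_succ]; ring
  calc ∑ d ∈ E, (clTor (Qneg d) ℓ : ℝ)^2 ≤ ∑ d ∈ E, C1^2 * 2^i * (i:ℝ)^2 := Finset.sum_le_sum hT
    _ = (E.card : ℝ) * (C1^2 * 2^i * (i:ℝ)^2) := by rw [Finset.sum_const, nsmul_eq_mul]
    _ ≤ (2 * C2 * (i:ℝ)^(6*(80*ℓ)+1)) * (C1^2 * 2^i * (i:ℝ)^2) := by gcongr
    _ = C1^2 * 2 * C2 * 2^i * (i:ℝ)^(6*(80*ℓ)+3) := by ring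
    _ ≤ C1^2 * 2 * C2 * 2^i * (C3 * (2:ℝ)^(tht ℓ * i)) := by
        have := h3 i
        gcongr
    _ = _ := by ring

noncomputable def sqTerm (ℓ d : ℕ) : ℝ := if Squarefree d then (clTor (Qneg d) ℓ : ℝ)^2 else 0

lemma sqTerm_nonneg (ℓ d : ℕ) : 0 ≤ sqTerm ℓ d := by
  unfold sqTerm; split_ifs <;> positivity

theorem H5 (ℓ : ℕ) (hℓo : Odd ℓ) (hℓ : 5 ≤ ℓ) : ∃ C : ℝ, 0 ≤ C ∧ ∀ i : ℕ, 
    ∑ d ∈ blk i, sqTerm ℓ d ≤ C * (2:ℝ)^((1 + tht ℓ) * i) := by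
  obtain ⟨C1, hC1, i1, _, h1⟩ := H3 ℓ hℓo hℓ
  obtain ⟨C2, hC2, i2, h2⟩ := H4 ℓ hℓ
  have hth := tht_pos ℓ hℓ
  set C3 := ∑ i ∈ Finset.range (max i1 i2), ∑ d ∈ blk i, sqTerm ℓ d with hC3
  have hbn : ∀ i, 0 ≤ ∑ d ∈ blk i, sqTerm ℓ d := fun i => Finset.sum_nonneg (fun d _ => sqTerm_nonneg ℓ d)
  have hC30 : 0 ≤ C3 := Finset.sum_nonneg (fun i _ => hbn i)
  refine ⟨C1 + C2 + C3, by positivity, ?_⟩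
  intro i
  have hge : 1 ≤ (2:ℝ)^((1 + tht ℓ) * i) := Real.one_le_rpow (by norm_num) (by positivity)
  rcases lt_or_ge i (max i1 i2) with hi | hi
  · have : ∑ d ∈ blk i, sqTerm ℓ d ≤ C3 := 
      Finset.single_le_sum (f := fun i => ∑ d ∈ blk i, sqTerm ℓ d) (fun i _ => hbn i) (Finset.mem_range.2 hi)
    nlinarith
  · have g1 := h1 i ((le_max_left _ _).trans hi)
    have g2 := h2 i ((le_max_right _ _).trans hi)
    have e : (2:ℝ)^((1 + tht ℓ) * i) = 2^i * (2:ℝ)^(tht ℓ * i) := by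
      rw [add_mul, one_mul, Real.rpow_add (by norm_num), Real.rpow_natCast]
    have e2 : ∑ d ∈ blk i, sqTerm ℓ d = ∑ d ∈ (blk i).filter (fun d => Squarefree d ∧ ¬ exc (zz ℓ i) (2^i) d), (clTor (Qneg d) ℓ : ℝ)^2
       + ∑ d ∈ (blk i).filter (fun d => Squarefree d ∧ exc (zz ℓ i) (2^i) d), (clTor (Qneg d) ℓ : ℝ)^2 := by
      rw [Finset.sum_filter, Finset.sum_filter, ← Finset.sum_add_distrib]
      apply Finset.sum_congr rfl
      intro d _
      unfold sqTerm
      by_cases a : Squarefree d <;> by_cases b : exc (zz ℓ i) (2^i) d <;> simp [a, b]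
    rw [e2, e]
    have : 0 ≤ C3 * (2^i * (2:ℝ)^(tht ℓ * i)) := by positivity
    nlinarith

lemma blk_cover (n : ℕ) : Finset.Icc 1 n ⊆ (Finset.range (Nat.log 2 n + 1)).biUnion blk := by
  intro d hd
  rw [Finset.mem_Icc] at hd
  rw [Finset.mem_biUnion]
  refine ⟨Nat.log 2 d, ?_, ?_⟩
  · rw [Finset.mem_range]
    have := Nat.log_mono_right (b := 2) hd.2
    omega
  · rw [blk, Finset.mem_Ico]
    refine ⟨Nat.pow_log_le_self 2 (by omega), ?_⟩
    have := Nat.lt_pow_succ_log_self (b := 2) (by norm_num) d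
    rw [pow_succ] at this; omega

theorem H6 (ℓ : ℕ) (hℓo : Odd ℓ) (hℓ : 5 ≤ ℓ) : ∃ C : ℝ, ∀ X : ℝ, 2 ≤ X → 
    ∑ d ∈ Finset.Icc 1 ⌊X⌋₊, sqTerm ℓ d ≤ C * X ^ (1 + tht ℓ) := by
  obtain ⟨C, hC, h⟩ := H5 ℓ hℓo hℓ
  refine ⟨2 * C, ?_⟩
  intro X hX
  have hth := tht_pos ℓ hℓ
  set n := ⌊X⌋₊ with hn
  have hn2 : 2 ≤ n := Nat.le_floor (by exact_mod_cast hX)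
  have hnX : (n:ℝ) ≤ X := Nat.floor_le (by linarith)
  set L := Nat.log 2 n with hL
  have hLn : 2^L ≤ n := Nat.pow_log_le_self 2 (by omega)
  set r : ℝ := (2:ℝ)^(1 + tht ℓ) with hr
  have hr2 : 2 ≤ r := by
    calc (2:ℝ) = (2:ℝ)^(1:ℝ) := by norm_num
      _ ≤ _ := Real.rpow_le_rpow_of_exponent_le (by norm_num) (by linarith)
  calc ∑ d ∈ Finset.Icc 1 n, sqTerm ℓ d ≤ ∑ d ∈ (Finset.range (L+1)).biUnion blk, sqTerm ℓ d :=
        Finset.sum_le_sum_of_subset_of_nonneg (blk_cover n) (fun d _ _ => sqTerm_nonneg ℓ d)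
    _ ≤ ∑ i ∈ Finset.range (L+1), ∑ d ∈ blk i, sqTerm ℓ d := by
        rw [Finset.sum_biUnion]
        have hlog : ∀ i d : ℕ, d ∈ blk i → Nat.log 2 d = i := by
          intro i d hd
          rw [blk, Finset.mem_Ico] at hd
          exact Nat.log_eq_of_pow_le_of_lt_pow hd.1 (by rw [pow_succ]; omega)
        intro i _ j _ hij
        rw [Function.onFun, Finset.disjoint_left]
        intro d hd1 hd2
        exact hij ((hlog i d hd1).symm.trans (hlog j d hd2))
    _ ≤ ∑ i ∈ Finset.range (L+1), C * r^i := by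
        apply Finset.sum_le_sum
        intro i _
        have := h i
        rwa [Real.rpow_mul (by norm_num), Real.rpow_natCast] at this
    _ = C * ∑ i ∈ Finset.range (L+1), r^i := by rw [Finset.mul_sum]
    _ ≤ C * (2 * r^L) := mul_le_mul_of_nonneg_left (geo_le r hr2 L) hC
    _ = 2 * C * ((2:ℝ)^L)^(1 + tht ℓ) := by
        rw [hr, ← Real.rpow_natCast, ← Real.rpow_natCast, ← Real.rpow_mul (by norm_num), ← Real.rpow_mul (by norm_num)]
        rw [mul_comm (1 + tht ℓ)]; ring
    _ ≤ 2 * C * X^(1 + tht ℓ) := by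
        have : (2:ℝ)^L ≤ X := le_trans (by exact_mod_cast hLn) hnX
        have h0 : 0 ≤ 1 + tht ℓ := by linarith
        gcongr

/-- **Heath-Brown–Pierce.** For each prime `ℓ ≥ 5` there is a constant `C = C(ℓ)` such that
for every real `X ≥ 2`, the sum over squarefree `0 < d ≤ X` of `|Cl_{ℚ(√-d)}[ℓ]|²` is at
most `C · X^{2 - 3/(ℓ+1)}`. -/
theorem second_moment_ell_torsion_imaginary_quadratic (ℓ : ℕ) (hℓ : ℓ.Prime)
    (hℓ5 : 5 ≤ ℓ) :
    ∃ C : ℝ, ∀ X : ℝ, 2 ≤ X →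
      (∑ d ∈ Finset.Icc 1 ⌊X⌋₊, if Squarefree d then (clTor (Qneg d) ℓ : ℝ) ^ 2 else 0)
        ≤ C * X ^ (2 - 3 / ((ℓ : ℝ) + 1)) := by
  obtain ⟨C, h⟩ := H6 ℓ (hℓ.odd_of_ne_two (by omega)) hℓ5
  refine ⟨C, fun X hX => ?_⟩
  have h1 := h X hX
  have e : 1 + tht ℓ = 2 - 3 / ((ℓ : ℝ) + 1) := by rw [tht]; ring
  rw [e] at h1
  exact h1
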